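/- Let Ω ⊂ (0,1) be a lacunary sequence converging to 0 and let {R_n}_{n∈ℕ} be a process such that for every n ∈ ℕ the slope of R_n belongs to Ω. Then for every 1 < p ≤ ∞, {R_n}_{n∈ℕ} is a p-good process: for every probability space (X,𝒜,μ), every pair S,T of commuting, invertible, measure-preserving, ergodic transformations of X, and every f ∈ L^p(X), the averages M_n f converge almost everywhere as n → ∞. -/

import Mathlib

open MeasureTheory Filter Topology Set
open scoped ENNReal Pointwise BigOperators

noncomputable section

/-- A (possibly tilted) closed rectangle in the plane, described by a corner,
an angle, and two positive side lengths. -/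
structure Rect where
  corner : ℝ × ℝ
  angle : ℝ
  len1 : ℝ
  len2 : ℝ
  len1_pos : 0 < len1
  len2_pos : 0 < len2

namespace Rect

/-- The set of points of a rectangle. -/
def carrier (R : Rect) : Set (ℝ × ℝ) :=
  {p | ∃ s t : ℝ, s ∈ Icc (0 : ℝ) R.len1 ∧ t ∈ Icc (0 : ℝ) R.len2 ∧
    p = R.corner + s • (Real.cos R.angle, Real.sin R.angle) +
      t • (-Real.sin R.angle, Real.cos R.angle)}

/-- `l(R)`: the length of the shortest side. -/
def shortSide (R : Rect) : ℝ := min R.len1 R.len2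

/-- `L(R)`: the length of the longest side. -/
def longSide (R : Rect) : ℝ := max R.len1 R.len2

/-- The slope of a rectangle: the tangent of the angle formed between its longest
side and the horizontal axis (canonical choice for squares). -/
def slope (R : Rect) : ℝ :=
  if R.len2 ≤ R.len1 then Real.tan R.angle else Real.tan (R.angle + Real.pi / 2)

end Rect

/-- The integer lattice points lying in a planar set. -/
def latticePts (F : Set (ℝ × ℝ)) : Set (ℤ × ℤ) := {p | ((p.1 : ℝ), (p.2 : ℝ)) ∈ F}

/-- `#(F ∩ ℤ²)`: the number of integer lattice points in `F`. -/
def latticeCount (F : Set (ℝ × ℝ)) : ℕ := (latticePts F).ncard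

/-- A process: a sequence of rectangles containing `(0,0)` whose shortest sides
tend to infinity. -/
def IsProcess (R : ℕ → Rect) : Prop :=
  (∀ n, ((0 : ℝ), (0 : ℝ)) ∈ (R n).carrier) ∧
    Tendsto (fun n => (R n).shortSide) atTop atTop

variable {X : Type*} [MeasurableSpace X]

/-- The ergodic average `M_R f(x) = (1/#(R ∩ ℤ²)) ∑_{(i,j) ∈ R ∩ ℤ²} f(S^i T^j x)`. -/
def ergAvg (S T : X ≃ᵐ X) (R : Rect) (f : X → ℝ) (x : X) : ℝ :=
  (latticeCount R.carrier : ℝ)⁻¹ *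
    ∑ᶠ p ∈ latticePts R.carrier, f ((S.toEquiv ^ p.1) ((T.toEquiv ^ p.2) x))

/-- The maximal operator `M* f = sup_n M_n |f|`. -/
def maxOp (S T : X ≃ᵐ X) (R : ℕ → Rect) (f : X → ℝ) (x : X) : ℝ≥0∞ :=
  ⨆ n, ENNReal.ofReal (ergAvg S T (R n) (fun y => |f y|) x)

/-- The maximal operator `M'* f = sup_n |M_n f|`. -/
def maxOpAbs (S T : X ≃ᵐ X) (R : ℕ → Rect) (f : X → ℝ) (x : X) : ℝ≥0∞ :=
  ⨆ n, ENNReal.ofReal |ergAvg S T (R n) f x|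

/-- `S, T` form a pair of commuting, invertible, measure-preserving, ergodic
transformations of the probability space `(X, μ)`. -/
structure ErgodicSetup (μ : Measure X) (S T : X ≃ᵐ X) : Prop where
  prob : IsProbabilityMeasure μ
  measPres_S : MeasurePreserving (⇑S) μ μ
  measPres_T : MeasurePreserving (⇑T) μ μ
  comm : ∀ x, S (T x) = T (S x)
  erg_S : Ergodic (⇑S) μ
  erg_T : Ergodic (⇑T) μ

/-- An operator `M` is of weak-type `(p,p)`. -/
def IsWeakType (μ : Measure X) (M : (X → ℝ) → X → ℝ≥0∞) (p : ℝ) : Prop :=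
  ∃ C : ℝ, 0 < C ∧ ∀ f : X → ℝ, MemLp f (ENNReal.ofReal p) μ → ∀ lam : ℝ, 0 < lam →
    μ {x | ENNReal.ofReal lam < M f x} ≤
      ENNReal.ofReal (C * ((eLpNorm f (ENNReal.ofReal p) μ).toReal / lam) ^ p)

/-- The averages `M_n f` converge almost everywhere. -/
def AEConverges (μ : Measure X) (S T : X ≃ᵐ X) (R : ℕ → Rect) (f : X → ℝ) : Prop :=
  ∀ᵐ x ∂μ, ∃ L : ℝ, Tendsto (fun n => ergAvg S T (R n) f x) atTop (𝓝 L)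

/-- The maximal operator `M*` satisfies a Tauberian condition. -/
def ErgTauberian (μ : Measure X) (S T : X ≃ᵐ X) (R : ℕ → Rect) : Prop :=
  ∀ lam : ℝ, 0 < lam → lam < 1 → ∃ C : ℝ, 0 < C ∧ ∀ A : Set X, MeasurableSet A →
    0 < μ A → μ A < ⊤ →
    μ {x | ENNReal.ofReal lam < maxOp S T R (A.indicator fun _ => (1 : ℝ)) x} ≤
      ENNReal.ofReal C * μ A

/-- A `p`-good process: on every probability space with a commuting, invertible,
measure-preserving, ergodic pair, the averages converge a.e. for every `f ∈ L^p`. -/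
def IsGoodProcess (R : ℕ → Rect) (p : ℝ≥0∞) : Prop :=
  ∀ (Y : Type) [MeasurableSpace Y], ∀ (μ : Measure Y) (S T : Y ≃ᵐ Y),
    ErgodicSetup μ S T → ∀ f : Y → ℝ, MemLp f p μ → AEConverges μ S T R f

/-- The discrete average `A_R φ(k,l)`. -/
def discAvg (R : Rect) (φ : ℤ × ℤ → ℝ) (kl : ℤ × ℤ) : ℝ :=
  (latticeCount R.carrier : ℝ)⁻¹ *
    ∑ᶠ p ∈ latticePts R.carrier, φ (kl.1 + p.1, kl.2 + p.2)

/-- The discrete maximal operator `A* φ = sup_n A_n |φ|`. -/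
def discMaxOp (R : ℕ → Rect) (φ : ℤ × ℤ → ℝ) (kl : ℤ × ℤ) : ℝ≥0∞ :=
  ⨆ n, ENNReal.ofReal (discAvg (R n) (fun q => |φ q|) kl)

/-- The `N`-truncated discrete maximal operator `A*_N φ = sup_{n ≥ N} A_n |φ|`. -/
def discMaxOpFrom (R : ℕ → Rect) (N : ℕ) (φ : ℤ × ℤ → ℝ) (kl : ℤ × ℤ) : ℝ≥0∞ :=
  ⨆ n, ⨆ (_ : N ≤ n), ENNReal.ofReal (discAvg (R n) (fun q => |φ q|) kl)

def lpSum (φ : ℤ × ℤ → ℝ) (p : ℝ) : ℝ≥0∞ := ∑' q : ℤ × ℤ, ENNReal.ofReal (|φ q| ^ p)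

/-- `φ ∈ ℓ^p(ℤ²)`. -/
def Memlp (φ : ℤ × ℤ → ℝ) (p : ℝ) : Prop := lpSum φ p < ⊤

/-- The `ℓ^p(ℤ²)` norm. -/
def lpNorm (φ : ℤ × ℤ → ℝ) (p : ℝ) : ℝ≥0∞ := lpSum φ p ^ (1 / p)

/-- The `ℓ^p(ℤ²)` norm of an `ℝ≥0∞`-valued function. -/
def lpNormE (F : ℤ × ℤ → ℝ≥0∞) (p : ℝ) : ℝ≥0∞ := (∑' q : ℤ × ℤ, F q ^ p) ^ (1 / p)

/-- A discrete operator `B` is of weak-type `(p,p)` on `ℓ^p(ℤ²)`. -/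
def IsDiscWeakType (B : (ℤ × ℤ → ℝ) → ℤ × ℤ → ℝ≥0∞) (p : ℝ) : Prop :=
  ∃ C : ℝ, 0 < C ∧ ∀ φ : ℤ × ℤ → ℝ, Memlp φ p → ∀ lam : ℝ, 0 < lam →
    Measure.count {kl : ℤ × ℤ | ENNReal.ofReal lam ≤ B φ kl} ≤
      ENNReal.ofReal (C * ((lpNorm φ p).toReal / lam) ^ p)

/-- The discrete maximal operator associated with `R` satisfies a Tauberian condition. -/
def DiscTauberian (R : ℕ → Rect) : Prop :=
  ∀ lam : ℝ, 0 < lam → ∃ C : ℝ, 0 < C ∧ ∀ E : Finset (ℤ × ℤ), E.Nonempty →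
    Measure.count {kl : ℤ × ℤ |
        ENNReal.ofReal lam ≤ discMaxOp R (fun q => if q ∈ E then (1 : ℝ) else 0) kl} ≤
      ENNReal.ofReal C * (E.card : ℝ≥0∞)

/-- Vertices and sets of the geometric construction 1 (with `A = (1,0)`,
`B = (0,b)`, `C = (0,c)`). -/
def ptA : ℝ × ℝ := (1, 0)
def ptB (b : ℝ) : ℝ × ℝ := (0, b)
def ptC (c : ℝ) : ℝ × ℝ := (0, c)
def ptB' (b : ℝ) : ℝ × ℝ := ptA + (3 / 2 : ℝ) • (ptB b - ptA)
def ptC' (c : ℝ) : ℝ × ℝ := ptA + (3 / 2 : ℝ) • (ptC c - ptA)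

/-- The full triangle `ABC`. -/
def triABC (b c : ℝ) : Set (ℝ × ℝ) := convexHull ℝ {ptA, ptB b, ptC c}

/-- The full trapezium `BCC'B'`. -/
def trapV (b c : ℝ) : Set (ℝ × ℝ) := convexHull ℝ {ptB b, ptC c, ptC' c, ptB' b}

/-- The rectangle `P`: the smallest rectangle having `AC'` as one of its sides and
containing the triangle `AB'C'`, translated so that its center is the origin.
Its sides have directions `(-1,c)/√(1+c²)` and `(c,1)/√(1+c²)`, with half-lengths
`(3/4)√(1+c²)` and `(3/4)(b-c)/√(1+c²)`. -/
def rectP (b c : ℝ) : Set (ℝ × ℝ) :=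
  {p : ℝ × ℝ |
    |(-p.1 + c * p.2)| / Real.sqrt (1 + c ^ 2) ≤ (3 / 4) * Real.sqrt (1 + c ^ 2) ∧
    |(c * p.1 + p.2)| / Real.sqrt (1 + c ^ 2) ≤ (3 / 4) * (b - c) / Real.sqrt (1 + c ^ 2)}

/-- Horizontal translation of a planar set by `t`. -/
def hTranslate (t : ℝ) (F : Set (ℝ × ℝ)) : Set (ℝ × ℝ) :=
  (fun p : ℝ × ℝ => (p.1 + t, p.2)) '' F

/-- The triangle `Δ_k` with vertices `A = (0,1)`, `B_{k-1} = (u_{k-1}, 0)`,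
`B_k = (u_k, 0)`. -/
def triPerron (u : ℕ → ℝ) (k : ℕ) : Set (ℝ × ℝ) :=
  convexHull ℝ {((0 : ℝ), (1 : ℝ)), ((u (k - 1) : ℝ), (0 : ℝ)), ((u k : ℝ), (0 : ℝ))}

/-- The symmetric difference `Δ_n := R_n △ (R_n + (0,1))`. -/
def symmDiffTranslate (R : Rect) : Set (ℝ × ℝ) :=
  symmDiff R.carrier ((fun q : ℝ × ℝ => q + ((0 : ℝ), (1 : ℝ))) '' R.carrier)


section helpers
open Finset (sum_congr sum_comm sum_le_sum mul_sum sum_nonneg sum_add_distrib sum_sub_distrib sum_mul sum_eq_zero mem_filter)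
local notation "Fn" T:max => Fin (2^T)
local notation "Kn" T:max => Fn T → Fn T → ℝ
local notation "rg" => Finset.range
set_option linter.unusedSectionVars false
set_option linter.unusedVariables false

open Classical in
def av {α β : Type*} [Fintype α] (π : α → β) (a : α → ℝ) (z : α) : ℝ :=
  (∑ w, if π w = π z then a w else 0) / (∑ w : α, if π w = π z then (1:ℝ) else 0)

section av
variable {α β γ : Type*} [Fintype α] (π : α → β)

open Classical in
lemma av_cnt_pos (z : α) : 0 < (∑ w : α, if π w = π z then (1:ℝ) else 0) := by
  have : (1:ℝ) ≤ ∑ w : α, if π w = π z then (1:ℝ) else 0 := by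
    have := Finset.single_le_sum (f := fun w => if π w = π z then (1:ℝ) else 0) (s := Finset.univ)
      (fun i _ => by split_ifs <;> norm_num) (Finset.mem_univ z)
    simpa using this
  linarith

lemma av_add (a b : α → ℝ) (z : α) : av π (fun w => a w + b w) z = av π a z + av π b z := by
  unfold av
  rw [← add_div, ← sum_add_distrib]
  congr 1
  exact sum_congr rfl fun w _ => by split_ifs <;> simp

lemma av_smul (c : ℝ) (a : α → ℝ) (z : α) : av π (fun w => c * a w) z = c * av π a z := by
  unfold av
  rw [← mul_div_assoc, mul_sum]
  congr 1
  exact sum_congr rfl fun w _ => by split_ifs <;> simp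

lemma av_sub (a b : α → ℝ) (z : α) : av π (fun w => a w - b w) z = av π a z - av π b z := by
  have := av_add π a (fun w => (-1) * b w) z
  rw [av_smul] at this
  calc _ = av π (fun w => a w + (-1) * b w) z := by congr 1; ext; ring
    _ = _ := by rw [this]; ring

lemma av_sum {ι : Type*} (s : Finset ι) (a : ι → α → ℝ) (z : α) :
    av π (fun w => ∑ i ∈ s, a i w) z = ∑ i ∈ s, av π (a i) z := by
  classical
  induction s using Finset.induction_on with
  | empty => simp [av]
  | insert i s hi ih =>
    simp only [Finset.sum_insert hi]
    rw [av_add, ih]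

lemma av_mono {a b : α → ℝ} (h : ∀ w, a w ≤ b w) (z : α) : av π a z ≤ av π b z := by
  unfold av
  refine div_le_div_of_nonneg_right ?_ (av_cnt_pos π z).le
  exact sum_le_sum fun w _ => by split_ifs <;> simp [h]

lemma av_nonneg {a : α → ℝ} (h : ∀ w, 0 ≤ a w) (z : α) : 0 ≤ av π a z := by
  unfold av
  refine div_nonneg (sum_nonneg fun w _ => by split_ifs <;> simp [h]) (av_cnt_pos π z).le

def Ms (π : α → β) (a : α → ℝ) : Prop := ∀ z w, π z = π w → a z = a w

lemma av_ms (a : α → ℝ) : Ms π (av π a) := by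
  intro z w h
  unfold av
  rw [h]

lemma av_pull {a b : α → ℝ} (hb : Ms π b) (z : α) :
    av π (fun w => b w * a w) z = b z * av π a z := by
  unfold av
  rw [← mul_div_assoc, mul_sum]
  congr 1
  refine sum_congr rfl fun w _ => ?_
  split_ifs with h
  · simp only [hb w z h]
  · simp

open Classical in
lemma av_const (c : ℝ) (z : α) : av π (fun _ => c) z = c := by
  unfold av
  have := av_cnt_pos π z
  have h2 : (∑ w : α, if π w = π z then c else 0) = c * ∑ w : α, if π w = π z then (1:ℝ) else 0 := by
    rw [mul_sum]
    exact sum_congr rfl fun w _ => by split_ifs <;> simp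
  rw [h2]; field_simp

lemma av_of_ms {b : α → ℝ} (hb : Ms π b) (z : α) : av π b z = b z := by
  have := av_pull π (a := fun _ => 1) hb z
  simpa [av_const] using this

open Classical in
def avK (π : α → β) (z w : α) : ℝ :=
  if π w = π z then 1 / (∑ v : α, if π v = π z then (1:ℝ) else 0) else 0

lemma av_eq_ker (a : α → ℝ) (z : α) : av π a z = ∑ w, avK π z w * a w := by
  unfold av avK
  rw [Finset.sum_div]
  refine sum_congr rfl fun w _ => ?_
  split_ifs
  · ring
  · simp

lemma avK_symm (z w : α) : avK π z w = avK π w z := by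
  unfold avK
  by_cases h : π w = π z
  · rw [if_pos h, if_pos h.symm, h]
  · rw [if_neg h, if_neg (Ne.symm h)]

lemma av_adj (a b : α → ℝ) : ∑ z, av π a z * b z = ∑ z, a z * av π b z := by
  simp only [av_eq_ker, sum_mul, mul_sum]
  rw [sum_comm]
  refine sum_congr rfl fun w _ => sum_congr rfl fun z _ => ?_
  rw [avK_symm]; ring

lemma av_total (a : α → ℝ) : ∑ z, av π a z = ∑ z, a z := by
  have := av_adj π a (fun _ => 1)
  simpa [av_const] using this

lemma ms_tower {π' : α → γ} (h : ∀ z w, π z = π w → π' z = π' w) {a : α → ℝ} (ha : Ms π' a) : Ms π a :=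
  fun z w e => ha z w (h z w e)

lemma ms_mul {a b : α → ℝ} (ha : Ms π a) (hb : Ms π b) : Ms π (fun z => a z * b z) :=
  fun z w e => by simp only [ha z w e, hb z w e]

lemma ms_comp {a : α → ℝ} (F : ℝ → ℝ) (ha : Ms π a) : Ms π (fun z => F (a z)) :=
  fun z w e => by simp only [ha z w e]

lemma ms_sum {ι : Type*} (s : Finset ι) {a : ι → α → ℝ} (ha : ∀ i ∈ s, Ms π (a i)) :
    Ms π (fun z => ∑ i ∈ s, a i z) :=
  fun z w e => sum_congr rfl fun i hi => ha i hi z w e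

lemma av_tower {π' : α → γ} (h : ∀ z w, π z = π w → π' z = π' w) (a : α → ℝ) (z : α) :
    av π' (av π a) z = av π' a z := by
  classical
  unfold av
  congr 1
  have hb : Ms π (fun w => if π' w = π' z then (1:ℝ) else 0) := by
    intro w v e; simp only [h w v e]
  have := av_adj π a (fun w => if π' w = π' z then (1:ℝ) else 0)
  simp only [av_of_ms π hb] at this
  simpa [av] using this

lemma av_tower' {π' : α → γ} (h : ∀ z w, π z = π w → π' z = π' w) (a : α → ℝ) (z : α) :
    av π (av π' a) z = av π' a z :=
  av_of_ms π (ms_tower π h (av_ms π' a)) z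

lemma av_pow_le {a : α → ℝ} (ha : ∀ w, 0 ≤ a w) (m : ℕ) (z : α) :
    (av π a z) ^ m ≤ av π (fun w => a w ^ m) z := by
  classical
  simp only [av_eq_ker]
  refine Real.pow_arith_mean_le_arith_mean_pow _ _ _ (fun i _ => ?_) ?_ (fun i _ => ha i) m
  · unfold avK; split_ifs
    · have := av_cnt_pos π z; positivity
    · exact le_rfl
  · have := av_const π 1 z
    rw [av_eq_ker] at this; simpa using this

lemma av_sq_le (a : α → ℝ) (z : α) : (av π a z) ^ 2 ≤ av π (fun w => a w ^ 2) z := by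
  classical
  simp only [av_eq_ker]
  refine Real.pow_arith_mean_le_arith_mean_pow_of_even _ _ _ (fun i _ => ?_) ?_ (by decide)
  · unfold avK; split_ifs
    · have := av_cnt_pos π z; positivity
    · exact le_rfl
  · have := av_const π 1 z
    rw [av_eq_ker] at this; simpa using this

lemma av_le_one {a : α → ℝ} (h : ∀ w, a w ≤ 1) (z : α) : av π a z ≤ 1 := by
  have := av_mono π h z
  rwa [av_const] at this

end av

lemma young_nat (m : ℕ) {a b : ℝ} (ha : 0 ≤ a) (hb : 0 ≤ b) :
    (m + 1) * (a ^ m * b) ≤ m * a ^ (m + 1) + b ^ (m + 1) := by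
  induction m with
  | zero => simp
  | succ m ih =>
    have h1 := mul_le_mul_of_nonneg_left ih hb
    have h2 : 0 ≤ (a ^ (m+1) - b ^ (m+1)) * (a - b) := by
      rcases le_total a b with h | h
      · exact mul_nonneg_of_nonpos_of_nonpos (by have := pow_le_pow_left₀ ha h (m+1); linarith) (by linarith)
      · exact mul_nonneg (by have := pow_le_pow_left₀ hb h (m+1); linarith) (by linarith)
    have h3 : 0 ≤ (m:ℝ) * (a ^ m * (a-b)^2) := by positivity
    push_cast
    have e1 : b * ((m + 1) * (a ^ m * b)) = (m+1) * (a^m * b^2) := by ring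
    have e2 : a ^ (m+1) = a^m * a := pow_succ a m
    have e3 : a ^ (m+2) = a^m * a^2 := by ring
    have e4 : b ^ (m+2) = b^m * b^2 := by ring
    have e5 : b ^ (m+1) = b^m * b := pow_succ b m
    rw [show m + 1 + 1 = m + 2 from rfl]
    simp only [e2, e3, e4, e5] at *
    nlinarith [h1, h2, h3]

lemma YA {α : Type*} [Fintype α] (m : ℕ) (c : ℝ) (hc : 0 ≤ c) {A Z : α → ℝ}
    (hA : ∀ z, 0 ≤ A z) (hZ : ∀ z, 0 ≤ Z z)
    (h : ∑ z, A z ^ (m + 1) ≤ c * ∑ z, A z ^ m * Z z) :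
    ∑ z, A z ^ (m + 1) ≤ c ^ (m + 1) * ∑ z, Z z ^ (m + 1) := by
  have h1 : (m + 1) * (c * ∑ z, A z ^ m * Z z) ≤ m * ∑ z, A z ^ (m + 1) + c ^ (m+1) * ∑ z, Z z ^ (m+1) := by
    simp only [mul_sum]
    rw [← sum_add_distrib]
    refine sum_le_sum fun z _ => ?_
    have := young_nat m (hA z) (mul_nonneg hc (hZ z))
    rw [mul_pow] at this
    linarith
  have h2 : (m + 1) * ∑ z, A z ^ (m + 1) ≤ (m + 1) * (c * ∑ z, A z ^ m * Z z) :=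
    mul_le_mul_of_nonneg_left h (by positivity)
  linarith

lemma pow_tail (m n : ℕ) (c : ℕ → ℝ) (hc : ∀ j, 0 ≤ c j) :
    (∑ j ∈ rg n, c j) ^ (m + 1) ≤
      (m + 1) * ∑ j ∈ rg n, c j * (∑ i ∈ Finset.Ico j n, c i) ^ m := by

  suffices H : ∀ d k, k + d = n → (∑ j ∈ Finset.Ico k n, c j) ^ (m + 1) ≤
      (m + 1) * ∑ j ∈ Finset.Ico k n, c j * (∑ i ∈ Finset.Ico j n, c i) ^ m by
    have := H n 0 (by simp)
    simpa using this
  intro d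
  induction d with
  | zero => intro k hk; simp at hk; subst hk; simp
  | succ d ih =>
    intro k hk
    have hkn : k < n := by omega
    have := ih (k+1) (by omega)
    rw [Finset.sum_eq_sum_Ico_succ_bot hkn (fun j => c j * (∑ i ∈ Finset.Ico j n, c i) ^ m)]
    have e := Finset.sum_eq_sum_Ico_succ_bot hkn c
    set S := ∑ j ∈ Finset.Ico (k+1) n, c j
    have hS : 0 ≤ S := sum_nonneg fun j _ => hc j
    have hB : 0 ≤ c k := hc k
    rw [e]
    have key : (c k + S) ^ (m+1) ≤ S ^ (m+1) + (m+1) * (c k * (c k + S) ^ m) := by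
      have := young_nat m (a := c k + S) (b := S) (by positivity) hS
      have e2 : (c k + S) ^ (m+1) = (c k + S)^m * (c k + S) := pow_succ _ _
      nlinarith
    linarith

section dd
variable {α β : Type*} [Fintype α]

lemma DD (π : ℕ → α → β) (hπ : ∀ l z w, π l z = π l w → π (l+1) z = π (l+1) w)
    (m n : ℕ) (g : ℕ → α → ℝ) (hg : ∀ j z, 0 ≤ g j z) :
    ∑ z, (∑ j ∈ rg n, av (π j) (g j) z) ^ (m+1) ≤
      (m+1) ^ (m+1) * ∑ z, (∑ j ∈ rg n, g j z) ^ (m+1) := by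
  have nest : ∀ j i, j ≤ i → ∀ z w, π j z = π j w → π i z = π i w := by
    intro j i hji
    induction i, hji using Nat.le_induction with
    | base => exact fun z w h => h
    | succ i _ ih => exact fun z w h => hπ i z w (ih z w h)
  have hav : ∀ j z, 0 ≤ av (π j) (g j) z := fun j z => av_nonneg _ (hg j) z
  refine YA m (m+1) (by positivity) (fun z => sum_nonneg fun j _ => hav j z)
    (fun z => sum_nonneg fun j _ => hg j z) ?_
  calc _ ≤ ∑ z, ((m:ℝ) + 1) * ∑ j ∈ rg n, av (π j) (g j) z *
            (∑ i ∈ Finset.Ico j n, av (π i) (g i) z) ^ m :=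
        sum_le_sum fun z _ => pow_tail m n _ (fun j => hav j z)
    _ = (m + 1) * ∑ j ∈ rg n, ∑ z, av (π j) (g j) z *
            (∑ i ∈ Finset.Ico j n, av (π i) (g i) z) ^ m := by
        rw [← mul_sum, sum_comm]
    _ = (m + 1) * ∑ j ∈ rg n, ∑ z, g j z *
            (∑ i ∈ Finset.Ico j n, av (π i) (g i) z) ^ m := by
        congr 1
        refine sum_congr rfl fun j _ => ?_
        rw [av_adj]
        refine sum_congr rfl fun z _ => ?_
        congr 1
        apply av_of_ms
        apply ms_comp (π j) (F := fun t => t ^ m)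
        apply ms_sum
        intro i hi
        exact ms_tower _ (nest j i (Finset.mem_Ico.1 hi).1) (av_ms _ _)
    _ ≤ (m + 1) * ∑ j ∈ rg n, ∑ z, g j z *
            (∑ i ∈ rg n, av (π i) (g i) z) ^ m := by
        gcongr with j hj z _
        · exact hg j z
        · exact sum_nonneg fun i _ => hav i z
        · intro i _ _; exact hav i z
        · intro i hi; simp at hi ⊢; omega
    _ = _ := by
        rw [sum_comm]
        congr 1
        refine sum_congr rfl fun z _ => ?_
        rw [← sum_mul, mul_comm]

lemma DDi {ι : Type*} (π : ℕ → α → β) (hπ : ∀ l z w, π l z = π l w → π (l+1) z = π (l+1) w)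
    (m : ℕ) (s : Finset ι) (lv : ι → ℕ) (g : ι → α → ℝ) (hg : ∀ i z, 0 ≤ g i z) :
    ∑ z, (∑ i ∈ s, av (π (lv i)) (g i) z) ^ (m+1) ≤
      (m+1) ^ (m+1) * ∑ z, (∑ i ∈ s, g i z) ^ (m+1) := by
  classical
  obtain ⟨n, hn⟩ : ∃ n, ∀ i ∈ s, lv i < n := ⟨s.sup lv + 1, fun i hi => Nat.lt_succ_of_le (Finset.le_sup hi)⟩
  have hmap : ∀ i ∈ s, lv i ∈ rg n := fun i hi => Finset.mem_range.2 (hn i hi)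
  have := DD π hπ m n (fun j z => ∑ i ∈ s with lv i = j, g i z)
    (fun j z => sum_nonneg fun i _ => hg i z)
  have e1 : ∀ z, ∑ j ∈ rg n, ∑ i ∈ s with lv i = j, g i z = ∑ i ∈ s, g i z :=
    fun z => Finset.sum_fiberwise_of_maps_to hmap _
  have e2 : ∀ z, ∑ j ∈ rg n, av (π j) (fun z => ∑ i ∈ s with lv i = j, g i z) z
      = ∑ i ∈ s, av (π (lv i)) (g i) z := by
    intro z
    rw [← Finset.sum_fiberwise_of_maps_to hmap]
    refine sum_congr rfl fun j _ => ?_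
    rw [av_sum]
    refine sum_congr rfl fun i hi => ?_
    rw [(Finset.mem_filter.1 hi).2]
  simpa only [e1, e2] using this

end dd

section dy
variable {T : ℕ}

def lb (l : ℕ) (y : Fn T) : ℕ := y.val / 2^l

def Ea (l : ℕ) (a : Fn T → ℝ) : Fn T → ℝ := av (lb l) a

def De (l : ℕ) (a : Fn T → ℝ) (y : Fn T) : ℝ := Ea l a y - Ea (l+1) a y

def fl (l : ℕ) (y : Fn T) : Fn T :=
  if h : l < T then ⟨y.val ^^^ 2^l, Nat.xor_lt_two_pow y.2 (Nat.pow_lt_pow_right (by norm_num) h)⟩ else y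

lemma lb_succ (l : ℕ) (y : Fn T) : lb (l+1) y = lb l y / 2 := by
  unfold lb; rw [pow_succ, Nat.div_div_eq_div_mul]

lemma lb_nest (l : ℕ) (z w : Fn T) (h : lb l z = lb l w) : lb (l+1) z = lb (l+1) w := by
  rw [lb_succ, lb_succ, h]

lemma lb_nest' {j i : ℕ} (hji : j ≤ i) (z w : Fn T) (h : lb j z = lb j w) : lb i z = lb i w := by
  induction i, hji using Nat.le_induction with
  | base => exact h
  | succ i _ ih => exact lb_nest i z w ih

lemma lb_big {l : ℕ} (h : T ≤ l) (y : Fn T) : lb l y = 0 := by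
  unfold lb
  exact Nat.div_eq_of_lt (lt_of_lt_of_le y.2 (Nat.pow_le_pow_right (by norm_num) h))

lemma fl_val {l : ℕ} (h : l < T) (y : Fn T) : (fl l y).val = y.val ^^^ 2^l := by
  simp [fl, h]

lemma lb_fl {l : ℕ} (h : l < T) (y : Fn T) : lb l (fl l y) = lb l y ^^^ 1 := by
  unfold lb; rw [fl_val h, Nat.xor_div_two_pow, Nat.div_self (by positivity)]

lemma fl_fl (l : ℕ) (y : Fn T) : fl l (fl l y) = y := by
  by_cases h : l < T
  · apply Fin.ext; rw [fl_val h, fl_val h, Nat.xor_assoc, Nat.xor_self, Nat.xor_zero]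
  · simp [fl, h]

def flE (l : ℕ) : Equiv.Perm (Fn T) := ⟨fl l, fl l, fl_fl l, fl_fl l⟩

lemma sum_fl (l : ℕ) (F : Fn T → ℝ) : ∑ z, F (fl l z) = ∑ z, F z :=
  Equiv.sum_comp (flE l) F

lemma xor_one_div (n : ℕ) : (n ^^^ 1) / 2 = n / 2 := by
  have := Nat.xor_div_two_pow (a := n) (b := 1) (n := 1)
  simpa using this

lemma lb_fl_succ (l : ℕ) (y : Fn T) : lb (l+1) (fl l y) = lb (l+1) y := by
  by_cases h : l < T
  · rw [lb_succ, lb_succ, lb_fl h, xor_one_div]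
  · simp [fl, h]

lemma xor_one_iff (m n : ℕ) (h : m / 2 = n / 2) : m = n ∨ m = n ^^^ 1 := by
  rcases Nat.even_or_odd n with hn | hn
  · rw [Nat.xor_one_of_even hn]
    have := Nat.even_iff.1 hn
    omega
  · rw [Nat.xor_one_of_odd hn]
    have := Nat.odd_iff.1 hn
    omega

lemma xor_one_ne (n : ℕ) : n ^^^ 1 ≠ n := by
  rcases Nat.even_or_odd n with hn | hn
  · rw [Nat.xor_one_of_even hn]; omega
  · rw [Nat.xor_one_of_odd hn]
    have := Nat.odd_iff.1 hn
    omega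

lemma lb_sep {l : ℕ} (h : l < T) (z w : Fn T) (e : lb (l+1) z = lb (l+1) w) :
    lb l z = lb l w ∨ lb l z = lb l (fl l w) := by
  rw [lb_fl h]; rw [lb_succ, lb_succ] at e
  exact xor_one_iff _ _ e

lemma De_big {l : ℕ} (h : T ≤ l) (a : Fn T → ℝ) (y : Fn T) : De l a y = 0 := by
  unfold De Ea av
  simp only [lb_big h, lb_big (Nat.le_succ_of_le h)]
  simp

lemma Ea_fl {l : ℕ} (h : l < T) (a : Fn T → ℝ) (z : Fn T) :
    Ea l a z + Ea l a (fl l z) = 2 * Ea (l+1) a z := by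
  have key : ∀ b : Fn T → ℝ, (∑ w, if lb (l+1) w = lb (l+1) z then b w else 0) =
      (∑ w, if lb l w = lb l z then b w else 0) + (∑ w, if lb l w = lb l (fl l z) then b w else 0) := by
    intro b
    rw [← sum_add_distrib]
    refine sum_congr rfl fun w _ => ?_
    have hne : lb l (fl l z) ≠ lb l z := by rw [lb_fl h]; exact xor_one_ne _
    by_cases e : lb (l+1) w = lb (l+1) z
    · rcases lb_sep h w z e with e1 | e1
      · simp [e, e1, hne.symm]
      · simp [e, e1, hne]
    · have n1 : lb l w ≠ lb l z := fun e1 => e (lb_nest l w z e1)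
      have n2 : lb l w ≠ lb l (fl l z) := fun e1 => e (by
        have := lb_nest l w _ e1
        rwa [lb_fl_succ] at this)
      simp [e, n1, n2]
  have cnt : (∑ w : Fn T, if lb l w = lb l (fl l z) then (1:ℝ) else 0) =
      ∑ w : Fn T, if lb l w = lb l z then (1:ℝ) else 0 := by
    rw [← sum_fl l]
    refine sum_congr rfl fun w _ => ?_
    rw [lb_fl h, lb_fl h]
    simp
  have k1 := key a
  have k2 := key (fun _ => 1)
  have pos := av_cnt_pos (lb l) z
  have dec : ∀ (i : ℕ) (v : Fn T) (b : Fn T → ℝ),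
     av (lb i) b v = (∑ w, if lb i w = lb i v then b w else 0) / (∑ w : Fn T, if lb i w = lb i v then (1:ℝ) else 0) := by
    intro i v b; unfold av; congr!
  have pos' : 0 < (∑ w : Fn T, if lb l w = lb l z then (1:ℝ) else 0) := by convert pos
  unfold Ea
  rw [dec, dec, dec, k1, k2, cnt]
  field_simp
  ring

lemma Ea_fl_eq (l : ℕ) (a : Fn T → ℝ) (z : Fn T) : Ea (l+1) a (fl l z) = Ea (l+1) a z :=
  av_ms _ _ _ _ (lb_fl_succ l z)

lemma De_fl (l : ℕ) (a : Fn T → ℝ) (z : Fn T) : De l a (fl l z) = - De l a z := by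
  by_cases h : l < T
  · have := Ea_fl h a z
    have := Ea_fl_eq l a z
    unfold De; linarith
  · rw [De_big (not_lt.1 h), De_big (not_lt.1 h)]; simp

lemma De_ms (l : ℕ) (a : Fn T → ℝ) : Ms (lb l) (De l a) := by
  intro z w e
  unfold De Ea
  rw [av_ms _ _ _ _ e, av_ms _ _ _ _ (lb_nest l z w e)]

lemma De_mul_ms (l : ℕ) (a b : Fn T → ℝ) : Ms (lb (l+1)) (fun z => De l a z * De l b z) := by
  intro z w e
  by_cases h : l < T
  · rcases lb_sep h z w e with e1 | e1
    · simp only [De_ms l a z w e1, De_ms l b z w e1]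
    · simp only [De_ms l a z _ e1, De_ms l b z _ e1, De_fl]; ring
  · simp only [De_big (not_lt.1 h)]

lemma De_sq_ms (l : ℕ) (a : Fn T → ℝ) : Ms (lb (l+1)) (fun z => De l a z ^ 2) := by
  have := De_mul_ms l a a
  simpa only [sq] using this

lemma Ea_Ea {i j : ℕ} (h : i ≤ j) (a : Fn T → ℝ) (z) : Ea j (Ea i a) z = Ea j a z :=
  av_tower _ (lb_nest' h) a z

lemma Ea_Ea' {i j : ℕ} (h : i ≤ j) (a : Fn T → ℝ) (z) : Ea i (Ea j a) z = Ea j a z :=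
  av_tower' _ (lb_nest' h) a z

lemma Ea_De_zero {i l : ℕ} (h : l < i) (a : Fn T → ℝ) (z) : Ea i (De l a) z = 0 := by
  have : Ea i (De l a) z = Ea i (Ea l a) z - Ea i (Ea (l+1) a) z := av_sub _ _ _ z
  rw [this, Ea_Ea h.le, Ea_Ea h]; ring

lemma Ea_De {i l : ℕ} (h : i ≤ l) (a : Fn T → ℝ) (z) : Ea i (De l a) z = De l a z :=
  av_of_ms _ (ms_tower _ (lb_nest' h) (De_ms l a)) z

end dy

lemma bk_alg (m : ℕ) : ∃ C : ℝ, 0 ≤ C ∧ ∀ N D q : ℝ, 0 ≤ N → 0 ≤ D → q ^ 2 ≤ 4 * (N * D) →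
    ((N + D + q) ^ (m+1) + (N + D - q) ^ (m+1)) / 2 ≤ N ^ (m+1) + C * (D * (N + D) ^ m) := by
  have hq : ∀ N D q : ℝ, 0 ≤ N → 0 ≤ D → q ^ 2 ≤ 4 * (N * D) → |q| ≤ N + D := by
    intro N D q hN hD h
    apply abs_le_of_sq_le_sq _ (by positivity)
    nlinarith [sq_nonneg (N - D)]
  have hS : ∀ m : ℕ, ∀ N D q : ℝ, 0 ≤ N → 0 ≤ D → q ^ 2 ≤ 4 * (N * D) →
      ((N + D + q) ^ m + (N + D - q) ^ m) / 2 ≤ 2 ^ m * (N + D) ^ m := by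
    intro m N D q hN hD h
    have := abs_le.1 (hq N D q hN hD h)
    have h1 : (N + D + q) ^ m ≤ (2 * (N + D)) ^ m := pow_le_pow_left₀ (by linarith) (by linarith) m
    have h2 : (N + D - q) ^ m ≤ (2 * (N + D)) ^ m := pow_le_pow_left₀ (by linarith) (by linarith) m
    rw [← mul_pow]; linarith
  have hT : ∀ m : ℕ, ∃ c : ℝ, 0 ≤ c ∧ ∀ N D q : ℝ, 0 ≤ N → 0 ≤ D → q ^ 2 ≤ 4 * (N * D) →
      q * (((N + D + q) ^ (m+1) - (N + D - q) ^ (m+1)) / 2) ≤ c * (q ^ 2 * (N + D) ^ m) := by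
    intro m
    induction m with
    | zero => exact ⟨1, by norm_num, fun N D q _ _ _ => by simp; nlinarith⟩
    | succ m ih =>
      obtain ⟨c, hc, ih⟩ := ih
      refine ⟨c + 2 ^ (m+1), by positivity, fun N D q hN hD h => ?_⟩
      have h1 := mul_le_mul_of_nonneg_left (ih N D q hN hD h) (by positivity : 0 ≤ N + D)
      have h2 := mul_le_mul_of_nonneg_left (hS (m+1) N D q hN hD h) (sq_nonneg q)
      calc _ = (N + D) * (q * (((N + D + q) ^ (m+1) - (N + D - q) ^ (m+1)) / 2)) +
            q ^ 2 * (((N + D + q) ^ (m+1) + (N + D - q) ^ (m+1)) / 2) := by ring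
        _ ≤ (N + D) * (c * (q ^ 2 * (N + D) ^ m)) + q ^ 2 * (2 ^ (m+1) * (N + D) ^ (m+1)) := add_le_add h1 h2
        _ = _ := by ring
  induction m with
  | zero => exact ⟨1, by norm_num, fun N D q _ _ _ => by simp⟩
  | succ m ih =>
    obtain ⟨C, hC, ih⟩ := ih
    obtain ⟨c, hc, hT⟩ := hT m
    refine ⟨C + 1 + 4 * c, by positivity, fun N D q hN hD h => ?_⟩
    have h1 := mul_le_mul_of_nonneg_left (ih N D q hN hD h) (by positivity : 0 ≤ N + D)
    have h2 := hT N D q hN hD h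
    have h3 : q ^ 2 * (N + D) ^ m ≤ 4 * (D * (N + D) ^ (m+1)) := by
      calc q ^ 2 * (N + D) ^ m ≤ (4 * ((N + D) * D)) * (N + D) ^ m := by
            apply mul_le_mul_of_nonneg_right _ (by positivity); nlinarith
        _ = _ := by ring
    have h4 : D * N ^ (m+1) ≤ D * (N + D) ^ (m+1) := by gcongr; linarith
    calc _ = (N + D) * (((N + D + q) ^ (m+1) + (N + D - q) ^ (m+1)) / 2) +
            q * (((N + D + q) ^ (m+1) - (N + D - q) ^ (m+1)) / 2) := by ring
      _ ≤ (N + D) * (N ^ (m+1) + C * (D * (N + D) ^ m)) + c * (q ^ 2 * (N + D) ^ m) := add_le_add h1 h2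
      _ ≤ (N + D) * (N ^ (m+1) + C * (D * (N + D) ^ m)) + c * (4 * (D * (N + D) ^ (m+1))) := by gcongr
      _ = N ^ (m+2) + D * N ^ (m+1) + C * (D * (N + D) ^ (m+1)) + c * (4 * (D * (N + D) ^ (m+1))) := by ring
      _ ≤ N ^ (m+2) + D * (N + D) ^ (m+1) + C * (D * (N + D) ^ (m+1)) + c * (4 * (D * (N + D) ^ (m+1))) := by gcongr
      _ = _ := by ring

lemma half_pow_le (m : ℕ) {x y : ℝ} (hx : 0 ≤ x) (hy : 0 ≤ y) :
    ((x + y) / 2) ^ m ≤ (x ^ m + y ^ m) / 2 := by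
  have := (convexOn_pow (𝕜 := ℝ) m).2 hx hy (by norm_num : (0:ℝ) ≤ 1/2) (by norm_num : (0:ℝ) ≤ 1/2) (by norm_num)
  simp only [smul_eq_mul] at this
  calc _ = (1 / 2 * x + 1 / 2 * y) ^ m := by congr 1; ring
    _ ≤ _ := this
    _ = _ := by ring

lemma BK (m : ℕ) : ∃ C : ℝ, 0 ≤ C ∧ ∀ (T : ℕ) {ι : Type} (s : Finset ι)
    (a : ℕ → ι → Fn T → ℝ) (n : ℕ),
    ∑ z, (∑ i ∈ s, (∑ l ∈ rg n, De l (a l i) z) ^ 2) ^ (m+1) ≤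
      C * ∑ z, (∑ i ∈ s, ∑ l ∈ rg n, De l (a l i) z ^ 2) ^ (m+1) := by
  obtain ⟨C, hC, alg⟩ := bk_alg m
  refine ⟨C ^ (m+1), by positivity, fun T ι s a n => ?_⟩
  set F : ℕ → ι → Fn T → ℝ := fun l i z => ∑ k ∈ Finset.Ico l n, De k (a k i) z with hF
  set N : ℕ → Fn T → ℝ := fun l z => ∑ i ∈ s, F l i z ^ 2 with hN
  set D : ℕ → Fn T → ℝ := fun l z => ∑ i ∈ s, De l (a l i) z ^ 2 with hD
  have N0 : ∀ l z, 0 ≤ N l z := fun l z => sum_nonneg fun i _ => sq_nonneg _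
  have D0 : ∀ l z, 0 ≤ D l z := fun l z => sum_nonneg fun i _ => sq_nonneg _
  have Fms : ∀ l i, Ms (lb l) (F l i) := by
    intro l i
    apply ms_sum
    intro k hk
    exact ms_tower _ (lb_nest' (Finset.mem_Ico.1 hk).1) (De_ms k _)
  have FE : ∀ l i z, Ea l (F 0 i) z = F l i z := by
    intro l i z
    have : Ea l (F 0 i) z = ∑ k ∈ Finset.Ico 0 n, Ea l (De k (a k i)) z := av_sum _ _ _ _
    rw [this]
    simp only [hF]
    rw [← Finset.sum_subset (s₁ := Finset.Ico l n) (s₂ := Finset.Ico 0 n)]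
    · refine sum_congr rfl fun k hk => Ea_De (Finset.mem_Ico.1 hk).1 _ _
    · intro k hk; simp at hk ⊢; omega
    · intro k hk hk'; simp at hk hk'; exact Ea_De_zero (by omega) _ _
  have Ffl : ∀ l i z, F (l+1) i (fl l z) = F (l+1) i z := fun l i z => Fms _ _ _ _ (lb_fl_succ l z)
  have Fstep : ∀ l, l < n → ∀ i z, F l i z = F (l+1) i z + De l (a l i) z := by
    intro l hl i z
    simp only [hF]
    rw [Finset.sum_eq_sum_Ico_succ_bot hl]; ring
  have NE : ∀ l z, N l z ^ m ≤ Ea l (fun w => N 0 w ^ m) z := by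
    intro l z
    have h1 : N l z ≤ Ea l (N 0) z := by
      have : Ea l (N 0) z = ∑ i ∈ s, Ea l (fun w => F 0 i w ^ 2) z := av_sum _ _ _ _
      rw [this]
      refine sum_le_sum fun i _ => ?_
      rw [← FE]
      exact av_sq_le _ _ _
    calc N l z ^ m ≤ (Ea l (N 0) z) ^ m := pow_le_pow_left₀ (N0 l z) h1 m
      _ ≤ _ := av_pow_le _ (N0 0) m z
  have Dms : ∀ l, Ms (lb l) (D l) := fun l => ms_sum _ s fun i _ => ms_comp _ (fun t => t^2) (De_ms l _)
  have Dfl : ∀ l z, D l (fl l z) = D l z := fun l z => by simp only [hD, De_fl]; simp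
  have DN : ∀ l, ∑ z, D l z * N l z ^ m ≤ ∑ z, D l z * N 0 z ^ m := by
    intro l
    calc _ ≤ ∑ z, D l z * Ea l (fun w => N 0 w ^ m) z :=
          sum_le_sum fun z _ => mul_le_mul_of_nonneg_left (NE l z) (D0 l z)
      _ = ∑ z, Ea l (D l) z * N 0 z ^ m := (av_adj (lb l) (D l) _).symm
      _ = _ := sum_congr rfl fun z _ => by rw [show Ea l (D l) z = D l z from av_of_ms _ (Dms l) z]
  have step : ∀ l, l < n → ∑ z, N l z ^ (m+1) ≤ ∑ z, N (l+1) z ^ (m+1) + C * ∑ z, D l z * N l z ^ m := by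
    intro l hl
    have pt : ∀ z, (N l z ^ (m+1) + N l (fl l z) ^ (m+1)) / 2 ≤ N (l+1) z ^ (m+1) +
        C * ((D l z * N l z ^ m + D l (fl l z) * N l (fl l z) ^ m) / 2) := by
      intro z
      set q : ℝ := 2 * ∑ i ∈ s, F (l+1) i z * De l (a l i) z with hq
      have e1 : N l z = N (l+1) z + D l z + q := by
        simp only [hN, hD, hq, mul_sum]
        rw [← sum_add_distrib, ← sum_add_distrib]
        refine sum_congr rfl fun i _ => ?_
        rw [Fstep l hl]; ring
      have e2 : N l (fl l z) = N (l+1) z + D l z - q := by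
        simp only [hN, hD, hq, mul_sum]
        rw [← sum_add_distrib, ← sum_sub_distrib]
        refine sum_congr rfl fun i _ => ?_
        rw [Fstep l hl, Ffl, De_fl]; ring
      have e3 : q ^ 2 ≤ 4 * (N (l+1) z * D l z) := by
        have := Finset.sum_mul_sq_le_sq_mul_sq s (fun i => F (l+1) i z) (fun i => De l (a l i) z)
        simp only [hq, mul_pow]
        linarith
      have := alg (N (l+1) z) (D l z) q (N0 _ _) (D0 _ _) e3
      rw [← e1, ← e2] at this
      have e4 : N (l+1) z + D l z = (N l z + N l (fl l z)) / 2 := by rw [e1, e2]; ring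
      rw [e4] at this
      have h5 := mul_le_mul_of_nonneg_left (half_pow_le m (N0 l z) (N0 l (fl l z))) (D0 l z)
      have h6 := mul_le_mul_of_nonneg_left h5 hC
      rw [Dfl]
      have e7 : C * (D l z * ((N l z ^ m + N l (fl l z) ^ m) / 2)) =
        C * ((D l z * N l z ^ m + D l z * N l (fl l z) ^ m) / 2) := by ring
      linarith
    have := sum_le_sum fun z (_ : z ∈ Finset.univ) => pt z
    simp only [sum_add_distrib, ← Finset.sum_div, ← mul_sum] at this
    rw [sum_fl l (fun z => N l z ^ (m+1)), sum_fl l (fun z => D l z * N l z ^ m)] at this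
    linarith
  have tel : ∀ d l, l + d = n → ∑ z, N l z ^ (m+1) ≤ C * ∑ k ∈ Finset.Ico l n, ∑ z, D k z * N 0 z ^ m := by
    intro d
    induction d with
    | zero => intro l hl; simp at hl; subst hl; simp [hN, hF]
    | succ d ih =>
      intro l hl
      have h1 := step l (by omega)
      have h2 := ih (l+1) (by omega)
      rw [Finset.sum_eq_sum_Ico_succ_bot (by omega)]
      have h3 := mul_le_mul_of_nonneg_left (DN l) hC
      linarith
  have fin := tel n 0 (by simp)
  have key := YA m C hC (A := N 0) (Z := fun z => ∑ k ∈ rg n, D k z) (N0 0)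
    (fun z => sum_nonneg fun k _ => D0 k z) (by
      refine fin.trans (le_of_eq ?_)
      rw [sum_comm]
      congr 1
      refine sum_congr rfl fun z _ => ?_
      rw [mul_sum, Nat.Ico_zero_eq_range]
      exact sum_congr rfl fun k _ => mul_comm _ _)
  have e : ∀ z, ∑ k ∈ rg n, D k z = ∑ i ∈ s, ∑ l ∈ rg n, De l (a l i) z ^ 2 :=
    fun z => sum_comm
  simp only [e] at key
  simpa [hN, hF] using key

section two
variable {T : ℕ}

def E1 (j : ℕ) (f : Kn T) (x y : Fn T) : ℝ := Ea j (fun x' => f x' y) x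
def E2 (l : ℕ) (f : Kn T) (x y : Fn T) : ℝ := Ea l (f x) y
def D1 (j : ℕ) (f : Kn T) (x y : Fn T) : ℝ := De j (fun x' => f x' y) x
def D2 (l : ℕ) (f : Kn T) (x y : Fn T) : ℝ := De l (f x) y

lemma D1_eq (j : ℕ) (f : Kn T) (x y) : D1 j f x y = E1 j f x y - E1 (j+1) f x y := rfl
lemma D2_eq (j : ℕ) (f : Kn T) (x y) : D2 j f x y = E2 j f x y - E2 (j+1) f x y := rfl

lemma E12 (j l : ℕ) (f : Kn T) : E1 j (E2 l f) = E2 l (E1 j f) := by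
  funext x y
  simp only [E1, E2, Ea, av_eq_ker, mul_sum]
  rw [sum_comm]
  exact sum_congr rfl fun _ _ => sum_congr rfl fun _ _ => by ring

lemma E1_sub (j : ℕ) (f g : Kn T) (x y) :
    E1 j (fun x y => f x y - g x y) x y = E1 j f x y - E1 j g x y := av_sub _ _ _ _
lemma E2_sub (j : ℕ) (f g : Kn T) (x y) :
    E2 j (fun x y => f x y - g x y) x y = E2 j f x y - E2 j g x y := av_sub _ _ _ _
lemma E1_add (j : ℕ) (f g : Kn T) (x y) :
    E1 j (fun x y => f x y + g x y) x y = E1 j f x y + E1 j g x y := av_add _ _ _ _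
lemma E2_add (j : ℕ) (f g : Kn T) (x y) :
    E2 j (fun x y => f x y + g x y) x y = E2 j f x y + E2 j g x y := av_add _ _ _ _
lemma E1_sum {ι : Type*} (s : Finset ι) (j : ℕ) (f : ι → Kn T) (x y) :
    E1 j (fun x y => ∑ i ∈ s, f i x y) x y = ∑ i ∈ s, E1 j (f i) x y := av_sum _ _ _ _
lemma E2_sum {ι : Type*} (s : Finset ι) (j : ℕ) (f : ι → Kn T) (x y) :
    E2 j (fun x y => ∑ i ∈ s, f i x y) x y = ∑ i ∈ s, E2 j (f i) x y := av_sum _ _ _ _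
lemma De_sum {ι : Type*} (s : Finset ι) (j : ℕ) (f : ι → Fn T → ℝ) (x) :
    De j (fun x => ∑ i ∈ s, f i x) x = ∑ i ∈ s, De j (f i) x := by
  unfold De Ea; rw [av_sum, av_sum, ← sum_sub_distrib]
lemma D1_sum {ι : Type*} (s : Finset ι) (j : ℕ) (f : ι → Kn T) (x y) :
    D1 j (fun x y => ∑ i ∈ s, f i x y) x y = ∑ i ∈ s, D1 j (f i) x y := De_sum _ _ _ _
lemma D2_sum {ι : Type*} (s : Finset ι) (j : ℕ) (f : ι → Kn T) (x y) :
    D2 j (fun x y => ∑ i ∈ s, f i x y) x y = ∑ i ∈ s, D2 j (f i) x y := De_sum _ _ _ _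
lemma E1D2 (j l : ℕ) (f : Kn T) : E1 j (D2 l f) = D2 l (E1 j f) := by
  funext x y
  have : E1 j (D2 l f) x y = E1 j (E2 l f) x y - E1 j (E2 (l+1) f) x y := E1_sub j (E2 l f) (E2 (l+1) f) x y
  rw [this, E12, E12, D2_eq]
lemma D1E2 (j l : ℕ) (f : Kn T) : D1 j (E2 l f) = E2 l (D1 j f) := by
  funext x y
  have : E2 l (D1 j f) x y = E2 l (E1 j f) x y - E2 l (E1 (j+1) f) x y := E2_sub l (E1 j f) (E1 (j+1) f) x y
  rw [this, ← E12, ← E12, D1_eq]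
lemma D12 (j l : ℕ) (f : Kn T) : D1 j (D2 l f) = D2 l (D1 j f) := by
  funext x y
  rw [D1_eq, D2_eq, E1D2, E1D2, ← D1E2, ← D1E2]
  simp only [D1_eq, D2_eq, E12]; ring

lemma E1_adj (j : ℕ) (f g : Kn T) :
    ∑ x, ∑ y, E1 j f x y * g x y = ∑ x, ∑ y, f x y * E1 j g x y := by
  rw [sum_comm, sum_comm (f := fun x y => f x y * E1 j g x y)]
  exact sum_congr rfl fun y _ => av_adj _ (fun x => f x y) (fun x => g x y)
lemma E2_adj (j : ℕ) (f g : Kn T) :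
    ∑ x, ∑ y, E2 j f x y * g x y = ∑ x, ∑ y, f x y * E2 j g x y :=
  sum_congr rfl fun x _ => av_adj _ (f x) (g x)

def Ms2 (j l : ℕ) (w : Kn T) : Prop :=
  ∀ x x' y y', lb j x = lb j x' → lb l y = lb l y' → w x y = w x' y'

lemma Ms2.x {j l : ℕ} {w : Kn T} (h : Ms2 j l w) (y) : Ms (lb j) (fun x => w x y) :=
  fun x x' e => h x x' y y e rfl
lemma Ms2.y {j l : ℕ} {w : Kn T} (h : Ms2 j l w) (x) : Ms (lb l) (w x) :=
  fun y y' e => h x x y y' rfl e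
lemma Ms2.mono {j l j' l' : ℕ} (hj : j ≤ j') (hl : l ≤ l') {w : Kn T} (h : Ms2 j' l' w) : Ms2 j l w :=
  fun x x' y y' e e' => h x x' y y' (lb_nest' hj _ _ e) (lb_nest' hl _ _ e')
lemma Ms2_of {j l : ℕ} {w : Kn T} (hx : ∀ y, Ms (lb j) (fun x => w x y))
   (hy : ∀ x, Ms (lb l) (w x)) : Ms2 j l w :=
  fun x x' y y' e e' => (hx y x x' e).trans (hy x' y y' e')

lemma E1_ms (j : ℕ) (f : Kn T) (y) : Ms (lb j) (fun x => E1 j f x y) := av_ms _ _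
lemma E2_ms (j : ℕ) (f : Kn T) (x) : Ms (lb j) (fun y => E2 j f x y) := av_ms _ _
lemma E12_ms (j l : ℕ) (f : Kn T) : Ms2 j l (E1 j (E2 l f)) := by
  refine Ms2_of (fun y => E1_ms j _ y) (fun x => ?_)
  rw [E12]; exact E2_ms l _ x

lemma E12_of_ms {j l : ℕ} {w : Kn T} (h : Ms2 j l w) : E1 j (E2 l w) = w := by
  have : E2 l w = w := by funext x y; exact av_of_ms _ (h.y x) y
  rw [this]; funext x y; exact av_of_ms _ (h.x y) x

lemma E12_adj (j l : ℕ) (f g : Kn T) :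
    ∑ x, ∑ y, E1 j (E2 l f) x y * g x y = ∑ x, ∑ y, f x y * E1 j (E2 l g) x y := by
  rw [E1_adj, E2_adj, E12]

lemma E1_nonneg (j : ℕ) {f : Kn T} (h : ∀ x y, 0 ≤ f x y) (x y) : 0 ≤ E1 j f x y :=
  av_nonneg _ (fun x => h x y) x
lemma E2_nonneg (j : ℕ) {f : Kn T} (h : ∀ x y, 0 ≤ f x y) (x y) : 0 ≤ E2 j f x y :=
  av_nonneg _ (h x) y
lemma E1_mono (j : ℕ) {f g : Kn T} (h : ∀ x y, f x y ≤ g x y) (x y) : E1 j f x y ≤ E1 j g x y :=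
  av_mono _ (fun x => h x y) x
lemma E2_mono (j : ℕ) {f g : Kn T} (h : ∀ x y, f x y ≤ g x y) (x y) : E2 j f x y ≤ E2 j g x y :=
  av_mono _ (h x) y

lemma LP2 (m : ℕ) : ∃ C : ℝ, 0 ≤ C ∧ ∀ (T n : ℕ) (f : ℕ → ℕ → Kn T),
    ∑ x, ∑ y, ((∑ j ∈ rg n, ∑ l ∈ rg n, D1 j (D2 l (f j l)) x y) ^ 2) ^ (m+1) ≤
    C * ∑ x, ∑ y, (∑ j ∈ rg n, ∑ l ∈ rg n, D1 j (D2 l (f j l)) x y ^ 2) ^ (m+1) := by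
  obtain ⟨C, hC, H⟩ := BK m
  refine ⟨C * C, by positivity, fun T n f => ?_⟩
  have s1 : ∀ x, ∑ y, ((∑ j ∈ rg n, ∑ l ∈ rg n, D1 j (D2 l (f j l)) x y) ^ 2) ^ (m+1) ≤
      C * ∑ y, (∑ l ∈ rg n, (∑ j ∈ rg n, D1 j (D2 l (f j l)) x y) ^ 2) ^ (m+1) := by
    intro x
    have := H T ({()} : Finset Unit) (fun l _ y => ∑ j ∈ rg n, D1 j (f j l) x y) n
    simp only [Finset.sum_singleton, De_sum] at this
    have e : ∀ y j l, De l (D1 j (f j l) x) y = D1 j (D2 l (f j l)) x y := fun y j l => by rw [D12]; rfl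
    simp only [e] at this
    refine le_trans (le_of_eq ?_) this
    refine sum_congr rfl fun y _ => ?_
    rw [sum_comm]
  have s2 : ∀ y, ∑ x, (∑ l ∈ rg n, (∑ j ∈ rg n, D1 j (D2 l (f j l)) x y) ^ 2) ^ (m+1) ≤
      C * ∑ x, (∑ l ∈ rg n, ∑ j ∈ rg n, D1 j (D2 l (f j l)) x y ^ 2) ^ (m+1) :=
    fun y => H T (rg n) (fun j l x => D2 l (f j l) x y) n
  calc _ ≤ ∑ x, C * ∑ y, (∑ l ∈ rg n, (∑ j ∈ rg n, D1 j (D2 l (f j l)) x y) ^ 2) ^ (m+1) :=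
        sum_le_sum fun x _ => s1 x
    _ = C * ∑ y, ∑ x, (∑ l ∈ rg n, (∑ j ∈ rg n, D1 j (D2 l (f j l)) x y) ^ 2) ^ (m+1) := by
        rw [← mul_sum, sum_comm]
    _ ≤ C * ∑ y, C * ∑ x, (∑ l ∈ rg n, ∑ j ∈ rg n, D1 j (D2 l (f j l)) x y ^ 2) ^ (m+1) :=
        mul_le_mul_of_nonneg_left (sum_le_sum fun y _ => s2 y) hC
    _ = _ := by
        rw [← mul_sum, sum_comm, mul_assoc]
        congr 2
        refine sum_congr rfl fun x _ => sum_congr rfl fun y _ => ?_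
        rw [sum_comm]

lemma pyth (l : ℕ) (a w : Fn T → ℝ) (hw : Ms (lb (l+1)) w) :
    ∑ y, De l a y ^ 2 * w y = ∑ y, Ea l a y ^ 2 * w y - ∑ y, Ea (l+1) a y ^ 2 * w y := by
  have h : ∑ y, Ea l a y * (Ea (l+1) a y * w y) = ∑ y, Ea (l+1) a y * (Ea (l+1) a y * w y) := by
    have hm : Ms (lb (l+1)) (fun y => Ea (l+1) a y * w y) := ms_mul _ (av_ms _ _) hw
    have := av_adj (lb (l+1)) (Ea l a) (fun y => Ea (l+1) a y * w y)
    simp only [av_of_ms _ hm] at this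
    rw [← this]
    refine sum_congr rfl fun y _ => ?_
    congr 1
    exact Ea_Ea (Nat.le_succ l) a y
  have e : ∀ y, De l a y ^ 2 * w y = Ea l a y ^ 2 * w y - 2 * (Ea l a y * (Ea (l+1) a y * w y)) +
      Ea (l+1) a y * (Ea (l+1) a y * w y) := fun y => by unfold De; ring
  simp only [e, sum_add_distrib, sum_sub_distrib, ← mul_sum]
  rw [h]
  have e2 : ∀ y, Ea (l+1) a y * (Ea (l+1) a y * w y) = Ea (l+1) a y ^ 2 * w y := fun y => by ring
  simp only [e2]; ring

lemma pyth_x (l : ℕ) (f w : Kn T) (hw : ∀ y, Ms (lb (l+1)) (fun x => w x y)) :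
    ∑ x, ∑ y, D1 l f x y ^ 2 * w x y = ∑ x, ∑ y, E1 l f x y ^ 2 * w x y - ∑ x, ∑ y, E1 (l+1) f x y ^ 2 * w x y := by
  rw [sum_comm, sum_comm (f := fun x y => E1 l f x y ^ 2 * w x y),
    sum_comm (f := fun x y => E1 (l+1) f x y ^ 2 * w x y), ← sum_sub_distrib]
  exact sum_congr rfl fun y _ => pyth l (fun x => f x y) (fun x => w x y) (hw y)

lemma pyth_y (l : ℕ) (f w : Kn T) (hw : ∀ x, Ms (lb (l+1)) (w x)) :
    ∑ x, ∑ y, D2 l f x y ^ 2 * w x y = ∑ x, ∑ y, E2 l f x y ^ 2 * w x y - ∑ x, ∑ y, E2 (l+1) f x y ^ 2 * w x y := by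
  rw [← sum_sub_distrib]
  exact sum_congr rfl fun x _ => pyth l (f x) (w x) (hw x)

lemma sum2_nonneg {f : Kn T} (h : ∀ x y, 0 ≤ f x y) : 0 ≤ ∑ x, ∑ y, f x y :=
  sum_nonneg fun x _ => sum_nonneg fun y _ => h x y

lemma sum2_le {f g : Kn T} (h : ∀ x y, f x y ≤ g x y) : ∑ x, ∑ y, f x y ≤ ∑ x, ∑ y, g x y :=
  sum_le_sum fun x _ => sum_le_sum fun y _ => h x y

lemma DD_contr (j l : ℕ) (V w : Kn T) (hw : Ms2 (j+1) (l+1) w) (w0 : ∀ x y, 0 ≤ w x y) :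
    ∑ x, ∑ y, D1 j (D2 l V) x y ^ 2 * w x y ≤
      ∑ x, ∑ y, E1 j (E2 l V) x y ^ 2 * w x y - ∑ x, ∑ y, E1 (j+1) (E2 (l+1) V) x y ^ 2 * w x y := by
  have h1 := pyth_x j (D2 l V) w hw.x
  have h2 : 0 ≤ ∑ x, ∑ y, E1 (j+1) (D2 l V) x y ^ 2 * w x y := sum2_nonneg fun x y => mul_nonneg (sq_nonneg _) (w0 x y)
  have h3 := pyth_y l (E1 j V) w hw.y
  have h4 := pyth_x j (E2 (l+1) V) w hw.x
  have h5 : 0 ≤ ∑ x, ∑ y, D1 j (E2 (l+1) V) x y ^ 2 * w x y := sum2_nonneg fun x y => mul_nonneg (sq_nonneg _) (w0 x y)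
  rw [E1D2] at h1
  rw [E12] at h4 ⊢
  linarith

lemma DD_sq_ms (j l : ℕ) (V : Kn T) : Ms2 (j+1) (l+1) (fun x y => D1 j (D2 l V) x y ^ 2) := by
  refine Ms2_of (fun y => De_sq_ms j _) (fun x => ?_)
  rw [D12]; exact De_sq_ms l _

lemma Dw (v : Kn T) (hv : ∀ x y, 0 ≤ v x y) (V : Kn T)
    (N : ℕ) : ∀ (j0 l0 : ℕ), ∃ θ : ℕ → Kn T, ∃ w : Kn T,
      (∀ t x y, 0 ≤ θ t x y) ∧ (∀ x y, ∑ t ∈ rg (N+1), θ t x y = 1) ∧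
      (∀ x y, w x y = ∑ t ∈ rg (N+1), θ t x y * E1 (j0 + t) (E2 (l0 + t) v) x y) ∧
      Ms2 j0 l0 w ∧ (∀ x y, E1 j0 (E2 l0 v) x y ≤ w x y) ∧
      ∑ t ∈ rg N, ∑ x, ∑ y, D1 (j0 + t) (D2 (l0 + t) V) x y ^ 2 * v x y ≤
        ∑ x, ∑ y, E1 j0 (E2 l0 V) x y ^ 2 * w x y := by
  have Bv : ∀ j l x y, 0 ≤ E1 j (E2 l v) x y := fun j l => E1_nonneg j (E2_nonneg l hv)
  induction N with
  | zero =>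
    intro j0 l0
    refine ⟨fun _ _ _ => 1, E1 j0 (E2 l0 v), by simp, by simp, by simp, E12_ms _ _ _, fun _ _ => le_rfl, ?_⟩
    simp only [Finset.range_zero, Finset.sum_empty]
    exact sum2_nonneg fun x y => mul_nonneg (sq_nonneg _) (Bv _ _ x y)
  | succ N ih =>
    intro j0 l0
    obtain ⟨θ, w, h1, h2, h3, h4, h5, h6⟩ := ih (j0+1) (l0+1)
    have hB := E12_ms j0 l0 v
    have h4' : Ms2 j0 l0 w := h4.mono (Nat.le_succ _) (Nat.le_succ _)
    have w0 : ∀ x y, 0 ≤ w x y := fun x y => (Bv _ _ x y).trans (h5 x y)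
    classical
    refine ⟨fun t x y => if E1 j0 (E2 l0 v) x y ≤ w x y then (if t = 0 then 0 else θ (t-1) x y) else
      (if t = 0 then 1 else 0), fun x y => max (w x y) (E1 j0 (E2 l0 v) x y), ?_, ?_, ?_, ?_, ?_, ?_⟩
    · intro t x y; dsimp only; split_ifs <;> simp [h1]
    · intro x y
      rw [Finset.sum_range_succ']
      by_cases h : E1 j0 (E2 l0 v) x y ≤ w x y
      · simp [h, h2]
      · simp [h]
    · intro x y
      rw [Finset.sum_range_succ']
      by_cases h : E1 j0 (E2 l0 v) x y ≤ w x y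
      · simp only [if_pos h, max_eq_left h]
        rw [h3]
        simp [add_assoc, add_comm 1]
      · simp only [if_neg h, max_eq_right (not_le.1 h).le]
        simp
    · intro x x' y y' e e'
      simp only [h4' x x' y y' e e', hB x x' y y' e e']
    · intro x y; exact le_max_right _ _
    · rw [Finset.sum_range_succ']
      have a1 : ∑ x, ∑ y, D1 (j0 + 0) (D2 (l0 + 0) V) x y ^ 2 * v x y ≤
          ∑ x, ∑ y, D1 j0 (D2 l0 V) x y ^ 2 * w x y := by
        have := E12_adj (j0+1) (l0+1) (fun x y => D1 j0 (D2 l0 V) x y ^ 2) v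
        rw [E12_of_ms (DD_sq_ms j0 l0 V)] at this
        simp only [add_zero]
        rw [this]
        exact sum2_le fun x y => mul_le_mul_of_nonneg_left (h5 x y) (sq_nonneg _)
      have a2 := DD_contr j0 l0 V w h4 w0
      have a3 : ∑ x, ∑ y, E1 j0 (E2 l0 V) x y ^ 2 * w x y ≤
          ∑ x, ∑ y, E1 j0 (E2 l0 V) x y ^ 2 * max (w x y) (E1 j0 (E2 l0 v) x y) :=
        sum2_le fun x y => mul_le_mul_of_nonneg_left (le_max_left _ _) (sq_nonneg _)
      simp only [add_assoc, add_comm 1] at h6 ⊢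
      simp only [add_zero] at a1 ⊢
      linarith

lemma DDi2 {ι : Type*} (m : ℕ) (s : Finset ι) (l1 l2 : ι → ℕ) (g : ι → Kn T)
    (hg : ∀ i x y, 0 ≤ g i x y) :
    ∑ x, ∑ y, (∑ i ∈ s, E1 (l1 i) (E2 (l2 i) (g i)) x y) ^ (m+1) ≤
      ((m+1) ^ (m+1) * (m+1) ^ (m+1)) * ∑ x, ∑ y, (∑ i ∈ s, g i x y) ^ (m+1) := by
  have a1 : ∀ y, ∑ x, (∑ i ∈ s, E1 (l1 i) (E2 (l2 i) (g i)) x y) ^ (m+1) ≤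
      (m+1) ^ (m+1) * ∑ x, (∑ i ∈ s, E2 (l2 i) (g i) x y) ^ (m+1) :=
    fun y => DDi lb lb_nest m s l1 (fun i x => E2 (l2 i) (g i) x y) (fun i x => E2_nonneg _ (hg i) x y)
  have a2 : ∀ x, ∑ y, (∑ i ∈ s, E2 (l2 i) (g i) x y) ^ (m+1) ≤ (m+1) ^ (m+1) * ∑ y, (∑ i ∈ s, g i x y) ^ (m+1) :=
    fun x => DDi lb lb_nest m s l2 (fun i y => g i x y) (fun i y => hg i x y)
  calc _ = ∑ y, ∑ x, (∑ i ∈ s, E1 (l1 i) (E2 (l2 i) (g i)) x y) ^ (m+1) := sum_comm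
    _ ≤ ∑ y, (m+1) ^ (m+1) * ∑ x, (∑ i ∈ s, E2 (l2 i) (g i) x y) ^ (m+1) := sum_le_sum fun y _ => a1 y
    _ = (m+1) ^ (m+1) * ∑ x, ∑ y, (∑ i ∈ s, E2 (l2 i) (g i) x y) ^ (m+1) := by
        rw [← mul_sum, sum_comm]
    _ ≤ (m+1) ^ (m+1) * ∑ x, (m+1) ^ (m+1) * ∑ y, (∑ i ∈ s, g i x y) ^ (m+1) :=
        mul_le_mul_of_nonneg_left (sum_le_sum fun x _ => a2 x) (by positivity)
    _ = _ := by rw [← mul_sum, mul_assoc]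

lemma YA2 (m : ℕ) {A Z : Kn T} (c : ℝ) (hc : 0 ≤ c)
    (hA : ∀ x y, 0 ≤ A x y) (hZ : ∀ x y, 0 ≤ Z x y)
    (h : ∑ x, ∑ y, A x y ^ (m + 1) ≤ c * ∑ x, ∑ y, A x y ^ m * Z x y) :
    ∑ x, ∑ y, A x y ^ (m + 1) ≤ c ^ (m+1) * ∑ x, ∑ y, Z x y ^ (m + 1) := by
  have := YA (α := Fn T × Fn T) m c hc (A := fun p => A p.1 p.2) (Z := fun p => Z p.1 p.2)
    (fun p => hA _ _) (fun p => hZ _ _) (by simpa only [Fintype.sum_prod_type] using h)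
  simpa only [Fintype.sum_prod_type] using this

lemma Dlem {ι : Type*} (m : ℕ) (K : Finset ι) (j0 l0 N : ι → ℕ) (V : ι → Kn T) :
    ∑ x, ∑ y, (∑ k ∈ K, ∑ t ∈ rg (N k), D1 (j0 k + t) (D2 (l0 k + t) (V k)) x y ^ 2) ^ (m+1) ≤
      ((m+1) ^ (m+1) * (m+1) ^ (m+1)) * ∑ x, ∑ y, (∑ k ∈ K, V k x y ^ 2) ^ (m+1) := by
  classical
  set A : Kn T := fun x y =>
    ∑ k ∈ K, ∑ t ∈ rg (N k), D1 (j0 k + t) (D2 (l0 k + t) (V k)) x y ^ 2 with hA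
  have A0 : ∀ x y, 0 ≤ A x y := fun x y => sum_nonneg fun k _ => sum_nonneg fun t _ => sq_nonneg _
  set v : Kn T := fun x y => A x y ^ m with hv
  have v0 : ∀ x y, 0 ≤ v x y := fun x y => pow_nonneg (A0 x y) m
  choose θ w h1 h2 h3 h4 h5 h6 using fun k => Dw v v0 (V k) (N k) (j0 k) (l0 k)
  have w0 : ∀ k x y, 0 ≤ w k x y := fun k x y =>
    (E1_nonneg _ (E2_nonneg _ v0) x y).trans (h5 k x y)
  set S : Finset (Σ _ : ι, ℕ) := K.sigma (fun k => rg (N k + 1)) with hS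
  set g : (Σ _ : ι, ℕ) → Kn T := fun i x y => V i.1 x y ^ 2 * θ i.1 i.2 x y with hg
  have g0 : ∀ i x y, 0 ≤ g i x y := fun i x y => mul_nonneg (sq_nonneg _) (h1 _ _ _ _)
  set Z : Kn T := fun x y => ∑ i ∈ S, E1 (j0 i.1 + i.2) (E2 (l0 i.1 + i.2) (g i)) x y with hZ
  have Z0 : ∀ x y, 0 ≤ Z x y := fun x y => sum_nonneg fun i _ => E1_nonneg _ (E2_nonneg _ (g0 i)) x y
  have b1 : ∀ k, ∑ t ∈ rg (N k), ∑ x, ∑ y, D1 (j0 k + t) (D2 (l0 k + t) (V k)) x y ^ 2 * v x y ≤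
      ∑ x, ∑ y, V k x y ^ 2 * w k x y := by
    intro k
    refine (h6 k).trans ?_
    calc _ ≤ ∑ x, ∑ y, E1 (j0 k) (E2 (l0 k) (fun x y => V k x y ^ 2)) x y * w k x y := by
          refine sum2_le fun x y => mul_le_mul_of_nonneg_right ?_ (w0 k x y)
          calc _ ≤ E1 (j0 k) (fun x y => E2 (l0 k) (V k) x y ^ 2) x y := av_sq_le _ _ _
            _ ≤ _ := E1_mono _ (fun x y => av_sq_le _ _ _) x y
      _ = ∑ x, ∑ y, V k x y ^ 2 * E1 (j0 k) (E2 (l0 k) (w k)) x y := E12_adj _ _ _ _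
      _ = _ := by rw [E12_of_ms (h4 k)]
  have b2 : ∀ k, ∑ x, ∑ y, V k x y ^ 2 * w k x y = ∑ t ∈ rg (N k + 1), ∑ x, ∑ y,
      E1 (j0 k + t) (E2 (l0 k + t) (g ⟨k, t⟩)) x y * v x y := by
    intro k
    have : ∀ t, ∑ x, ∑ y, E1 (j0 k + t) (E2 (l0 k + t) (g ⟨k, t⟩)) x y * v x y =
      ∑ x, ∑ y, V k x y ^ 2 * θ k t x y * E1 (j0 k + t) (E2 (l0 k + t) v) x y := fun t => E12_adj _ _ _ _
    simp only [this]
    symm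
    rw [sum_comm]
    refine sum_congr rfl fun x _ => ?_
    rw [sum_comm]
    refine sum_congr rfl fun y _ => ?_
    rw [h3, mul_sum]
    exact sum_congr rfl fun t _ => by ring
  have b3 : ∑ x, ∑ y, A x y ^ (m+1) ≤ 1 * ∑ x, ∑ y, A x y ^ m * Z x y := by
    calc ∑ x, ∑ y, A x y ^ (m+1) = ∑ k ∈ K, ∑ t ∈ rg (N k), ∑ x, ∑ y,
            D1 (j0 k + t) (D2 (l0 k + t) (V k)) x y ^ 2 * v x y := by
          have : ∀ x y, A x y ^ (m+1) = ∑ k ∈ K, ∑ t ∈ rg (N k),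
              D1 (j0 k + t) (D2 (l0 k + t) (V k)) x y ^ 2 * v x y := by
            intro x y
            rw [pow_succ']
            conv_lhs => rw [hA]
            rw [sum_mul]
            exact sum_congr rfl fun k _ => by rw [sum_mul]
          simp only [this]
          simp only [sum_comm (s := Finset.univ) (t := K)]
          refine sum_congr rfl fun k _ => ?_
          simp only [sum_comm (s := Finset.univ) (t := rg (N k))]
      _ ≤ ∑ k ∈ K, ∑ t ∈ rg (N k + 1), ∑ x, ∑ y,
            E1 (j0 k + t) (E2 (l0 k + t) (g ⟨k, t⟩)) x y * v x y :=
          sum_le_sum fun k _ => (b1 k).trans (b2 k).le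
      _ = _ := by
          rw [one_mul, Finset.sum_sigma' K (fun k => rg (N k + 1))
            (fun k t => ∑ x, ∑ y, E1 (j0 k + t) (E2 (l0 k + t) (g ⟨k, t⟩)) x y * v x y)]
          rw [sum_comm]
          refine sum_congr rfl fun x _ => ?_
          rw [sum_comm]
          refine sum_congr rfl fun y _ => ?_
          rw [← sum_mul, mul_comm]
  have b4 := YA2 m 1 (by norm_num) A0 Z0 b3
  rw [one_pow, one_mul] at b4
  refine b4.trans ((DDi2 m S _ _ g g0).trans (le_of_eq ?_))
  congr 1
  refine sum_congr rfl fun x _ => sum_congr rfl fun y _ => ?_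
  congr 1
  rw [hS, Finset.sum_sigma]
  refine sum_congr rfl fun k _ => ?_
  simp only [hg]
  rw [← mul_sum, h2, mul_one]

end two

section sh
variable {T : ℕ}

lemma av_cs {α β : Type*} [Fintype α] (π : α → β) (a b : α → ℝ) (z : α) :
    av π (fun w => a w * b w) z ^ 2 ≤ av π (fun w => a w ^ 2) z * av π (fun w => b w ^ 2) z := by
  classical
  simp only [av_eq_ker]
  have hk : ∀ w, 0 ≤ avK π z w := by
    intro w; unfold avK; split_ifs
    · exact div_nonneg zero_le_one (av_cnt_pos π z).le
    · exact le_rfl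
  refine Finset.sum_sq_le_sum_mul_sum_of_sq_le_mul _ (fun i _ => mul_nonneg (hk i) (sq_nonneg _))
    (fun i _ => mul_nonneg (hk i) (sq_nonneg _)) (fun i _ => le_of_eq (by ring))

lemma lb_iff {l : ℕ} (w : Fn T) (c : ℕ) : lb l w = c ↔ c * 2^l ≤ w.val ∧ w.val < (c+1) * 2^l := by
  unfold lb
  have h : 0 < 2^l := by positivity
  rw [Nat.div_eq_iff h]
  constructor
  · rintro ⟨h1, h2⟩; constructor
    · linarith
    · rw [add_mul]; omega
  · rintro ⟨h1, h2⟩; rw [add_mul] at h2; constructor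
    · linarith
    · omega

lemma lb_cnt {l : ℕ} (h : l ≤ T) (z : Fn T) :
    (∑ w : Fn T, if lb l w = lb l z then (1:ℝ) else 0) = 2^l := by
  have h1 : (∑ w : Fn T, if lb l w = lb l z then (1:ℝ) else 0) =
      ∑ w ∈ rg (2^T), if w / 2^l = lb l z then (1:ℝ) else 0 :=
    Fin.sum_univ_eq_sum_range (fun w => if w / 2^l = lb l z then (1:ℝ) else 0) (2^T)
  rw [h1, Finset.sum_boole]
  have h2 : (rg (2^T)).filter (fun w => w / 2^l = lb l z) =
      Finset.Ico (lb l z * 2^l) (lb l z * 2^l + 2^l) := by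
    ext w
    have hp : 0 < 2^l := by positivity
    simp only [mem_filter, Finset.mem_range, Finset.mem_Ico]
    rw [Nat.div_eq_iff hp]
    have hz : (lb l z + 1) * 2^l ≤ 2^T := by
      obtain ⟨k, rfl⟩ := Nat.exists_eq_add_of_le h
      rw [pow_add, mul_comm (2^l)]
      refine Nat.mul_le_mul_right _ ?_
      unfold lb
      refine Nat.succ_le_of_lt ?_
      rw [Nat.div_lt_iff_lt_mul hp, mul_comm, ← pow_add]
      exact z.2
    rw [add_mul, one_mul] at hz
    constructor
    · rintro ⟨_, h1, h2⟩; omega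
    · rintro ⟨h1, h2⟩; omega
  rw [h2, Nat.card_Ico]
  simp

lemma Ea_eq {l : ℕ} (h : l ≤ T) (a : Fn T → ℝ) (z : Fn T) :
    Ea l a z = (∑ w, if lb l w = lb l z then a w else 0) / 2^l := by
  unfold Ea av
  have := lb_cnt h z
  rw [← this]
  congr 1
  all_goals exact sum_congr rfl fun w _ => by congr

lemma Ea_zero (a : Fn T → ℝ) (z : Fn T) : Ea 0 a z = a z := by
  refine av_of_ms _ (fun z w h => ?_) z
  have : z = w := by apply Fin.ext; simpa [lb] using h
  rw [this]

lemma Ea_mul_exp (ω a : Fn T → ℝ) (n : ℕ) (z : Fn T) :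
    Ea n (fun w => ω w * a w) z = Ea n ω z * Ea n a z +
      ∑ i ∈ rg n, Ea n (fun w => De i ω w * De i a w) z := by
  induction n generalizing z with
  | zero => simp [Ea_zero]
  | succ n ih =>
    rw [← Ea_Ea (Nat.le_succ n) (fun w => ω w * a w)]
    have h1 : Ea n (fun w => ω w * a w) = fun z => Ea n ω z * Ea n a z +
      ∑ i ∈ rg n, Ea n (fun w => De i ω w * De i a w) z := funext ih
    rw [h1]
    have h2 : Ea (n+1) (fun z => Ea n ω z * Ea n a z +
      ∑ i ∈ rg n, Ea n (fun w => De i ω w * De i a w) z) z =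
      Ea (n+1) (fun z => Ea n ω z * Ea n a z) z + ∑ i ∈ rg n, Ea (n+1) (fun w => De i ω w * De i a w) z := by
      unfold Ea; rw [av_add, av_sum]; congr 1
      exact sum_congr rfl fun i _ => Ea_Ea (Nat.le_succ n) _ z
    rw [h2, Finset.sum_range_succ]
    have h3 : (fun z => Ea n ω z * Ea n a z) = fun z => ((Ea (n+1) ω z * Ea (n+1) a z + Ea (n+1) ω z * De n a z)
        + Ea (n+1) a z * De n ω z) + De n ω z * De n a z := by
      funext z; unfold De; ring
    have h4 : Ea (n+1) (fun z => Ea n ω z * Ea n a z) z = Ea (n+1) ω z * Ea (n+1) a z +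
        Ea (n+1) (fun w => De n ω w * De n a w) z := by
      rw [h3]; unfold Ea; rw [av_add, av_add, av_add]
      have e1 := av_pull (lb (n+1)) (a := Ea (n+1) a) (av_ms (lb (n+1)) ω) z
      have e2 := av_pull (lb (n+1)) (a := De n a) (av_ms (lb (n+1)) ω) z
      have e3 := av_pull (lb (n+1)) (a := De n ω) (av_ms (lb (n+1)) a) z
      have z1 : av (lb (n+1)) (De n a) z = 0 := Ea_De_zero (Nat.lt_succ_self n) a z
      have z2 : av (lb (n+1)) (De n ω) z = 0 := Ea_De_zero (Nat.lt_succ_self n) ω z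
      have z3 : av (lb (n+1)) (Ea (n+1) a) z = Ea (n+1) a z := Ea_Ea le_rfl a z
      rw [z1] at e2; rw [z2] at e3; rw [z3] at e1
      unfold Ea at e1
      rw [e1, e2, e3]; ring
    rw [h4]; ring

def wt (c : ℝ) (i d : ℕ) : ℝ := c ^ ((i:ℤ) - d).natAbs

lemma Ea_De_sq_le {i n : ℕ} (h : i < n) (ω : Fn T → ℝ) (z) :
    Ea n (fun w => De i ω w ^ 2) z ≤ Ea n (fun w => Ea i ω w ^ 2) z := by
  have h0 : ∀ w, Ea (i+1) (fun w => De i ω w ^ 2) w ≤ Ea (i+1) (fun w => Ea i ω w ^ 2) w := by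
    intro w
    have h3 : (fun z => Ea i ω z ^ 2) = fun z => De i ω z ^ 2 + (Ea (i+1) ω z * (Ea (i+1) ω z +2 * De i ω z)) := by
      funext z; unfold De; ring
    rw [h3]
    have e : Ea (i+1) (fun z => De i ω z ^ 2 + (Ea (i+1) ω z * (Ea (i+1) ω z +2 * De i ω z))) w
      = Ea (i+1) (fun z => De i ω z ^ 2) w + Ea (i+1) ω w * (Ea (i+1) ω w) := by
      have p1 := av_add (lb (i+1)) (fun z => De i ω z ^ 2) (fun z => (Ea (i+1) ω z * (Ea (i+1) ω z +2 * De i ω z))) w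
      have p2 := av_pull (lb (i+1)) (a := fun z => Ea (i+1) ω z +2 * De i ω z) (av_ms (lb (i+1)) ω) w
      have p3 := av_add (lb (i+1)) (Ea (i+1) ω) (fun z => 2 * De i ω z) w
      have p4 := av_smul (lb (i+1)) 2 (De i ω) w
      have z1 : av (lb (i+1)) (De i ω) w = 0 := Ea_De_zero (Nat.lt_succ_self i) ω w
      have z3 : av (lb (i+1)) (Ea (i+1) ω) w = Ea (i+1) ω w := Ea_Ea le_rfl ω w
      rw [p4, z1, z3, mul_zero, add_zero] at p3
      unfold Ea at *
      rw [p1, p2, p3]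
    rw [e]; nlinarith [mul_self_nonneg (Ea (i+1) ω w)]
  rw [← Ea_Ea h (fun w => De i ω w ^ 2), ← Ea_Ea h (fun w => Ea i ω w ^ 2)]
  exact av_mono _ h0 z

lemma om_bound {n d r : ℕ} (hn : n ≤ T) (hr : r ≤ 2^d) (ω : Fn T → ℝ)
    (h0 : ∀ w, 0 ≤ ω w) (h1 : ∀ w, ω w ≤ 1)
    (hb : ∀ z l, l ≤ n → Ea l ω z ≤ r / 2^l)
    (hc : ∀ (z : Fn T) i, i < n → ∃ β, ∀ w, lb n w = lb n z → lb (i+1) w ≠ β → De i ω w = 0) (i : ℕ) (hi : i < n) (z) :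
    Ea n (fun w => De i ω w ^ 2) z ≤ 2 * (2^d / 2^n) * wt (1/2) i d := by
  have hr' : (r:ℝ) ≤ 2^d := by exact_mod_cast hr
  have hE0 : ∀ l w, 0 ≤ Ea l ω w := fun l w => av_nonneg _ h0 w
  by_cases hid : d ≤ i
  · have e1 := Ea_De_sq_le hi ω z
    have e2 : Ea n (fun w => Ea i ω w ^ 2) z ≤ (r/2^i) * (r / 2^n) := by
      calc _ ≤ Ea n (fun w => (r/2^i) * Ea i ω w) z := av_mono _ (fun w => by
            rw [sq]; exact mul_le_mul_of_nonneg_right (hb w i hi.le) (hE0 i w)) z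
        _ = (r/2^i) * Ea n (Ea i ω) z := av_smul _ _ _ _
        _ = (r/2^i) * Ea n ω z := by rw [Ea_Ea hi.le]
        _ ≤ _ := mul_le_mul_of_nonneg_left (hb z n le_rfl) (by positivity)
    refine e1.trans (e2.trans ?_)
    have hw : wt (1/2) i d = 2^d / 2^i := by
      unfold wt
      obtain ⟨k, rfl⟩ := Nat.exists_eq_add_of_le hid
      have : (((d + k : ℕ):ℤ) - d).natAbs = k := by push_cast; simp
      rw [this, pow_add, one_div, inv_pow]; field_simp
    rw [hw]
    calc (r:ℝ)/2^i * (r / 2^n) ≤ 2^d/2^i * (2^d/2^n) := by gcongr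
      _ ≤ 2 * (2 ^ d / 2 ^ n) * (2 ^ d / 2 ^ i) := by
        have : (0:ℝ) ≤ (2 ^ d / 2 ^ n) * (2 ^ d / 2 ^ i) := by positivity
        linarith
  · push Not at hid
    obtain ⟨β, hβ⟩ := hc z i hi
    have hw : 2 * (2^d / 2^n) * wt (1/2) i d = (2:ℝ)^(i+1) / 2^n := by
      unfold wt
      obtain ⟨k, rfl⟩ := Nat.exists_eq_add_of_le hid.le
      have : ((i:ℤ) - (i+k:ℕ)).natAbs = k := by push_cast; simp
      rw [this, pow_add, one_div, inv_pow, pow_succ]; field_simp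
    rw [hw, Ea_eq hn]
    refine div_le_div_of_nonneg_right ?_ (by positivity)
    by_cases hz : ∃ w0 : Fn T, lb (i+1) w0 = β
    · obtain ⟨w0, hw0⟩ := hz
      rw [← lb_cnt (show i+1 ≤ T by omega) w0]
      refine sum_le_sum fun w _ => ?_
      by_cases h2 : lb n w = lb n z
      · rw [if_pos h2]
        by_cases h3 : lb (i+1) w = β
        · rw [if_pos (h3.trans hw0.symm)]
          have a1 : Ea i ω w ≤ 1 := av_le_one _ h1 w
          have a2 : Ea (i+1) ω w ≤ 1 := av_le_one _ h1 w
          have := hE0 i w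
          have := hE0 (i+1) w
          unfold De
          rw [sq_le_one_iff_abs_le_one, abs_le]; constructor <;> linarith
        · rw [hβ w h2 h3]; split_ifs <;> norm_num
      · rw [if_neg h2]; split_ifs <;> norm_num
    · push Not at hz
      rw [sum_eq_zero]
      · positivity
      · intro w _
        split_ifs with h2
        · rw [hβ w h2 (hz w)]; norm_num
        · rfl

def chi (n t : ℕ) (w : Fn T) : ℝ := if t ≤ w.val % 2^n then 1 else 0

lemma De_of_const {i : ℕ} {ω : Fn T → ℝ} {w : Fn T} (c : ℝ) (h : ∀ v, lb (i+1) v = lb (i+1) w → ω v = c) :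
    De i ω w = 0 := by
  classical
  have aux : ∀ l, l ≤ i+1 → Ea l ω w = c := by
    intro l hl
    unfold Ea
    rw [av_eq_ker, ← av_const (lb l) c w, av_eq_ker]
    refine sum_congr rfl fun v _ => ?_
    unfold avK
    split_ifs with h1
    · rw [h v (lb_nest' hl v w h1)]
    · simp
  unfold De
  rw [aux i (Nat.le_succ i), aux (i+1) le_rfl, sub_self]

lemma lb_div (n : ℕ) (w : Fn T) : w.val = 2^n * lb n w + w.val % 2^n := (Nat.div_add_mod _ _).symm

lemma chi_c (n t : ℕ) (z : Fn T) (i : ℕ) (hi : i < n) :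
    ∃ β, ∀ w : Fn T, lb n w = lb n z → lb (i+1) w ≠ β → De i (chi n t) w = 0 := by
  refine ⟨(2^n * lb n z + t) / 2^(i+1), fun w hw hne => ?_⟩
  have hp : 0 < 2^(i+1) := by positivity
  rcases lt_or_gt_of_ne hne with h | h
  · refine De_of_const 0 fun v hv => ?_
    have hvn : lb n v = lb n z := (lb_nest' (by omega) v w hv).trans hw
    unfold chi
    rw [if_neg]
    have := lb_div n v
    rw [hvn] at this
    have h2 : lb (i+1) v < (2^n * lb n z + t) / 2^(i+1) := by rw [hv]; exact h
    unfold lb at h2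
    have : v.val < 2^n * lb n z + t := by
      by_contra hh
      push Not at hh
      exact absurd (Nat.div_le_div_right (c := 2^(i+1)) hh) (not_le.2 h2)
    omega
  · refine De_of_const 1 fun v hv => ?_
    have hvn : lb n v = lb n z := (lb_nest' (by omega) v w hv).trans hw
    unfold chi
    rw [if_pos]
    have := lb_div n v
    rw [hvn] at this
    have h2 : (2^n * lb n z + t) / 2^(i+1) < lb (i+1) v := by rw [hv]; exact h
    unfold lb at h2
    have : 2^n * lb n z + t < v.val := by
      by_contra hh
      push Not at hh
      exact absurd (Nat.div_le_div_right (c := 2^(i+1)) hh) (not_le.2 h2)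
    omega

lemma cnt_ico {n : ℕ} (c s r : ℕ) :
    (∑ w : Fn T, if lb n w = c ∧ s ≤ w.val % 2^n ∧ w.val % 2^n < s + r then (1:ℝ) else 0) ≤ r := by
  rw [Finset.sum_boole]
  norm_cast
  calc _ ≤ (Finset.Ico (2^n * c + s) (2^n * c + s + r)).card := by
        refine Finset.card_le_card_of_injOn (fun w => w.val) ?_ (fun a _ b _ h => Fin.ext h)
        intro w hw
        simp only [Finset.coe_filter, Finset.mem_univ, true_and, Set.mem_ofPred_eq] at hw
        obtain ⟨h1, h2, h3⟩ := hw
        have := lb_div n w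
        rw [h1] at this
        simp only [Finset.coe_Ico, Set.mem_Ico]; omega
    _ = r := by simp

lemma chi_b {n : ℕ} (hn : n ≤ T) (ω : Fn T → ℝ) (s r : ℕ)
    (hω : ∀ w, ω w = if s ≤ w.val % 2^n ∧ w.val % 2^n < s + r then 1 else 0) (z : Fn T) (l : ℕ) (hl : l ≤ n) :
    Ea l ω z ≤ r / 2^l := by
  rw [Ea_eq (hl.trans hn)]
  refine div_le_div_of_nonneg_right ?_ (by positivity)
  refine le_trans (sum_le_sum fun w _ => ?_) (cnt_ico (T := T) (n := n) (lb n z) s r)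
  rw [hω]
  by_cases h : lb l w = lb l z
  · have := lb_nest' hl w z h
    simp [h, this]
  · rw [if_neg h]; split_ifs <;> norm_num

lemma sh_shift {n r : ℕ} (hn : n ≤ T) (hr : r ≤ 2^n) (a b : Fn T → ℝ)
    (h : ∀ x x' : Fn T, lb n x = lb n x' → x'.val = x.val + r → b x' = a x) (z) :
    Ea n (fun w => (if w.val % 2^n + r < 2^n then 1 else 0) * a w) z =
      Ea n (fun w => chi n r w * b w) z := by
  rw [Ea_eq hn, Ea_eq hn]
  congr 1
  simp only [chi, ite_mul, one_mul, zero_mul, ← ite_and]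
  rw [← Finset.sum_filter, ← Finset.sum_filter]
  have hp : 0 < 2^n := by positivity
  have hN : ∀ w : Fn T, w.val % 2^n + r < 2^n → w.val + r < 2^T := by
    intro w hw
    have h1 := lb_div n w
    have h2 : 2^n * (lb n w + 1) ≤ 2^T := by
      obtain ⟨k, rfl⟩ := Nat.exists_eq_add_of_le hn
      rw [pow_add]
      refine Nat.mul_le_mul_left _ ?_
      unfold lb
      refine Nat.succ_le_of_lt ?_
      rw [Nat.div_lt_iff_lt_mul hp, mul_comm, ← pow_add]
      exact w.2
    rw [mul_add] at h2; omega
  have hT : ∀ x : ℕ, x % 2^T < 2^T := fun x => Nat.mod_lt _ (by positivity)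
  have key : ∀ w : Fn T, w.val % 2^n + r < 2^n → (w.val + r) % 2^n = w.val % 2^n + r ∧ (w.val + r) / 2^n = lb n w := by
    intro w hw
    have h1 := lb_div n w
    have := Nat.div_mod_unique (a := w.val + r) (c := w.val % 2^n + r) (d := lb n w) hp
    obtain ⟨h3, h4⟩ := this.2 ⟨by omega, hw⟩
    exact ⟨h4, h3⟩
  refine Finset.sum_bij' (fun w _ => ⟨(w.val + r) % 2^T, hT _⟩) (fun w _ => ⟨w.val - r, by omega⟩) ?_ ?_ ?_ ?_ ?_
  · intro w hw
    simp only [mem_filter, Finset.mem_univ, true_and] at hw ⊢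
    obtain ⟨h1, h2⟩ := hw
    refine ⟨?_, ?_⟩
    · unfold lb; simp only; rw [Nat.mod_eq_of_lt (hN w h2), (key w h2).2]; exact h1
    · rw [Nat.mod_eq_of_lt (hN w h2), (key w h2).1]; omega
  · intro w hw
    simp only [mem_filter, Finset.mem_univ, true_and] at hw ⊢
    obtain ⟨h1, h2⟩ := hw
    have h3 := lb_div n w
    have h5 : w.val % 2^n < 2^n := Nat.mod_lt _ hp
    obtain ⟨h6, h7⟩ := (Nat.div_mod_unique (a := w.val - r) (c := w.val % 2^n - r) (d := lb n w) hp).2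
      ⟨by omega, by omega⟩
    refine ⟨?_, ?_⟩
    · unfold lb at *; simp only; rw [h6]; exact h1
    · rw [h7]; omega
  · intro w hw
    simp only [mem_filter, Finset.mem_univ, true_and] at hw
    apply Fin.ext; simp only
    rw [Nat.mod_eq_of_lt (hN w hw.2)]; omega
  · intro w hw
    simp only [mem_filter, Finset.mem_univ, true_and] at hw
    apply Fin.ext; simp only
    have h3 := lb_div n w
    rw [Nat.sub_add_cancel (by omega), Nat.mod_eq_of_lt w.2]
  · intro w hw
    simp only [mem_filter, Finset.mem_univ, true_and] at hw
    symm
    refine h w _ ?_ ?_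
    · unfold lb; simp only; rw [Nat.mod_eq_of_lt (hN w hw.2), (key w hw.2).2]; rfl
    · simp only; rw [Nat.mod_eq_of_lt (hN w hw.2)]

lemma sum_int_pow {c : ℝ} (h0 : 0 ≤ c) (h1 : c < 1) (s : Finset ℤ) : ∑ e ∈ s, c ^ e.natAbs ≤ 2 / (1 - c) := by
  have a1 : HasSum (fun n : ℕ => c ^ ((n:ℤ)).natAbs) (1 - c)⁻¹ := by
    simpa using hasSum_geometric_of_lt_one h0 h1
  have a2 : HasSum (fun n : ℕ => c ^ (-((n:ℤ)+1)).natAbs) (c * (1 - c)⁻¹) := by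
    have := (hasSum_geometric_of_lt_one h0 h1).mul_left c
    refine this.congr_fun ?_ |> fun h => h
    intro n
    have : (-((n:ℤ)+1)).natAbs = n + 1 := by omega
    rw [this, pow_succ']
  have a3 := HasSum.of_nat_of_neg_add_one (f := fun e : ℤ => c ^ e.natAbs) a1 a2
  refine (sum_le_hasSum s (fun e _ => by positivity) a3).trans ?_
  have : 0 < 1 - c := by linarith
  rw [div_eq_mul_inv, ← one_add_mul]
  have : 0 < (1-c)⁻¹ := by positivity
  nlinarith

lemma sum_wt {c : ℝ} (h0 : 0 ≤ c) (h1 : c < 1) (s : Finset ℕ) (d : ℕ) : ∑ i ∈ s, wt c i d ≤ 2 / (1 - c) := by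
  have := sum_int_pow h0 h1 (s.image (fun i : ℕ => (i:ℤ) - d))
  rw [Finset.sum_image (fun a _ b _ h => by simpa using h)] at this
  exact this

lemma De_one_sub (i : ℕ) (ω : Fn T → ℝ) (w) : De i (fun w => 1 - ω w) w = - De i ω w := by
  unfold De Ea; rw [av_sub, av_sub, av_const, av_const]; ring

lemma SH {n d r : ℕ} (hn : n ≤ T) (hd : d < n) (hr : r ≤ 2^d) (a b : Fn T → ℝ)
    (h : ∀ x x' : Fn T, lb n x = lb n x' → x'.val = x.val + r → b x' = a x) :
    ∑ z, (Ea n a z - Ea n b z) ^ 2 ≤ 128 * (2^d / 2^n) * ∑ i ∈ rg n, wt (3/4) i d *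
      (∑ z, De i a z ^ 2 + ∑ z, De i b z ^ 2) := by
  have hdn : 2 * 2^d ≤ 2^n := by rw [← pow_succ']; exact Nat.pow_le_pow_right (by norm_num) hd
  have hrn : r ≤ 2^n := by omega
  set ω : Fn T → ℝ := chi n (2^n - r) with hω
  set ω' : Fn T → ℝ := fun w => 1 - chi n r w with hω'
  have chi0 : ∀ t (w : Fn T), 0 ≤ chi n t w := fun t w => by unfold chi; split_ifs <;> norm_num
  have chi1 : ∀ t (w : Fn T), chi n t w ≤ 1 := fun t w => by unfold chi; split_ifs <;> norm_num
  have hmod : ∀ w : Fn T, w.val % 2^n < 2^n := fun w => Nat.mod_lt _ (by positivity)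
  have hωb : ∀ z l, l ≤ n → Ea l ω z ≤ r / 2^l := fun z l hl => chi_b hn ω (2^n - r) r (fun w => by
    have := hmod w
    simp only [hω, chi]; congr 1; apply propext; constructor
    · intro; omega
    · intro; omega) z l hl
  have hωb' : ∀ z l, l ≤ n → Ea l ω' z ≤ r / 2^l := fun z l hl => chi_b hn ω' 0 r (fun w => by
    simp only [hω', chi]
    by_cases h : r ≤ w.val % 2^n
    · rw [if_pos h, if_neg (by omega)]; norm_num
    · rw [if_neg h, if_pos (by omega)]; norm_num) z l hl
  have B1 : ∀ i, i < n → ∀ z, Ea n (fun w => De i ω w ^ 2) z ≤ 2 * (2^d / 2^n) * wt (1/2) i d :=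
    fun i hi z => om_bound hn hr ω (chi0 _) (chi1 _) hωb (fun z i hi => chi_c n _ z i hi) i hi z
  have B2 : ∀ i, i < n → ∀ z : Fn T, Ea n (fun w => De i (chi n r) w ^ 2) z ≤ 2 * (2^d / 2^n) * wt (1/2) i d := by
    intro i hi z
    have := om_bound hn hr ω' (fun w => by simp only [hω']; linarith [chi1 r w])
      (fun w => by simp only [hω']; linarith [chi0 r w]) hωb' (fun z i hi => by
        obtain ⟨β, hβ⟩ := chi_c n r z i hi
        exact ⟨β, fun w h1 h2 => by rw [hω', De_one_sub, hβ w h1 h2, neg_zero]⟩) i hi z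
    refine le_trans (le_of_eq ?_) this
    congr 1; funext w; rw [hω', De_one_sub]; ring
  set ω1 : Fn T → ℝ := fun w => if w.val % 2^n + r < 2^n then 1 else 0 with hω1
  have hω1e : ω1 = fun w => 1 - ω w := by
    funext w
    simp only [hω1, hω, chi]
    by_cases h : w.val % 2^n + r < 2^n
    · rw [if_pos h, if_neg (by omega)]; norm_num
    · rw [if_neg h, if_pos (by omega)]; norm_num
  have B1' : ∀ i, i < n → ∀ z, Ea n (fun w => De i ω1 w ^ 2) z ≤ 2 * (2^d / 2^n) * wt (1/2) i d := by
    intro i hi z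
    refine le_trans (le_of_eq ?_) (B1 i hi z)
    congr 1; funext w; rw [hω1e, De_one_sub]; ring
  have hwp : ∀ c i, 0 < c → 0 < wt c i d := fun c i hc => by unfold wt; positivity
  have hw8 : ∑ i ∈ rg n, wt (3/4) i d ≤ 8 := by
    have := sum_wt (c := 3/4) (by norm_num) (by norm_num) (rg n) d
    norm_num at this ⊢; exact this
  have hww : ∀ i, wt (1/2) i d ≤ wt (3/4) i d * wt (3/4) i d := by
    intro i; unfold wt; rw [← mul_pow]; exact pow_le_pow_left₀ (by norm_num) (by norm_num) _
  set ε : ℝ := 2^d/2^n with hε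
  have hε0 : 0 < ε := by positivity
  have main : ∀ z, (Ea n a z - Ea n b z) ^ 2 ≤ 128 * ε * ∑ i ∈ rg n, wt (3/4) i d *
      (Ea n (fun w => De i a w ^ 2) z + Ea n (fun w => De i b w ^ 2) z) := by
    intro z
    have s1 := sh_shift hn hrn a b h z
    have s2 := sh_shift hn hrn (fun _ => 1) (fun _ => 1) (fun _ _ _ _ => rfl) z
    simp only [mul_one] at s2
    change Ea n ω1 z = Ea n (chi n r) z at s2
    change Ea n (fun w => ω1 w * a w) z = _ at s1
    rw [Ea_mul_exp, Ea_mul_exp, s2] at s1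
    set η := Ea n (chi n r) z with hη
    have hη2 : 1/2 ≤ η := by
      have e1 := hωb' z n le_rfl
      have e2 : Ea n ω' z = 1 - η := by
        have := av_sub (lb n) (fun _ => 1) (chi n r) z
        rw [av_const] at this; exact this
      have e3 : (r:ℝ) / 2^n ≤ 1/2 := by
        rw [div_le_div_iff₀ (by positivity) (by norm_num)]
        have : (2 * r : ℝ) ≤ 2^n := by exact_mod_cast (by omega : 2 * r ≤ 2^n)
        linarith
      linarith
    set c : ℕ → ℝ := fun i => Ea n (fun w => De i ω1 w * De i a w) z with hc
    set c' : ℕ → ℝ := fun i => Ea n (fun w => De i (chi n r) w * De i b w) z with hc'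
    have s3 : η * (Ea n a z - Ea n b z) = ∑ i ∈ rg n, (c' i - c i) := by
      rw [sum_sub_distrib]; linarith
    have s4 : (∑ i ∈ rg n, (c' i - c i)) ^ 2 ≤ (∑ i ∈ rg n, wt (3/4) i d) *
        ∑ i ∈ rg n, (c' i - c i) ^ 2 / wt (3/4) i d := by
      refine Finset.sum_sq_le_sum_mul_sum_of_sq_le_mul _ (fun i _ => (hwp _ _ (by norm_num)).le)
        (fun i _ => div_nonneg (sq_nonneg _) (hwp _ _ (by norm_num)).le) (fun i _ => le_of_eq ?_)
      have := hwp (3/4) i (by norm_num)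
      field_simp
    have s5 : ∀ i ∈ rg n, (c' i - c i) ^ 2 / wt (3/4) i d ≤ 4 * ε * (wt (3/4) i d *
        (Ea n (fun w => De i a w ^ 2) z + Ea n (fun w => De i b w ^ 2) z)) := by
      intro i hi
      have hi' := Finset.mem_range.1 hi
      have hA0 : 0 ≤ Ea n (fun w => De i a w ^ 2) z := av_nonneg _ (fun w => sq_nonneg _) z
      have hB0 : 0 ≤ Ea n (fun w => De i b w ^ 2) z := av_nonneg _ (fun w => sq_nonneg _) z
      have q1 : c i ^ 2 ≤ 2 * ε * (wt (3/4) i d * wt (3/4) i d) * Ea n (fun w => De i a w ^ 2) z :=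
        (av_cs _ _ _ z).trans (mul_le_mul_of_nonneg_right ((B1' i hi' z).trans
          (mul_le_mul_of_nonneg_left (hww i) (by positivity))) hA0)
      have q2 : c' i ^ 2 ≤ 2 * ε * (wt (3/4) i d * wt (3/4) i d) * Ea n (fun w => De i b w ^ 2) z :=
        (av_cs _ _ _ z).trans (mul_le_mul_of_nonneg_right ((B2 i hi' z).trans
          (mul_le_mul_of_nonneg_left (hww i) (by positivity))) hB0)
      rw [div_le_iff₀ (hwp _ _ (by norm_num))]
      nlinarith [sq_nonneg (c i + c' i)]
    have s6 : (∑ i ∈ rg n, (c' i - c i)) ^ 2 ≤ 8 * ∑ i ∈ rg n, 4 * ε * (wt (3/4) i d *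
        (Ea n (fun w => De i a w ^ 2) z + Ea n (fun w => De i b w ^ 2) z)) := by
      refine s4.trans (mul_le_mul hw8 (sum_le_sum s5) (sum_nonneg fun i _ =>
        div_nonneg (sq_nonneg _) (hwp _ _ (by norm_num)).le) (by norm_num))
    rw [← mul_sum, ← s3, mul_pow] at s6
    have : (1/4:ℝ) ≤ η^2 := by nlinarith
    nlinarith [mul_le_mul_of_nonneg_right this (sq_nonneg (Ea n a z - Ea n b z))]
  calc _ ≤ _ := sum_le_sum fun z _ => main z
    _ = _ := by
      rw [← mul_sum, sum_comm]
      congr 1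
      refine sum_congr rfl fun i _ => ?_
      rw [← mul_sum, sum_add_distrib]
      congr 2
      · exact av_total (lb n) (fun w => De i a w ^ 2)
      · exact av_total (lb n) (fun w => De i b w ^ 2)

end sh

section dec
variable {T : ℕ}

lemma tele_x (h : ℕ → Kn T) (h0 : ∀ j x y, 0 ≤ h j x y)
    (hm : ∀ j x y, h (j+1) x y ≤ h j x y) (c b n : ℕ) :
    ∑ t ∈ rg n, ∑ x, ∑ y, D1 (c+t) (h (b+t)) x y ^ 2 ≤ ∑ x, ∑ y, h b x y ^ 2 := by
  have key : ∑ t ∈ rg n, ∑ x, ∑ y, D1 (c+t) (h (b+t)) x y ^ 2 + ∑ x, ∑ y, E1 (c+n) (h (b+n)) x y ^ 2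
      ≤ ∑ x, ∑ y, E1 c (h b) x y ^ 2 := by
    induction n with
    | zero => simp
    | succ n ih =>
      rw [Finset.sum_range_succ]
      have := pyth_x (c+n) (h (b+n)) (fun _ _ => 1) (fun _ _ _ _ => rfl)
      simp only [mul_one] at this
      have h2 : ∑ x, ∑ y, E1 (c+(n+1)) (h (b+(n+1))) x y ^ 2 ≤ ∑ x, ∑ y, E1 (c+n+1) (h (b+n)) x y ^ 2 :=
        sum2_le fun x y => pow_le_pow_left₀ (E1_nonneg _ (h0 _) x y) (E1_mono _ (hm (b+n)) x y) 2
      linarith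
  have h3 : ∑ x, ∑ y, E1 c (h b) x y ^ 2 ≤ ∑ x, ∑ y, h b x y ^ 2 := by
    rw [sum_comm, sum_comm (f := fun x y => h b x y ^ 2)]
    refine sum_le_sum fun y _ => ?_
    rw [← av_total (lb c) (fun x => h b x y ^ 2)]
    exact sum_le_sum fun x _ => av_sq_le _ _ _
  have h4 : 0 ≤ ∑ x, ∑ y, E1 (c+n) (h (b+n)) x y ^ 2 := sum2_nonneg fun x y => sq_nonneg _
  linarith

lemma tele_y (h : ℕ → Kn T) (h0 : ∀ j x y, 0 ≤ h j x y)
    (hm : ∀ j x y, h (j+1) x y ≤ h j x y) (c b n : ℕ) :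
    ∑ t ∈ rg n, ∑ x, ∑ y, D2 (c+t) (h (b+t)) x y ^ 2 ≤ ∑ x, ∑ y, h b x y ^ 2 := by
  have := tele_x (fun j x y => h j y x) (fun j x y => h0 j y x) (fun j x y => hm j y x) c b n
  rw [sum_comm (f := fun x y => h b x y ^ 2)]
  refine le_trans (le_of_eq ?_) this
  exact sum_congr rfl fun t _ => sum_comm

lemma diag_sub (A : ℕ → ℕ → ℝ) (hA : ∀ i j, 0 ≤ A i j) (F : Finset (ℕ × ℕ)) (e : ℤ) (n : ℕ)
    (hF : ∀ p ∈ F, (p.1:ℤ) - p.2 = e ∧ p.2 < n) :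
    ∑ p ∈ F, A p.1 p.2 ≤ ∑ t ∈ rg n, A (e.toNat + t) ((-e).toNat + t) := by
  classical
  have h1 : ∑ p ∈ F, A p.1 p.2 = ∑ t ∈ F.image (fun p => min p.1 p.2), A (e.toNat + t) ((-e).toNat + t) := by
    rw [Finset.sum_image]
    · refine sum_congr rfl fun p hp => ?_
      have := (hF p hp).1
      congr 1 <;> omega
    · intro p hp p' hp' h
      have a := (hF p hp).1
      have b := (hF p' hp').1
      simp only at h
      ext <;> omega
  rw [h1]
  refine Finset.sum_le_sum_of_subset_of_nonneg ?_ (fun _ _ _ => hA _ _)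
  intro t ht
  obtain ⟨p, hp, rfl⟩ := Finset.mem_image.1 ht
  have := (hF p hp).2
  simp only [Finset.mem_range]; omega

lemma diag_wt {ρ : ℝ} (hρ : 0 ≤ ρ) (hρ1 : ρ < 1) (A : ℕ → ℕ → ℝ) (hA : ∀ i j, 0 ≤ A i j) (M : ℝ)
    (hM : ∀ c b n, ∑ t ∈ rg n, A (c+t) (b+t) ≤ M) (o : ℤ) (n m : ℕ) :
    ∑ j ∈ rg n, ∑ i ∈ rg m, ρ ^ ((i:ℤ) - j - o).natAbs * A i j ≤ 2 / (1 - ρ) * M := by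
  classical
  have hM0 : 0 ≤ M := by simpa using hM 0 0 0
  rw [sum_comm, ← Finset.sum_product']
  set F := rg m ×ˢ rg n
  rw [← Finset.sum_fiberwise_of_maps_to (s := F) (t := F.image (fun p => (p.1:ℤ) - p.2)) (g := fun p => (p.1:ℤ) - p.2)
    (fun p hp => Finset.mem_image_of_mem _ hp)]
  calc _ ≤ ∑ e ∈ F.image (fun p => (p.1:ℤ) - p.2), ρ ^ (e - o).natAbs * M := by
        refine sum_le_sum fun e _ => ?_
        calc _ = ρ ^ (e - o).natAbs * ∑ p ∈ F with (p.1:ℤ) - p.2 = e, A p.1 p.2 := by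
              rw [mul_sum]
              refine sum_congr rfl fun p hp => ?_
              rw [← (Finset.mem_filter.1 hp).2]
          _ ≤ _ := by
              refine mul_le_mul_of_nonneg_left ((diag_sub A hA _ e n ?_).trans (hM _ _ _)) (by positivity)
              intro p hp
              obtain ⟨h1, h2⟩ := Finset.mem_filter.1 hp
              exact ⟨h2, Finset.mem_range.1 (Finset.mem_product.1 h1).2⟩
    _ = (∑ e ∈ F.image (fun p => (p.1:ℤ) - p.2), ρ ^ (e - o).natAbs) * M := by rw [sum_mul]
    _ ≤ _ := by
        refine mul_le_mul_of_nonneg_right ?_ hM0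
        have := sum_int_pow hρ hρ1 ((F.image (fun p => (p.1:ℤ) - p.2)).image (fun e => e - o))
        rwa [Finset.sum_image (fun a _ b _ h => by simpa using h)] at this

lemma Ea_comp_fl (l : ℕ) (a : Fn T → ℝ) (z) : Ea l (fun w => a (fl l w)) z = Ea l a (fl l z) := by
  by_cases h : l < T
  · rw [Ea_eq h.le, Ea_eq h.le, ← sum_fl l (fun w => if lb l w = lb l (fl l z) then a w else 0)]
    congr 1
    refine sum_congr rfl fun w _ => ?_
    have : lb l (fl l w) = lb l (fl l z) ↔ lb l w = lb l z := by
      rw [lb_fl h, lb_fl h]; exact Nat.xor_left_inj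
    simp only [this]
  · have : ∀ w : Fn T, fl l w = w := fun w => by simp [fl, h]
    simp only [this]

lemma De_half (l : ℕ) (a : Fn T → ℝ) (z) : De l a z = (1/2) * Ea l (fun w => a w - a (fl l w)) z := by
  by_cases h : l < T
  · have h1 := Ea_fl h a z
    have h2 : Ea l (fun w => a w - a (fl l w)) z = Ea l a z - Ea l a (fl l z) := by
      rw [← Ea_comp_fl]; exact av_sub _ _ _ _
    rw [h2]; unfold De; linarith
  · have : ∀ w : Fn T, fl l w = w := fun w => by simp [fl, h]
    rw [De_big (by omega)]
    simp only [this, sub_self]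
    unfold Ea; rw [av_const]; ring

lemma De_half_sq (l : ℕ) (a : Fn T → ℝ) :
    ∑ z, De l a z ^ 2 ≤ (1/4) * ∑ z, (a z - a (fl l z)) ^ 2 := by
  rw [← av_total (lb l) (fun z => (a z - a (fl l z)) ^ 2), mul_sum]
  refine sum_le_sum fun z _ => ?_
  rw [De_half, mul_pow]
  have := av_sq_le (lb l) (fun w => a w - a (fl l w)) z
  unfold Ea; linarith

lemma fl_cases (l : ℕ) (hl : l < T) (y : Fn T) :
    (fl l y).val = y.val + 2^l ∨ y.val = (fl l y).val + 2^l := by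
  have hp : 0 < 2^l := by positivity
  have h1 := lb_div l y
  have h2 := lb_div l (fl l y)
  have h3 : (fl l y).val % 2^l = y.val % 2^l := by
    rw [fl_val hl, Nat.xor_mod_two_pow]; simp
  rw [h3, lb_fl hl] at h2
  rcases Nat.even_or_odd (lb l y) with h | h
  · rw [Nat.xor_one_of_even h] at h2
    left; rw [mul_add] at h2; omega
  · rw [Nat.xor_one_of_odd h] at h2
    right
    obtain ⟨m, hm⟩ := h
    rw [hm] at h1 h2
    rw [Nat.add_sub_cancel] at h2
    rw [mul_add] at h1; omega

lemma SHsym {n d r : ℕ} (hn : n ≤ T) (hd : d < n) (hr : r ≤ 2^d) (a b : Fn T → ℝ)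
    (h : (∀ x x' : Fn T, lb n x = lb n x' → x'.val = x.val + r → b x' = a x) ∨
      (∀ x x' : Fn T, lb n x = lb n x' → x'.val = x.val + r → a x' = b x)) :
    ∑ z, (Ea n a z - Ea n b z) ^ 2 ≤ 128 * (2^d / 2^n) * ∑ i ∈ rg n, wt (3/4) i d *
      (∑ z, De i a z ^ 2 + ∑ z, De i b z ^ 2) := by
  rcases h with h | h
  · exact SH hn hd hr a b h
  · have := SH hn hd hr b a h
    refine le_trans (le_of_eq (sum_congr rfl fun z _ => by ring)) (this.trans (le_of_eq ?_))
    congr 1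
    exact sum_congr rfl fun i _ => by ring

def LInv (P j : ℕ) (h : Kn T) : Prop :=
  ∀ x x' y y' : Fn T, lb j x = lb j x' → y.val / P + x'.val = y'.val / P + x.val → h x y = h x' y'

lemma tall {P j k l : ℕ} (hl : l < T) (hj : j < T) (hP0 : 0 < P) (hP : P ≤ 2^(k+1)) (hkl : k + j + 2 ≤ l)
    (h : Kn T) (hh : LInv P (j+1) h) :
    ∑ x, ∑ y, D1 j (D2 l h) x y ^ 2 ≤ 64 * (2^(k+1+j) / 2^l) * ∑ i ∈ rg l, wt (3/4) i (k+1+j) *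
      ∑ x, ∑ y, D2 i h x y ^ 2 := by
  have e1 : ∑ x, ∑ y, D1 j (D2 l h) x y ^ 2 ≤ ∑ x, ∑ y, D1 j (E2 l h) x y ^ 2 := by
    rw [D12, D1E2]
    have := pyth_y l (D1 j h) (fun _ _ => 1) (fun _ _ _ _ => rfl)
    simp only [mul_one] at this
    rw [this]
    have : 0 ≤ ∑ x, ∑ y, E2 (l+1) (D1 j h) x y ^ 2 := sum2_nonneg fun x y => sq_nonneg _
    linarith
  have e2 : ∑ x, ∑ y, D1 j (E2 l h) x y ^ 2 ≤ (1/4) * ∑ x, ∑ y, (Ea l (h x) y - Ea l (h (fl j x)) y) ^ 2 := by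
    rw [sum_comm, sum_comm (f := fun x y => (Ea l (h x) y - Ea l (h (fl j x)) y) ^ 2), mul_sum]
    exact sum_le_sum fun y _ => De_half_sq j (fun x => E2 l h x y)
  have e3 : ∀ x, ∑ y, (Ea l (h x) y - Ea l (h (fl j x)) y) ^ 2 ≤ 128 * (2^(k+1+j) / 2^l) *
      ∑ i ∈ rg l, wt (3/4) i (k+1+j) * (∑ y, De i (h x) y ^ 2 + ∑ y, De i (h (fl j x)) y ^ 2) := by
    intro x
    refine SHsym (r := P * 2^j) hl.le (by omega) (by rw [pow_add]; exact Nat.mul_le_mul_right _ hP) _ _ ?_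
    have hx := lb_fl_succ j x
    rcases fl_cases j hj x with hf | hf
    · left
      intro y y' _ hy
      refine hh _ _ _ _ hx ?_
      rw [hy, hf, Nat.add_mul_div_left _ _ hP0]; omega
    · right
      intro y y' _ hy
      refine hh _ _ _ _ hx.symm ?_
      rw [hy, Nat.add_mul_div_left _ _ hP0]; omega
  refine e1.trans (e2.trans ?_)
  calc _ ≤ (1/4) * ∑ x, 128 * ((2:ℝ)^(k+1+j) / 2^l) *
      ∑ i ∈ rg l, wt (3/4) i (k+1+j) * (∑ y, De i (h x) y ^ 2 + ∑ y, De i (h (fl j x)) y ^ 2) :=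
        mul_le_mul_of_nonneg_left (sum_le_sum fun x _ => e3 x) (by norm_num)
    _ = _ := by
        rw [← mul_sum, sum_comm]
        have : ∀ i, ∑ x, wt (3/4) i (k+1+j) * (∑ y, De i (h x) y ^ 2 + ∑ y, De i (h (fl j x)) y ^ 2) =
          2 * (wt (3/4) i (k+1+j) * ∑ x, ∑ y, D2 i h x y ^ 2) := by
          intro i
          rw [← mul_sum, sum_add_distrib, sum_fl j (fun x => ∑ y, De i (h x) y ^ 2)]
          unfold D2; ring
        simp only [this]
        rw [← mul_sum]; ring

lemma wide {P j k l : ℕ} (hl : l < T) (hj : j < T) (hP : 2^k ≤ P) (hkl : k ≤ l) (hlj : l + 1 < j + k)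
    (h : Kn T) (hh : LInv P j h) :
    ∑ x, ∑ y, D1 j (D2 l h) x y ^ 2 ≤ 64 * (2^(l+1-k) / 2^j) * ∑ i ∈ rg j, wt (3/4) i (l+1-k) *
      ∑ x, ∑ y, D1 i h x y ^ 2 := by
  have hP0 : 0 < P := lt_of_lt_of_le (by positivity) hP
  have e1 : ∑ x, ∑ y, D1 j (D2 l h) x y ^ 2 ≤ ∑ x, ∑ y, D2 l (E1 j h) x y ^ 2 := by
    rw [← E1D2]
    have := pyth_x j (D2 l h) (fun _ _ => 1) (fun _ _ _ _ => rfl)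
    simp only [mul_one] at this
    rw [this]
    have : 0 ≤ ∑ x, ∑ y, E1 (j+1) (D2 l h) x y ^ 2 := sum2_nonneg fun x y => sq_nonneg _
    linarith
  have e2 : ∑ x, ∑ y, D2 l (E1 j h) x y ^ 2 ≤ (1/4) * ∑ y, ∑ x, (Ea j (fun x => h x y) x - Ea j (fun x => h x (fl l y)) x) ^ 2 := by
    rw [sum_comm (f := fun y x => (Ea j (fun x => h x y) x - Ea j (fun x => h x (fl l y)) x) ^ 2), mul_sum]
    exact sum_le_sum fun x _ => De_half_sq l (fun y => E1 j h x y)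
  have e3 : ∀ y, ∑ x, (Ea j (fun x => h x y) x - Ea j (fun x => h x (fl l y)) x) ^ 2 ≤ 128 * (2^(l+1-k) / 2^j) *
      ∑ i ∈ rg j, wt (3/4) i (l+1-k) *
        (∑ x, De i (fun x => h x y) x ^ 2 + ∑ x, De i (fun x => h x (fl l y)) x ^ 2) := by
    intro y
    have hb : ∀ v : ℕ, (v + 2^l) / P - v / P ≤ 2^(l+1-k) ∧ v / P ≤ (v + 2^l)/P := by
      intro v
      refine ⟨?_, Nat.div_le_div_right (Nat.le_add_right _ _)⟩
      have h0 : 0 < 2^(l-k) := by positivity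
      have h1 : 2^l = 2^(l-k) * 2^k := by rw [← pow_add]; congr 1; omega
      have h2 : 2^(l+1-k) = 2 * 2^(l-k) := by rw [← pow_succ']; congr 1; omega
      have h3 : v + 2^l ≤ v + 2^(l-k) * P := by rw [h1]; exact Nat.add_le_add_left (Nat.mul_le_mul_left _ hP) _
      have h4 := Nat.div_le_div_right (c := P) h3
      rw [Nat.add_mul_div_right _ _ hP0] at h4
      omega
    rcases fl_cases l hl y with hf | hf
    · refine SHsym (r := (fl l y).val / P - y.val / P) hj.le (by omega) (by rw [hf]; exact (hb _).1) _ _ ?_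
      left
      intro x x' hx hx'
      refine hh _ _ _ _ hx.symm ?_
      rw [hx', hf]; have := (hb y.val).2; omega
    · refine SHsym (r := y.val / P - (fl l y).val / P) hj.le (by omega)
        (by rw [hf]; exact (hb _).1) _ _ ?_
      right
      intro x x' hx hx'
      refine hh _ _ _ _ hx.symm ?_
      have := (hb (fl l y).val).2
      rw [← hf] at this
      omega
  refine e1.trans (e2.trans ?_)
  calc _ ≤ (1/4) * ∑ y, 128 * ((2:ℝ)^(l+1-k) / 2^j) *
      ∑ i ∈ rg j, wt (3/4) i (l+1-k) *
        (∑ x, De i (fun x => h x y) x ^ 2 + ∑ x, De i (fun x => h x (fl l y)) x ^ 2) :=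
        mul_le_mul_of_nonneg_left (sum_le_sum fun x _ => e3 x) (by norm_num)
    _ = _ := by
        rw [← mul_sum, sum_comm]
        have : ∀ i, ∑ y, wt (3/4) i (l+1-k) * (∑ x, De i (fun x => h x y) x ^ 2 + ∑ x, De i (fun x => h x (fl l y)) x ^ 2) =
          2 * (wt (3/4) i (l+1-k) * ∑ x, ∑ y, D1 i h x y ^ 2) := by
          intro i
          rw [← mul_sum, sum_add_distrib, sum_fl l (fun y => ∑ x, De i (fun x => h x y) x ^ 2),
            sum_comm (f := fun x y => D1 i h x y ^ 2)]
          unfold D1; ring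
        simp only [this]
        rw [← mul_sum]; ring

end dec

section dec2
variable {T : ℕ}

lemma sum_if_unique (n : ℕ) (p : ℕ → Prop) [DecidablePred p] (a : ℕ → ℝ) (B : ℝ) (hB : 0 ≤ B)
    (hu : ∀ l l', p l → p l' → l = l') (ha : ∀ l < n, p l → a l ≤ B) :
    ∑ l ∈ rg n, (if p l then a l else 0) ≤ B := by
  by_cases h : ∃ l < n, p l
  · obtain ⟨l, hl, hp⟩ := h
    rw [Finset.sum_eq_single l]
    · rw [if_pos hp]; exact ha l hl hp
    · intro l' _ hne; rw [if_neg]; exact fun h => hne (hu _ _ h hp)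
    · intro h; exact absurd (Finset.mem_range.2 hl) h
  · push Not at h
    rw [sum_eq_zero]
    · exact hB
    · intro l hl; rw [if_neg (h l (Finset.mem_range.1 hl))]

lemma LInv.mono {P j j' : ℕ} (hj : j ≤ j') {h : Kn T} (hh : LInv P j' h) : LInv P j h :=
  fun x x' y y' e e' => hh x x' y y' (lb_nest' hj _ _ e) e'

lemma decay {P k q : ℕ} (hP : 2^k ≤ P) (hP' : P < 2^(k+1)) (hk : k < q)
    (h : ℕ → Kn T) (h0 : ∀ j x y, 0 ≤ h j x y)
    (hm : ∀ j x y, h (j+1) x y ≤ h j x y) (hL : ∀ j < T, LInv P (j+1) (h j)) (s : ℤ) :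
    ∑ j ∈ rg T, ∑ l ∈ rg T,
      (if q ≤ l ∧ (j:ℤ) + k = l + s then ∑ x, ∑ y, D1 j (D2 l (h j)) x y ^ 2 else 0) ≤
      1024 * (1/2) ^ s.natAbs * ∑ x, ∑ y, h 0 x y ^ 2 := by
  set M := ∑ x, ∑ y, h 0 x y ^ 2 with hMdef
  have hP0 : 0 < P := lt_of_lt_of_le (by positivity) hP
  have anti : ∀ b x y, h b x y ≤ h 0 x y := fun b x y => by
    induction b with
    | zero => exact le_rfl
    | succ n ih => exact (hm n x y).trans ih
  have hb : ∀ b, ∑ x, ∑ y, h b x y ^ 2 ≤ M := fun b =>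
    sum2_le fun x y => pow_le_pow_left₀ (h0 b x y) (anti b x y) 2
  have M0 : 0 ≤ M := sum2_nonneg fun x y => sq_nonneg _
  have hu : ∀ (j:ℕ) (l l' : ℕ), (q ≤ l ∧ (j:ℤ) + k = l + s) → (q ≤ l' ∧ (j:ℤ) + k = l' + s) → l = l' := by
    intro j l l' h1 h2; omega
  rcases le_or_gt s (-2) with hs | hs
  · set A : ℕ → ℕ → ℝ := fun i j => ∑ x, ∑ y, D2 i (h j) x y ^ 2 with hA
    have A0 : ∀ i j, 0 ≤ A i j := fun i j => sum2_nonneg fun x y => sq_nonneg _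
    have hD := diag_wt (ρ := 3/4) (by norm_num) (by norm_num) A A0 M
      (fun c b n => (tele_y h h0 hm c b n).trans (hb b)) (k+1) T T
    calc _ ≤ ∑ j ∈ rg T, 128 * (1/2) ^ s.natAbs *
          ∑ i ∈ rg T, (3/4 : ℝ) ^ ((i:ℤ) - j - (k+1)).natAbs * A i j := by
          refine sum_le_sum fun j hj => ?_
          refine sum_if_unique T _ _ _ ?_ (hu j) ?_
          · exact mul_nonneg (by positivity) (sum_nonneg fun i _ => mul_nonneg (by positivity) (A0 _ _))
          · rintro l hl ⟨hq, he⟩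
            refine (tall hl (Finset.mem_range.1 hj) hP0 hP'.le (by omega) _ (hL j (Finset.mem_range.1 hj))).trans ?_
            have e1 : (2:ℝ)^(k+1+j)/2^l = 2 * (1/2)^s.natAbs := by
              have : l = k + j + s.natAbs := by omega
              rw [this, pow_add _ (k+j), div_pow, one_pow, show k+1+j = k+j+1 by ring, pow_succ]
              field_simp
            rw [e1, show (64:ℝ) * (2 * (1/2)^s.natAbs) = 128 * (1/2) ^ s.natAbs by ring]
            refine mul_le_mul_of_nonneg_left ?_ (by positivity)
            refine (Finset.sum_le_sum_of_subset_of_nonneg (t := rg T) (Finset.range_subset_range.2 hl.le)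
              (fun i _ _ => mul_nonneg (by unfold wt; positivity) (A0 _ _))).trans (le_of_eq ?_)
            refine sum_congr rfl fun i _ => ?_
            unfold wt
            congr 3; push_cast; ring
      _ = 128 * (1/2) ^ s.natAbs * ∑ j ∈ rg T,
          ∑ i ∈ rg T, (3/4 : ℝ) ^ ((i:ℤ) - j - (k+1)).natAbs * A i j := by rw [mul_sum]
      _ ≤ 128 * (1/2) ^ s.natAbs * (2 / (1 - 3/4) * M) := mul_le_mul_of_nonneg_left hD (by positivity)
      _ = _ := by ring
  rcases le_or_gt 2 s with hs2 | hs2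
  · set A : ℕ → ℕ → ℝ := fun i j => ∑ x, ∑ y, D1 i (h j) x y ^ 2 with hA
    have A0 : ∀ i j, 0 ≤ A i j := fun i j => sum2_nonneg fun x y => sq_nonneg _
    have hD := diag_wt (ρ := 3/4) (by norm_num) (by norm_num) A A0 M
      (fun c b n => (tele_x h h0 hm c b n).trans (hb b)) (1-s) T T
    calc _ ≤ ∑ j ∈ rg T, 128 * (1/2) ^ s.natAbs *
          ∑ i ∈ rg T, (3/4 : ℝ) ^ ((i:ℤ) - j - (1-s)).natAbs * A i j := by
          refine sum_le_sum fun j hj => ?_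
          refine sum_if_unique T _ _ _ ?_ (hu j) ?_
          · exact mul_nonneg (by positivity) (sum_nonneg fun i _ => mul_nonneg (by positivity) (A0 _ _))
          · rintro l hl ⟨hq, he⟩
            have hjT := Finset.mem_range.1 hj
            refine (wide hl hjT hP (by omega) (by omega) _ ((hL j hjT).mono (Nat.le_succ j))).trans ?_
            have e1 : (2:ℝ)^(l+1-k)/2^j = 2 * (1/2)^s.natAbs := by
              have h1 : j = (l - k) + s.natAbs := by omega
              have h2 : l + 1 - k = (l - k) + 1 := by omega
              rw [h1, h2, pow_add _ (l-k), pow_add _ (l-k), div_pow, one_pow]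
              field_simp
            rw [e1, show (64:ℝ) * (2 * (1/2)^s.natAbs) = 128 * (1/2) ^ s.natAbs by ring]
            refine mul_le_mul_of_nonneg_left ?_ (by positivity)
            refine (Finset.sum_le_sum_of_subset_of_nonneg (t := rg T) (Finset.range_subset_range.2 hjT.le)
              (fun i _ _ => mul_nonneg (by unfold wt; positivity) (A0 _ _))).trans (le_of_eq ?_)
            refine sum_congr rfl fun i _ => ?_
            unfold wt
            congr 3; omega
      _ = 128 * (1/2) ^ s.natAbs * ∑ j ∈ rg T,
          ∑ i ∈ rg T, (3/4 : ℝ) ^ ((i:ℤ) - j - (1-s)).natAbs * A i j := by rw [mul_sum]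
      _ ≤ 128 * (1/2) ^ s.natAbs * (2 / (1 - 3/4) * M) := mul_le_mul_of_nonneg_left hD (by positivity)
      _ = _ := by ring
  · calc _ ≤ ∑ j ∈ rg T, ∑ x, ∑ y, D1 (0+j) (h (0+j)) x y ^ 2 := by
          refine sum_le_sum fun j hj => ?_
          refine sum_if_unique T _ _ _ (sum2_nonneg fun x y => sq_nonneg _) (hu j) ?_
          intro l hl _
          rw [D12, zero_add]
          have h1 := pyth_y l (D1 j (h j)) (fun _ _ => 1) (fun _ _ _ _ => rfl)
          simp only [mul_one] at h1
          have h2 : 0 ≤ ∑ x, ∑ y, E2 (l+1) (D1 j (h j)) x y ^ 2 := sum2_nonneg fun x y => sq_nonneg _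
          have h3 : ∑ x, ∑ y, E2 l (D1 j (h j)) x y ^ 2 ≤ ∑ x, ∑ y, D1 j (h j) x y ^ 2 := by
            refine sum_le_sum fun x _ => ?_
            rw [← av_total (lb l) (fun y => D1 j (h j) x y ^ 2)]
            exact sum_le_sum fun y _ => av_sq_le _ _ _
          linarith
      _ ≤ M := (tele_x h h0 hm 0 0 T)
      _ ≤ _ := by
          have : (1/2:ℝ) ≤ (1/2)^s.natAbs := by
            have : s.natAbs ≤ 1 := by omega
            calc (1/2:ℝ) = (1/2)^1 := by norm_num
              _ ≤ _ := pow_le_pow_of_le_one (by norm_num) (by norm_num) this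
          nlinarith

end dec2

section qm
variable {T : ℕ}

lemma wpow_le {ι : Type*} (S : Finset ι) (w a : ι → ℝ) (hw : ∀ i, 0 ≤ w i) (ha : ∀ i, 0 ≤ a i) (W : ℝ)
    (hW : ∑ i ∈ S, w i ≤ W) (M : ℕ) :
    (∑ i ∈ S, w i * a i) ^ (M+1) ≤ W ^ M * ∑ i ∈ S, w i * a i ^ (M+1) := by
  set V := ∑ i ∈ S, w i with hV
  have V0 : 0 ≤ V := sum_nonneg fun i _ => hw i
  rcases eq_or_lt_of_le V0 with h | h
  · have : ∀ i ∈ S, w i = 0 := (Finset.sum_eq_zero_iff_of_nonneg fun i _ => hw i).1 h.symm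
    rw [sum_eq_zero (fun i hi => by rw [this i hi, zero_mul]),
      sum_eq_zero (fun i hi => by rw [this i hi, zero_mul])]
    simp
  · have h1 := Real.pow_arith_mean_le_arith_mean_pow S (fun i => w i / V) a (fun i _ => div_nonneg (hw i) V0)
      (by rw [← Finset.sum_div]; exact div_self h.ne') (fun i _ => ha i) (M+1)
    have h2 : ∑ i ∈ S, w i / V * a i = (∑ i ∈ S, w i * a i) / V := by
      rw [Finset.sum_div]; exact sum_congr rfl fun i _ => by ring
    have h3 : ∑ i ∈ S, w i / V * a i ^ (M+1) = (∑ i ∈ S, w i * a i ^ (M+1)) / V := by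
      rw [Finset.sum_div]; exact sum_congr rfl fun i _ => by ring
    rw [h2, h3, div_pow, div_le_div_iff₀ (by positivity) h] at h1
    have h4 : 0 ≤ ∑ i ∈ S, w i * a i ^ (M+1) := sum_nonneg fun i _ => mul_nonneg (hw i) (pow_nonneg (ha i) _)
    have h5 : (∑ i ∈ S, w i * a i) ^ (M+1) ≤ V ^ M * ∑ i ∈ S, w i * a i ^ (M+1) := by
      refine le_of_mul_le_mul_right (h1.trans (le_of_eq ?_)) h
      ring
    exact h5.trans (mul_le_mul_of_nonneg_right (pow_le_pow_left₀ V0 hW M) h4)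

lemma SumS {ρ : ℝ} (hρ : 0 < ρ) (hρ1 : ρ < 1) (M : ℕ) (S : Finset ℤ) (Y : ℤ → Kn T) (A : ℝ)
    (hA : 0 ≤ A)
    (hY : ∀ s ∈ S, ∑ x, ∑ y, |Y s x y| ^ (M+1) ≤ A * (ρ ^ (M+1)) ^ s.natAbs) :
    ∑ x, ∑ y, |∑ s ∈ S, Y s x y| ^ (M+1) ≤ (2/(1-ρ)) ^ (M+1) * A := by
  have hW := sum_int_pow hρ.le hρ1 S
  have h1 : ∀ x y, |∑ s ∈ S, Y s x y| ^ (M+1) ≤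
      (2/(1-ρ)) ^ M * ∑ s ∈ S, ρ ^ s.natAbs * ((ρ ^ s.natAbs)⁻¹ * |Y s x y|) ^ (M+1) := by
    intro x y
    refine le_trans ?_ (wpow_le S (fun s => ρ ^ s.natAbs) (fun s => (ρ ^ s.natAbs)⁻¹ * |Y s x y|)
      (fun s => by positivity) (fun s => by positivity) _ hW M)
    refine pow_le_pow_left₀ (abs_nonneg _) ((Finset.abs_sum_le_sum_abs _ _).trans (le_of_eq ?_)) _
    refine sum_congr rfl fun s _ => ?_
    have : ρ ^ s.natAbs ≠ 0 := by positivity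
    field_simp
  have w0 : 0 ≤ 2/(1-ρ) := div_nonneg (by norm_num) (by linarith)
  calc _ ≤ ∑ x, ∑ y, (2/(1-ρ)) ^ M * ∑ s ∈ S, ρ ^ s.natAbs * ((ρ ^ s.natAbs)⁻¹ * |Y s x y|) ^ (M+1) := sum2_le h1
    _ = (2/(1-ρ)) ^ M * ∑ s ∈ S, ρ ^ s.natAbs * ((ρ ^ s.natAbs)⁻¹ ^ (M+1) * ∑ x, ∑ y, |Y s x y| ^ (M+1)) := by
        simp only [← mul_sum, mul_pow]
        congr 1
        simp_rw [mul_sum]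
        rw [sum_congr rfl fun x _ => sum_comm, sum_comm]
    _ ≤ (2/(1-ρ)) ^ M * ∑ s ∈ S, ρ ^ s.natAbs * A := by
        refine mul_le_mul_of_nonneg_left (sum_le_sum fun s hs => ?_) (by positivity)
        refine mul_le_mul_of_nonneg_left ?_ (by positivity)
        calc _ ≤ (ρ ^ s.natAbs)⁻¹ ^ (M+1) * (A * (ρ ^ (M+1)) ^ s.natAbs) :=
              mul_le_mul_of_nonneg_left (hY s hs) (by positivity)
          _ = A := by
              rw [← pow_mul, mul_comm (M+1), pow_mul, inv_pow]
              have : (ρ ^ s.natAbs) ^ (M+1) ≠ 0 := by positivity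
              field_simp
    _ = (2/(1-ρ)) ^ M * ((∑ s ∈ S, ρ ^ s.natAbs) * A) := by rw [sum_mul]
    _ ≤ (2/(1-ρ)) ^ M * ((2/(1-ρ)) * A) := by
        refine mul_le_mul_of_nonneg_left (mul_le_mul_of_nonneg_right hW hA) (by positivity)
    _ = _ := by ring

structure LD (T q : ℕ) (P : ℕ → ℕ) (g : ℕ → ℕ → Kn T) : Prop where
  hq : q ≤ T
  hP : ∀ k < q, 2^k ≤ P k ∧ P k < 2^(k+1)
  h0 : ∀ k j x y, 0 ≤ g k j x y
  hL : ∀ k < q, ∀ j < T, LInv (P k) j (g k j)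
  col : ∀ k < q, ∀ j < T, ∀ x y, E2 T (g k j) x y = E1 j (E2 T (g k j)) x y
  le1 : ∀ k < q, ∀ x y, ∑ j ∈ rg T, g k j x y ≤ 1

variable (g : ℕ → ℕ → Kn T)

def GG (k : ℕ) (x y : Fn T) : ℝ := ∑ j ∈ rg T, g k j x y
def Gt (k : ℕ) (x y : Fn T) : ℝ := ∑ j ∈ rg T, E1 j (g k j) x y
def WW (k : ℕ) (x y : Fn T) : ℝ := GG g k x y - Gt g k x y
def gg (k i : ℕ) (x y : Fn T) : ℝ := ∑ j ∈ rg T, if i < j then g k j x y else 0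
def FF (q : ℕ) (x y : Fn T) : ℝ := ∑ k ∈ rg q, GG g k x y
def Ft (q : ℕ) (x y : Fn T) : ℝ := ∑ k ∈ rg q, Gt g k x y
def mass (q : ℕ) : ℝ := ∑ x, ∑ y, FF g q x y

variable {g}

lemma E1E1_le {i j : ℕ} (h : i ≤ j) (f : Kn T) : E1 i (E1 j f) = E1 j f := by
  funext x y; exact Ea_Ea' h _ _
lemma E1E1_ge {i j : ℕ} (h : j ≤ i) (f : Kn T) : E1 i (E1 j f) = E1 i f := by
  funext x y; exact Ea_Ea h _ _
lemma D1_sub (j : ℕ) (f g : Kn T) (x y) :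
    D1 j (fun x y => f x y - g x y) x y = D1 j f x y - D1 j g x y := by
  simp only [D1_eq, E1_sub]; ring
lemma D1_zero (j : ℕ) : D1 j (fun _ _ : Fn T => (0:ℝ)) = fun _ _ => 0 := by
  funext x y
  simpa using D1_sub j (fun _ _ => 0) (fun _ _ => 0) x y
lemma D2_sub (j : ℕ) (f g : Kn T) (x y) :
    D2 j (fun x y => f x y - g x y) x y = D2 j f x y - D2 j g x y := by
  simp only [D2_eq, E2_sub]; ring
lemma D2_zero (j : ℕ) : D2 j (fun _ _ : Fn T => (0:ℝ)) = fun _ _ => 0 := by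
  funext x y
  simpa using D2_sub j (fun _ _ => 0) (fun _ _ => 0) x y

lemma D1_W (k i : ℕ) : D1 i (WW g k) = D1 i (gg g k i) := by
  funext x y
  have h1 : D1 i (WW g k) x y = ∑ j ∈ rg T, D1 i (g k j) x y - ∑ j ∈ rg T, D1 i (E1 j (g k j)) x y := by
    unfold WW
    rw [D1_sub]
    congr 1
    · exact D1_sum _ _ _ _ _
    · exact D1_sum _ _ (fun j => E1 j (g k j)) _ _
  have h2 : D1 i (gg g k i) x y = ∑ j ∈ rg T, D1 i (fun x y => if i < j then g k j x y else 0) x y :=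
    D1_sum _ _ (fun j x y => if i < j then g k j x y else 0) _ _
  rw [h1, h2, ← sum_sub_distrib]
  refine sum_congr rfl fun j _ => ?_
  by_cases h : i < j
  · simp only [h, if_true]
    rw [D1_eq i (E1 j _), E1E1_le h.le, E1E1_le h]; ring
  · simp only [h, if_false]
    rw [D1_zero, D1_eq i (E1 j _), E1E1_ge (by omega), E1E1_ge (by omega), D1_eq]; ring

lemma gg_nonneg (h0 : ∀ k j x y, 0 ≤ g k j x y) (k i x y) : 0 ≤ gg g k i x y :=
  sum_nonneg fun j _ => by split_ifs; exacts [h0 _ _ _ _, le_rfl]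

lemma gg_anti (h0 : ∀ k j x y, 0 ≤ g k j x y) (k i x y) : gg g k (i+1) x y ≤ gg g k i x y := by
  refine sum_le_sum fun j _ => ?_
  split_ifs
  · exact le_rfl
  · omega
  · exact h0 _ _ _ _
  · exact le_rfl

lemma gg_le (h0 : ∀ k j x y, 0 ≤ g k j x y) (k x y) : gg g k 0 x y ≤ GG g k x y := by
  refine sum_le_sum fun j _ => ?_
  split_ifs
  · exact le_rfl
  · exact h0 _ _ _ _

lemma gg_LInv {P i k : ℕ} (hL : ∀ j < T, LInv P j (g k j)) : LInv P (i+1) (gg g k i) := by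
  intro x x' y y' e e'
  refine sum_congr rfl fun j hj => ?_
  split_ifs with h
  · exact (hL j (Finset.mem_range.1 hj)).mono h x x' y y' e e'
  · rfl

lemma E2_W {q k : ℕ} {P : ℕ → ℕ} (h : LD T q P g) (hk : k < q) (x y) : E2 T (WW g k) x y = 0 := by
  unfold WW
  rw [E2_sub]
  have h1 : E2 T (GG g k) x y = ∑ j ∈ rg T, E2 T (g k j) x y := E2_sum _ _ _ _ _
  have h2 : E2 T (Gt g k) x y = ∑ j ∈ rg T, E2 T (E1 j (g k j)) x y := E2_sum _ _ (fun j => E1 j (g k j)) _ _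
  rw [h1, h2, ← sum_sub_distrib]
  refine sum_eq_zero fun j hj => ?_
  rw [← E12, h.col k hk j (Finset.mem_range.1 hj)]
  ring

lemma E1_W (k x y) : E1 T (WW g k) x y = 0 := by
  unfold WW
  rw [E1_sub]
  have h1 : E1 T (GG g k) x y = ∑ j ∈ rg T, E1 T (g k j) x y := E1_sum _ _ _ _ _
  have h2 : E1 T (Gt g k) x y = ∑ j ∈ rg T, E1 T (E1 j (g k j)) x y := E1_sum _ _ (fun j => E1 j (g k j)) _ _
  rw [h1, h2, ← sum_sub_distrib]
  refine sum_eq_zero fun j hj => ?_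
  rw [E1E1_ge (Finset.mem_range.1 hj).le]
  ring

lemma sum_D2 {q : ℕ} (hq : q ≤ T) (f : Kn T) (x y) :
    ∑ l ∈ rg T, (if q ≤ l then D2 l f x y else 0) = E2 q f x y - E2 T f x y := by
  rw [← Finset.sum_filter]
  have : (rg T).filter (fun l => q ≤ l) = Finset.Ico q T := by ext; simp [and_comm]
  rw [this]
  have := Finset.sum_Ico_sub (f := fun l => E2 l f x y) hq
  rw [← neg_sub, ← this, ← Finset.sum_neg_distrib]
  exact sum_congr rfl fun l _ => by rw [D2_eq]; ring

lemma sum_D1 (f : Kn T) (x y) :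
    ∑ l ∈ rg T, D1 l f x y = f x y - E1 T f x y := by
  have := Finset.sum_range_sub (f := fun l => E1 l f x y) T
  have h0 : E1 0 f x y = f x y := Ea_zero _ _
  rw [← h0, ← neg_sub, ← this, ← Finset.sum_neg_distrib]
  exact sum_congr rfl fun l _ => by rw [D1_eq]; ring

lemma E2_W_expand {q k : ℕ} {P : ℕ → ℕ} (h : LD T q P g) (hk : k < q) (x y) :
    E2 q (WW g k) x y = ∑ j ∈ rg T, ∑ l ∈ rg T, (if q ≤ l then D1 j (D2 l (WW g k)) x y else 0) := by
  have h1 : ∀ j, ∑ l ∈ rg T, (if q ≤ l then D1 j (D2 l (WW g k)) x y else 0) = D1 j (E2 q (WW g k)) x y := by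
    intro j
    simp only [D12]
    rw [sum_D2 h.hq, ← D1E2, ← D1E2]
    have : E2 T (WW g k) = fun _ _ => 0 := by funext x y; exact E2_W h hk x y
    rw [this, D1_zero]; ring
  simp only [h1]
  rw [sum_D1, E12]
  have : E1 T (WW g k) = fun _ _ => 0 := by funext x y; exact E1_W k x y
  rw [this]
  have : E2 q (fun _ _ : Fn T => (0:ℝ)) x y = 0 := av_const _ _ _
  rw [this]; ring

end qm

section qm2
variable {T : ℕ}
variable (g : ℕ → ℕ → Kn T)

def fY (q : ℕ) (s : ℤ) (j l : ℕ) (x y : Fn T) : ℝ :=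
  ∑ k ∈ rg q, if q ≤ l ∧ (j:ℤ) + k = l + s then WW g k x y else 0
def YY (q : ℕ) (s : ℤ) (x y : Fn T) : ℝ :=
  ∑ j ∈ rg T, ∑ l ∈ rg T, D1 j (D2 l (fY g q s j l)) x y

variable {g}

lemma DD_fY (q : ℕ) (s : ℤ) (j l : ℕ) (x y : Fn T) :
    D1 j (D2 l (fY g q s j l)) x y =
      ∑ k ∈ rg q, if q ≤ l ∧ (j:ℤ) + k = l + s then D1 j (D2 l (WW g k)) x y else 0 := by
  have h1 : D2 l (fY g q s j l) = fun x y =>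
      ∑ k ∈ rg q, D2 l (fun x y => if q ≤ l ∧ (j:ℤ) + k = l + s then WW g k x y else 0) x y := by
    funext x y; exact D2_sum _ _ _ _ _
  rw [h1, D1_sum]
  refine sum_congr rfl fun k _ => ?_
  split_ifs with h
  · rfl
  · have := D2_zero (T := T) l
    show D1 j (D2 l (fun _ _ => 0)) x y = 0
    rw [this, D1_zero]

lemma DD_fY_sq (q : ℕ) (s : ℤ) (j l : ℕ) (x y : Fn T) :
    D1 j (D2 l (fY g q s j l)) x y ^ 2 =
      ∑ k ∈ rg q, if q ≤ l ∧ (j:ℤ) + k = l + s then D1 j (D2 l (WW g k)) x y ^ 2 else 0 := by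
  rw [DD_fY]
  by_cases h : ∃ k ∈ rg q, q ≤ l ∧ (j:ℤ) + k = l + s
  · obtain ⟨k, hk, hp⟩ := h
    rw [Finset.sum_eq_single k, Finset.sum_eq_single k, if_pos hp, if_pos hp]
    · intro k' _ hne; rw [if_neg]; omega
    · intro h; exact absurd hk h
    · intro k' _ hne; rw [if_neg]; omega
    · intro h; exact absurd hk h
  · push Not at h
    have h' : ∀ k ∈ rg q, ¬ (q ≤ l ∧ (j:ℤ) + k = l + s) := fun k hk hc => h k hk hc.1 hc.2
    rw [sum_eq_zero (fun k hk => if_neg (h' k hk)), sum_eq_zero (fun k hk => if_neg (h' k hk))]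
    norm_num

lemma YY_sum {q : ℕ} {P : ℕ → ℕ} (h : LD T q P g) (x y : Fn T) :
    E2 q (FF g q) x y = E2 q (Ft g q) x y + ∑ s ∈ Finset.Icc (-(2*T:ℤ)) (2*T), YY g q s x y := by
  have h1 : E2 q (FF g q) x y = ∑ k ∈ rg q, E2 q (GG g k) x y := E2_sum _ _ _ _ _
  have h2 : E2 q (Ft g q) x y = ∑ k ∈ rg q, E2 q (Gt g k) x y := E2_sum _ _ _ _ _
  have h3 : ∑ s ∈ Finset.Icc (-(2*T:ℤ)) (2*T), YY g q s x y = ∑ k ∈ rg q, E2 q (WW g k) x y := by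
    have e1 : ∀ k ∈ rg q, E2 q (WW g k) x y =
      ∑ j ∈ rg T, ∑ l ∈ rg T, (if q ≤ l then D1 j (D2 l (WW g k)) x y else 0) :=
      fun k hk => E2_W_expand h (Finset.mem_range.1 hk) x y
    rw [sum_congr rfl e1]
    unfold YY
    rw [sum_comm, sum_comm (s := rg q)]
    refine sum_congr rfl fun j hj => ?_
    rw [sum_comm, sum_comm (s := rg q)]
    refine sum_congr rfl fun l hl => ?_
    simp only [DD_fY]
    rw [sum_comm]
    refine sum_congr rfl fun k hk => ?_
    have hj := Finset.mem_range.1 hj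
    have hl := Finset.mem_range.1 hl
    have hk := Finset.mem_range.1 hk
    have hq := h.hq
    rw [Finset.sum_eq_single ((j:ℤ)+k-l)]
    · have : (j:ℤ) + k = l + (j + k - l) := by ring
      by_cases hc : q ≤ l
      · rw [if_pos ⟨hc, this⟩, if_pos hc]
      · rw [if_neg (fun h => hc h.1), if_neg hc]
    · intro s _ hs; rw [if_neg]; rintro ⟨_, h⟩; apply hs; omega
    · intro hn; exfalso; apply hn; rw [Finset.mem_Icc]; omega
  rw [h1, h2, h3, ← sum_add_distrib]
  refine sum_congr rfl fun k _ => ?_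
  have : E2 q (WW g k) x y = _ := E2_sub q (GG g k) (Gt g k) x y
  rw [this]; ring

lemma sum4 {α β : Type*} (s : Finset α) (t : Finset β) (f : α → β → Kn T) :
    ∑ x, ∑ y, ∑ a ∈ s, ∑ b ∈ t, f a b x y = ∑ a ∈ s, ∑ b ∈ t, ∑ x, ∑ y, f a b x y := by
  rw [sum_congr rfl fun x _ => sum_comm, sum_comm]
  refine sum_congr rfl fun a _ => ?_
  rw [sum_congr rfl fun x _ => sum_comm, sum_comm]

lemma GG_nonneg (h0 : ∀ k j x y, 0 ≤ g k j x y) (k x y) : 0 ≤ GG g k x y := sum_nonneg fun j _ => h0 _ _ _ _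
lemma Gt_nonneg (h0 : ∀ k j x y, 0 ≤ g k j x y) (k x y) : 0 ≤ Gt g k x y :=
  sum_nonneg fun j _ => E1_nonneg _ (h0 k j) x y
lemma FF_nonneg (h0 : ∀ k j x y, 0 ≤ g k j x y) (q x y) : 0 ≤ FF g q x y := sum_nonneg fun j _ => GG_nonneg h0 _ _ _
lemma Ft_nonneg (h0 : ∀ k j x y, 0 ≤ g k j x y) (q x y) : 0 ≤ Ft g q x y := sum_nonneg fun j _ => Gt_nonneg h0 _ _ _
lemma mass_nonneg (h0 : ∀ k j x y, 0 ≤ g k j x y) (q) : 0 ≤ mass g q := sum2_nonneg fun x y => FF_nonneg h0 q x y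

lemma Y2 : ∃ C : ℝ, 0 ≤ C ∧ ∀ (T q : ℕ) (P : ℕ → ℕ) (g : ℕ → ℕ → Kn T), LD T q P g → ∀ s : ℤ,
    ∑ x, ∑ y, YY g q s x y ^ 2 ≤ C * (1/2) ^ s.natAbs * mass g q := by
  obtain ⟨C, hC, H⟩ := LP2 0
  refine ⟨C * 1024, by positivity, fun T q P g h s => ?_⟩
  have h1 := H T T (fY g q s)
  simp only [zero_add, pow_one] at h1
  refine h1.trans ?_
  rw [mul_assoc, mul_assoc]
  refine mul_le_mul_of_nonneg_left ?_ hC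
  rw [sum4]
  calc _ = ∑ k ∈ rg q, ∑ j ∈ rg T, ∑ l ∈ rg T,
        (if q ≤ l ∧ (j:ℤ) + k = l + s then ∑ x, ∑ y, D1 j (D2 l (gg g k j)) x y ^ 2 else 0) := by
        rw [sum_comm (s := rg q)]
        refine sum_congr rfl fun j _ => ?_
        rw [sum_comm (s := rg q)]
        refine sum_congr rfl fun l _ => ?_
        simp only [DD_fY_sq]
        rw [sum_congr rfl fun x _ => sum_comm, sum_comm]
        refine sum_congr rfl fun k _ => ?_
        split_ifs
        · rw [D12, D1_W, ← D12]
        · simp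
    _ ≤ ∑ k ∈ rg q, 1024 * (1/2) ^ s.natAbs * ∑ x, ∑ y, gg g k 0 x y ^ 2 := by
        refine sum_le_sum fun k hk => ?_
        have hk := Finset.mem_range.1 hk
        exact decay (h.hP k hk).1 (h.hP k hk).2 hk (gg g k) (gg_nonneg h.h0 k) (gg_anti h.h0 k)
          (fun j _ => gg_LInv (h.hL k hk)) s
    _ ≤ ∑ k ∈ rg q, 1024 * (1/2) ^ s.natAbs * ∑ x, ∑ y, GG g k x y := by
        refine sum_le_sum fun k hk => mul_le_mul_of_nonneg_left (sum2_le fun x y => ?_) (by positivity)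
        have hk := Finset.mem_range.1 hk
        have a := gg_le h.h0 k x y
        have b := gg_nonneg h.h0 k 0 x y
        have c : GG g k x y ≤ 1 := h.le1 k hk x y
        nlinarith
    _ = _ := by
        rw [← mul_sum, ← mul_assoc]
        congr 1
        unfold mass FF
        rw [sum_comm]
        refine sum_congr rfl fun x _ => ?_
        rw [sum_comm]

def QQ (M : ℕ) : Prop := ∀ CH : ℕ → ℝ, ∃ C : ℝ, 0 ≤ C ∧ ∀ (T q : ℕ) (P : ℕ → ℕ) (g : ℕ → ℕ → Kn T),
  LD T q P g → (∀ m, ∑ x, ∑ y, Ft g q x y ^ (m+1) ≤ CH m * mass g q) →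
    ∑ x, ∑ y, E2 q (FF g q) x y ^ M ≤ C * mass g q

lemma add_pow2 {a b : ℝ} (ha : 0 ≤ a) (hb : 0 ≤ b) (M : ℕ) : (a + b)^M ≤ 2^M * (a^M + b^M) := by
  rcases le_total a b with h | h
  · calc (a+b)^M ≤ (2*b)^M := pow_le_pow_left₀ (by positivity) (by linarith) M
      _ = 2^M * b^M := mul_pow _ _ _
      _ ≤ _ := mul_le_mul_of_nonneg_left (by have := pow_nonneg ha M; linarith) (by positivity)
  · calc (a+b)^M ≤ (2*a)^M := pow_le_pow_left₀ (by positivity) (by linarith) M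
      _ = 2^M * a^M := mul_pow _ _ _
      _ ≤ _ := mul_le_mul_of_nonneg_left (by have := pow_nonneg hb M; linarith) (by positivity)

lemma E2_pow_sum {f : Kn T} (hf : ∀ x y, 0 ≤ f x y) (q M : ℕ) :
    ∑ x, ∑ y, E2 q f x y ^ M ≤ ∑ x, ∑ y, f x y ^ M := by
  refine sum_le_sum fun x _ => ?_
  rw [← av_total (lb q) (fun y => f x y ^ M)]
  exact sum_le_sum fun y _ => av_pow_le _ (hf x) M y

lemma Q_of_Y (M : ℕ) {ρ : ℝ} (hρ : 0 < ρ) (hρ1 : ρ < 1)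
    (hY : ∀ CH : ℕ → ℝ, ∃ A : ℝ, 0 ≤ A ∧ ∀ (T q : ℕ) (P : ℕ → ℕ) (g : ℕ → ℕ → Kn T),
      LD T q P g → (∀ m, ∑ x, ∑ y, Ft g q x y ^ (m+1) ≤ CH m * mass g q) → ∀ s : ℤ,
      ∑ x, ∑ y, |YY g q s x y| ^ (M+1) ≤ A * mass g q * (ρ ^ (M+1)) ^ s.natAbs) : QQ (M+1) := by
  intro CH
  obtain ⟨A, hA, H⟩ := hY CH
  have w0 : 0 ≤ 2/(1-ρ) := div_nonneg (by norm_num) (by linarith)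
  refine ⟨2^(M+1) * (|CH M| + (2/(1-ρ))^(M+1) * A), by positivity, fun T q P g h hh => ?_⟩
  have m0 := mass_nonneg h.h0 q
  have h1 := SumS hρ hρ1 M (Finset.Icc (-(2*T:ℤ)) (2*T)) (YY g q) (A * mass g q) (by positivity)
    (fun s _ => H T q P g h hh s)
  calc _ ≤ ∑ x, ∑ y, 2^(M+1) * (E2 q (Ft g q) x y ^ (M+1) + |∑ s ∈ Finset.Icc (-(2*T:ℤ)) (2*T), YY g q s x y| ^ (M+1)) := by
        refine sum2_le fun x y => ?_
        have a := E2_nonneg q (Ft_nonneg h.h0 q) x y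
        refine le_trans (pow_le_pow_left₀ (E2_nonneg q (FF_nonneg h.h0 q) x y) ?_ _) (add_pow2 a (abs_nonneg _) (M+1))
        rw [YY_sum h]
        have := le_abs_self (∑ s ∈ Finset.Icc (-(2*T:ℤ)) (2*T), YY g q s x y)
        linarith
    _ = 2^(M+1) * (∑ x, ∑ y, E2 q (Ft g q) x y ^ (M+1) +
          ∑ x, ∑ y, |∑ s ∈ Finset.Icc (-(2*T:ℤ)) (2*T), YY g q s x y| ^ (M+1)) := by
        simp only [← mul_sum, sum_add_distrib]
    _ ≤ 2^(M+1) * (|CH M| * mass g q + (2/(1-ρ))^(M+1) * (A * mass g q)) := by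
        refine mul_le_mul_of_nonneg_left (add_le_add ?_ h1) (by positivity)
        refine (E2_pow_sum (Ft_nonneg h.h0 q) q _).trans ((hh M).trans ?_)
        exact mul_le_mul_of_nonneg_right (le_abs_self _) m0
    _ = _ := by ring

lemma root_half (N : ℕ) (hN : N ≠ 0) : ∃ ρ : ℝ, 0 < ρ ∧ ρ < 1 ∧ ρ ^ N = 1/2 := by
  refine ⟨(1/2:ℝ) ^ ((N:ℝ)⁻¹), by positivity, ?_, Real.rpow_inv_natCast_pow (by norm_num) hN⟩
  exact Real.rpow_lt_one (by norm_num) (by norm_num) (by positivity)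

lemma Q2 : QQ 2 := by
  obtain ⟨ρ, h0, h1, h2⟩ := root_half 2 (by norm_num)
  obtain ⟨C, hC, H⟩ := Y2
  refine Q_of_Y 1 h0 h1 fun CH => ⟨C, hC, fun T q P g h _ s => ?_⟩
  have := H T q P g h s
  simp only [sq_abs, Nat.reduceAdd]
  rw [h2]
  refine this.trans (le_of_eq (by ring))

lemma sum_sq_le_sq {ι : Type*} (s : Finset ι) (a : ι → ℝ) (ha : ∀ i, 0 ≤ a i) :
    ∑ i ∈ s, a i ^ 2 ≤ (∑ i ∈ s, a i) ^ 2 := by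
  rw [sq, sum_mul]
  refine sum_le_sum fun i hi => ?_
  rw [sq]
  exact mul_le_mul_of_nonneg_left (Finset.single_le_sum (fun j _ => ha j) hi) (ha i)

lemma Yhigh (n : ℕ) (hQ : QQ (n+1)) : ∀ CH : ℕ → ℝ, ∃ A : ℝ, 0 ≤ A ∧ ∀ (T q : ℕ) (P : ℕ → ℕ)
      (g : ℕ → ℕ → Kn T),
      LD T q P g → (∀ m, ∑ x, ∑ y, Ft g q x y ^ (m+1) ≤ CH m * mass g q) → ∀ s : ℤ,
      ∑ x, ∑ y, (YY g q s x y ^ 2) ^ (n+1) ≤ A * mass g q := by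
  intro CH
  obtain ⟨CQ, hCQ, HQ⟩ := hQ CH
  obtain ⟨C, hC, H⟩ := LP2 n
  set D : ℝ := (n+1)^(n+1) * (n+1)^(n+1) with hD
  have D0 : 0 ≤ D := by positivity
  refine ⟨C * (D * (2^(n+1) * (CQ + |CH (2*n+1)|))), by positivity, fun T q P g h hh s => ?_⟩
  have m0 := mass_nonneg h.h0 q
  refine (H T T (fY g q s)).trans ?_
  rw [mul_assoc]
  refine mul_le_mul_of_nonneg_left ?_ hC
  set V : ℕ → Kn T := fun k => E2 q (WW g k) with hV
  calc _ ≤ ∑ x, ∑ y, (∑ k ∈ rg q, ∑ t ∈ rg T,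
        D1 ((s-k).toNat + t) (D2 ((-(s-k)).toNat + t) (V k)) x y ^ 2) ^ (n+1) := by
        refine sum2_le fun x y => pow_le_pow_left₀ (sum_nonneg fun _ _ => sum_nonneg fun _ _ => sq_nonneg _) ?_ _
        simp only [DD_fY_sq]
        calc _ = ∑ k ∈ rg q, ∑ j ∈ rg T, ∑ l ∈ rg T,
              (if q ≤ l ∧ (j:ℤ) + k = l + s then D1 j (D2 l (WW g k)) x y ^ 2 else 0) := by
              rw [sum_comm (s := rg q)]
              refine sum_congr rfl fun j _ => ?_
              rw [sum_comm (s := rg q)]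
          _ ≤ _ := by
              refine sum_le_sum fun k _ => ?_
              rw [← Finset.sum_product', ← Finset.sum_filter]
              refine le_trans (le_of_eq ?_) (diag_sub (fun j l => D1 j (D2 l (V k)) x y ^ 2) (fun _ _ => sq_nonneg _)
                ((rg T ×ˢ rg T).filter (fun p => q ≤ p.2 ∧ (p.1:ℤ) + k = p.2 + s)) (s-k) T ?_)
              · refine sum_congr rfl fun p hp => ?_
                have hp := (Finset.mem_filter.1 hp).2.1
                have : D2 p.2 (V k) = D2 p.2 (WW g k) := by
                  funext x y
                  show De p.2 (E2 q (WW g k) x) y = De p.2 (WW g k x) y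
                  unfold De
                  have e1 : E2 q (WW g k) x = Ea q (WW g k x) := rfl
                  rw [e1, Ea_Ea hp, Ea_Ea (by omega)]
                rw [this]
              · intro p hp
                obtain ⟨h1, h2⟩ := Finset.mem_filter.1 hp
                exact ⟨by omega, Finset.mem_range.1 (Finset.mem_product.1 h1).2⟩
    _ ≤ D * ∑ x, ∑ y, (∑ k ∈ rg q, V k x y ^ 2) ^ (n+1) :=
        Dlem n (rg q) (fun k => (s-k).toNat) (fun k => (-(s-k)).toNat) (fun _ => T) V
    _ ≤ D * ∑ x, ∑ y, 2^(n+1) * (E2 q (FF g q) x y ^ (n+1) + (E2 q (Ft g q) x y ^ 2) ^ (n+1)) := by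
        refine mul_le_mul_of_nonneg_left (sum2_le fun x y => ?_) D0
        refine le_trans (pow_le_pow_left₀ (sum_nonneg fun _ _ => sq_nonneg _) ?_ _)
          (add_pow2 (E2_nonneg q (FF_nonneg h.h0 q) x y) (sq_nonneg _) (n+1))
        have h1 : E2 q (FF g q) x y = ∑ k ∈ rg q, E2 q (GG g k) x y := E2_sum _ _ _ _ _
        have h2 : E2 q (Ft g q) x y = ∑ k ∈ rg q, E2 q (Gt g k) x y := E2_sum _ _ _ _ _
        have h3 : ∑ k ∈ rg q, E2 q (Gt g k) x y ^ 2 ≤ E2 q (Ft g q) x y ^ 2 := by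
          rw [h2]
          exact sum_sq_le_sq _ _ (fun k => E2_nonneg q (Gt_nonneg h.h0 k) x y)
        refine le_trans ?_ (add_le_add_right h3 _)
        rw [h1, ← sum_add_distrib]
        refine sum_le_sum fun k hk => ?_
        have e : V k x y = E2 q (GG g k) x y - E2 q (Gt g k) x y := E2_sub q (GG g k) (Gt g k) x y
        rw [e]
        have a := E2_nonneg q (GG_nonneg h.h0 k) x y
        have b := E2_nonneg q (Gt_nonneg h.h0 k) x y
        have c : E2 q (GG g k) x y ≤ 1 := by
          have := E2_mono q (g := fun _ _ => 1) (h.le1 k (Finset.mem_range.1 hk)) x y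
          refine this.trans (le_of_eq ?_)
          exact av_const _ _ _
        nlinarith [mul_nonneg a b]
    _ = D * (2^(n+1) * (∑ x, ∑ y, E2 q (FF g q) x y ^ (n+1) + ∑ x, ∑ y, (E2 q (Ft g q) x y ^ 2) ^ (n+1))) := by
        simp only [← mul_sum, sum_add_distrib]
    _ ≤ D * (2^(n+1) * (CQ * mass g q + |CH (2*n+1)| * mass g q)) := by
        refine mul_le_mul_of_nonneg_left (mul_le_mul_of_nonneg_left (add_le_add (HQ T q P g h hh) ?_) (by positivity)) D0
        simp only [← pow_mul]
        rw [show 2 * (n+1) = 2*n+1+1 by ring]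
        refine (E2_pow_sum (Ft_nonneg h.h0 q) q _).trans ((hh _).trans ?_)
        exact mul_le_mul_of_nonneg_right (le_abs_self _) m0
    _ = _ := by ring

lemma Qstep (n : ℕ) (hQ : QQ (n+2)) : QQ (2*n+3) := by
  obtain ⟨ρ, h0, h1, h2⟩ := root_half ((2*n+3)*(2*n+2)) (by positivity)
  obtain ⟨C, hC, HY⟩ := Y2
  refine Q_of_Y (2*n+2) h0 h1 fun CH => ?_
  obtain ⟨A, hA, HA⟩ := Yhigh (n+1) hQ CH
  refine ⟨C + A, by positivity, fun T q P g h hh s => ?_⟩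
  have m0 := mass_nonneg h.h0 q
  set θ := ρ ^ (2*n+3) with hθ
  have hθ2 : θ ^ (2*n+2) = 1/2 := by rw [hθ, ← pow_mul, h2]
  have θ0 : 0 < θ := by positivity
  set μ := (θ ^ s.natAbs)⁻¹ with hμ
  have μ0 : 0 < μ := by positivity
  have pt : ∀ t : ℝ, |t| ^ (2*n+3) ≤ μ ^ (2*n+1) * t^2 + μ⁻¹ * (t^2)^(n+2) := by
    intro t
    rw [← sq_abs t]
    have t0 := abs_nonneg t
    generalize |t| = a at *
    rcases le_total a μ with h | h
    · have : a ^ (2*n+3) = a^(2*n+1) * a^2 := by ring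
      rw [this]
      have := mul_le_mul_of_nonneg_right (pow_le_pow_left₀ t0 h (2*n+1)) (sq_nonneg a)
      have : 0 ≤ μ⁻¹ * (a^2)^(n+2) := by positivity
      linarith
    · have e : μ⁻¹ * (a^2)^(n+2) = (μ⁻¹ * a) * a^(2*n+3) := by ring
      rw [e]
      have h3 : 1 ≤ μ⁻¹ * a := by rw [inv_mul_eq_div, le_div_iff₀ μ0]; linarith
      have := mul_le_mul_of_nonneg_right h3 (pow_nonneg t0 (2*n+3))
      have : 0 ≤ μ^(2*n+1) * a^2 := by positivity
      linarith
  have eμ : μ ^ (2*n+1) * (1/2)^s.natAbs = μ⁻¹ := by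
    rw [← hθ2, ← pow_mul, mul_comm (2*n+2), pow_mul, hμ, inv_inv, inv_pow]
    have : θ ^ s.natAbs ≠ 0 := by positivity
    field_simp
    ring
  calc _ ≤ ∑ x, ∑ y, (μ ^ (2*n+1) * YY g q s x y^2 + μ⁻¹ * (YY g q s x y^2)^(n+2)) := sum2_le fun x y => pt _
    _ = μ ^ (2*n+1) * ∑ x, ∑ y, YY g q s x y^2 + μ⁻¹ * ∑ x, ∑ y, (YY g q s x y^2)^(n+2) := by
        simp only [← mul_sum, sum_add_distrib]
    _ ≤ μ ^ (2*n+1) * (C * (1/2)^s.natAbs * mass g q) + μ⁻¹ * (A * mass g q) :=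
        add_le_add (mul_le_mul_of_nonneg_left (HY T q P g h s) (by positivity))
          (mul_le_mul_of_nonneg_left (HA T q P g h hh s) (by positivity))
    _ = (C + A) * mass g q * μ⁻¹ := by
        have : μ ^ (2*n+1) * (C * (1/2)^s.natAbs * mass g q) = C * mass g q * (μ ^ (2*n+1) * (1/2)^s.natAbs) := by ring
        rw [this, eμ]; ring
    _ = _ := by rw [hμ, inv_inv]

lemma Qall (N : ℕ) : ∃ n, N ≤ n ∧ QQ (n+2) := by
  induction N with
  | zero => exact ⟨0, le_rfl, Q2⟩
  | succ N ih =>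
    obtain ⟨n, hn, h⟩ := ih
    exact ⟨2*n+1, by omega, Qstep n h⟩

end qm2

section p9
variable {T : ℕ}

def rho (P j : ℕ) (z : Fn T × Fn T) : ℕ × ℤ := (lb j z.1, ((z.2.val / P : ℕ) : ℤ) - z.1.val)

def adm (T P j : ℕ) (c : ℕ × ℤ) : Prop :=
  0 ≤ (2:ℤ)^j * c.1 + c.2 ∧ ((2:ℤ)^j * c.1 + 2^j + c.2) * P ≤ 2^T

def La (P j : ℕ) (e : Kn T) (x y : Fn T) : ℝ :=
  av (rho P j) (fun z => e z.1 z.2) (x, y)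

def A2 {β : Type*} (π : Fn T → β) (f : Kn T) (x y : Fn T) : ℝ := av π (f x) y

lemma cntP {P : ℕ} (hP : 0 < P) (b : ℤ) (h0 : 0 ≤ b) (h1 : (b+1)*P ≤ 2^T) :
    (∑ y : Fn T, if ((y.val / P : ℕ) : ℤ) = b then (1:ℝ) else 0) = P := by
  lift b to ℕ using h0
  have h1' : (b+1)*P ≤ 2^T := by exact_mod_cast h1
  rw [Fin.sum_univ_eq_sum_range (fun y => if ((y / P : ℕ) : ℤ) = b then (1:ℝ) else 0) (2^T), Finset.sum_boole]
  have : (rg (2^T)).filter (fun y => ((y / P : ℕ) : ℤ) = b) = Finset.Ico (b*P) ((b+1)*P) := by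
    ext y
    simp only [mem_filter, Finset.mem_range, Finset.mem_Ico, Nat.cast_inj]
    rw [Nat.div_eq_iff hP]
    constructor
    · rintro ⟨_, h, h'⟩; exact ⟨h, by have := Nat.succ_mul b P; simp only [Nat.succ_eq_add_one] at this; omega⟩
    · rintro ⟨h, h'⟩; exact ⟨by omega, h, by have := Nat.succ_mul b P; simp only [Nat.succ_eq_add_one] at this; omega⟩
  rw [this, Nat.card_Ico, Nat.add_mul, one_mul, Nat.add_sub_cancel_left]

lemma adm_row {P j : ℕ} {c : ℕ × ℤ} (h : adm T P j c) {x : Fn T} (hx : lb j x = c.1) :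
    0 ≤ c.2 + x.val ∧ (c.2 + x.val + 1) * P ≤ 2^T := by
  have h1 := (lb_iff (l := j) x c.1).1 hx
  obtain ⟨h2, h3⟩ := h
  have h4 : (c.1:ℤ) * 2^j ≤ x.val ∧ (x.val:ℤ) + 1 ≤ (c.1+1) * 2^j := by
    constructor
    · exact_mod_cast h1.1
    · exact_mod_cast h1.2
  refine ⟨by nlinarith [h4.1], le_trans (mul_le_mul_of_nonneg_right ?_ (by positivity)) h3⟩
  nlinarith [h4.2]

lemma rho_iff {P j : ℕ} (c : ℕ × ℤ) (z : Fn T × Fn T) :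
    rho P j z = c ↔ lb j z.1 = c.1 ∧ ((z.2.val / P : ℕ) : ℤ) = c.2 + z.1.val := by
  rw [rho, Prod.ext_iff]; simp only; constructor
  · rintro ⟨a, b⟩; exact ⟨a, by omega⟩
  · rintro ⟨a, b⟩; exact ⟨a, by omega⟩

open Classical in
lemma rho_cnt {P j : ℕ} (hP : 0 < P) (hj : j ≤ T) (x y : Fn T) (h : adm T P j (rho P j (x, y))) :
    (∑ w : Fn T × Fn T, if rho P j w = rho P j (x, y) then (1:ℝ) else 0) = 2^j * P := by
  rw [Fintype.sum_prod_type]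
  have h1 : ∀ x' : Fn T, (∑ y' : Fn T, if rho P j (x', y') = rho P j (x, y) then (1:ℝ) else 0) =
      (if lb j x' = lb j x then (1:ℝ) else 0) * P := by
    intro x'
    by_cases e : lb j x' = lb j x
    · rw [if_pos e, one_mul]
      have h2 := adm_row h (x := x') e
      rw [← cntP hP _ h2.1 h2.2]
      refine sum_congr rfl fun y' _ => ?_
      refine if_congr ?_ rfl rfl
      rw [rho_iff]
      exact ⟨fun h => h.2, fun h => ⟨e, h⟩⟩
    · rw [if_neg e, zero_mul]
      refine sum_eq_zero fun y' _ => if_neg fun h => e ?_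
      exact (rho_iff _ _).1 h |>.1
  rw [sum_congr rfl fun x' _ => h1 x', ← sum_mul, lb_cnt hj]

lemma La_nonneg {P j : ℕ} {e : Kn T} (h0 : ∀ x y, 0 ≤ e x y) (x y) : 0 ≤ La P j e x y :=
  av_nonneg (rho P j) (a := fun z => e z.1 z.2) (fun w => h0 w.1 w.2) _

lemma La_ex {P j : ℕ} {e : Kn T} {x y} (h : La P j e x y ≠ 0) :
    ∃ x' y', e x' y' ≠ 0 ∧ rho P j (x', y') = rho P j (x, y) := by
  by_contra hc
  push Not at hc
  apply h
  rw [La, av]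
  rw [sum_eq_zero, zero_div]
  intro w _
  split_ifs with hw
  · by_contra h'; exact hc w.1 w.2 h' hw
  · rfl

open Classical in
lemma La_eq {P j : ℕ} (hP : 0 < P) (hj : j ≤ T) {e : Kn T} (h0 : ∀ x y, 0 ≤ e x y)
    (ha : ∀ x y, e x y ≠ 0 → adm T P j (rho P j (x, y))) (x y) :
    La P j e x y ≤ (∑ x', ∑ y', if rho P j (x', y') = rho P j (x, y) then e x' y' else 0) / (2^j * P) := by
  by_cases h : La P j e x y = 0
  · rw [h]
    exact div_nonneg (sum2_nonneg fun _ _ => by split_ifs; exacts [h0 _ _, le_rfl]) (by positivity)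
  · obtain ⟨x', y', h1, h2⟩ := La_ex h
    have h3 := ha _ _ h1
    rw [h2] at h3
    have h4 := rho_cnt hP hj _ _ h3
    rw [La, av, ← h4, Fintype.sum_prod_type]
    refine le_of_eq ?_
    congr!

lemma La_LInv (P j : ℕ) (e : Kn T) : LInv P j (La P j e) := by
  intro x x' y y' h1 h2
  refine av_ms (rho P j) _ _ _ ?_
  rw [rho_iff]
  exact ⟨h1, by simp only [rho]; omega⟩

lemma La_colsum {P j : ℕ} (hP : 0 < P) {e : Kn T}
    (ha : ∀ x y, e x y ≠ 0 → adm T P j (rho P j (x, y))) {x x' : Fn T} (hx : lb j x' = lb j x) :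
    (∑ y, La P j e x y) * P = ∑ y, ∑ y' : Fn T, if y.val / P + x'.val = y'.val / P + x.val then La P j e x y else 0 := by
  rw [sum_mul]
  refine sum_congr rfl fun y _ => ?_
  by_cases h : La P j e x y = 0
  · simp [h]
  · obtain ⟨x1, y1, h1, h2⟩ := La_ex h
    have h3 := ha _ _ h1
    rw [h2] at h3
    have h4 := adm_row h3 (x := x') hx
    rw [← cntP hP _ h4.1 h4.2, mul_sum]
    refine sum_congr rfl fun y' _ => ?_
    rw [mul_ite, mul_one, mul_zero]
    refine if_congr ?_ rfl rfl
    simp only [rho]; omega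

lemma La_col {P j : ℕ} (hP : 0 < P) {e : Kn T}
    (ha : ∀ x y, e x y ≠ 0 → adm T P j (rho P j (x, y))) (x y) :
    E2 T (La P j e) x y = E1 j (E2 T (La P j e)) x y := by
  have h1 : ∀ x x' : Fn T, lb j x = lb j x' → E2 T (La P j e) x y = E2 T (La P j e) x' y := by
    intro x x' hx
    rw [E2, E2, Ea_eq le_rfl, Ea_eq le_rfl]
    simp only [lb_big le_rfl, if_true]
    congr 1
    have hP' : (P:ℝ) ≠ 0 := by positivity
    apply mul_right_cancel₀ hP'
    rw [La_colsum hP ha hx.symm, La_colsum hP ha hx, sum_comm]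
    refine sum_congr rfl fun y' _ => sum_congr rfl fun y _ => ?_
    by_cases h : y.val / P + x'.val = y'.val / P + x.val
    · rw [if_pos h, if_pos h.symm]
      exact La_LInv P j e _ _ _ _ hx h
    · rw [if_neg h, if_neg (fun h' => h h'.symm)]
  exact (av_of_ms (lb j) (b := fun x => E2 T (La P j e) x y) (fun a b h => h1 a b h) x).symm

def sig (S : ℕ) : ℕ := (4^S - 1) / 3

lemma sig_eq (S : ℕ) : 3 * sig S + 1 = 4^S := by
  have h : 4^S % 3 = 1 := by rw [Nat.pow_mod]; simp
  have := Nat.one_le_pow S 4 (by norm_num)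
  rw [sig]; omega

lemma sig_mod {S l : ℕ} (hl : l ≤ 2*S) :
    3 * (sig S % 2^l) + 1 = 2^l ∨ 3 * (sig S % 2^l) + 1 = 2 * 2^l := by
  have h1 := sig_eq S
  have h2 : (4:ℕ)^S = 2^l * 2^(2*S-l) := by
    rw [← pow_add, Nat.add_sub_cancel' hl, pow_mul]; norm_num
  have h3 := Nat.div_add_mod (sig S) (2^l)
  have h4 : sig S % 2^l < 2^l := Nat.mod_lt _ (by positivity)
  set r := sig S % 2^l
  set t := sig S / 2^l
  set a := 2^l
  set b := 2^(2*S-l)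
  have h5 : (3 * (r:ℤ) + 1) = a * (b - 3 * t) := by
    have : 3 * (a * t + r) + 1 = a * b := by rw [h3, h1, h2]
    zify at this; linarith
  have a0 : (0:ℤ) < a := by positivity
  have h6 : (0:ℤ) < b - 3 * t := by
    by_contra h; push Not at h; nlinarith
  have h7 : ((b:ℤ) - 3 * t) < 3 := by
    by_contra h; push Not at h; zify at h4; nlinarith
  have h8 : (b:ℤ) - 3 * t = 1 ∨ (b:ℤ) - 3 * t = 2 := by omega
  rcases h8 with h | h
  · left; rw [h] at h5; zify; linarith
  · right; rw [h] at h5; zify; linarith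

lemma grid_aux {a d v y y'' : ℤ} (ha : 0 < a) (h1 : d ≤ (y + v) % a) (h2 : (y + v) % a + d < a) (h : |y'' - y| ≤ d) :
    (y'' + v) / a = (y + v) / a := by
  rw [abs_le] at h
  have h3 := Int.mul_ediv_add_emod (y + v) a
  rw [Int.ediv_eq_iff_of_pos ha]
  constructor <;> nlinarith

lemma twogrid {S l : ℕ} (hl : l ≤ 2*S) {d : ℕ} (hd0 : 0 < d) (hd : 8 * d ≤ 2^l) (y : ℤ) :
    (∀ y'' : ℤ, |y'' - y| ≤ d → y'' / 2^l = y / 2^l) ∨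
    (∀ y'' : ℤ, |y'' - y| ≤ d → (y'' + sig S) / 2^l = (y + sig S) / 2^l) := by
  have a0 : (0:ℤ) < 2^l := by positivity
  by_cases h : (d:ℤ) ≤ y % 2^l ∧ y % 2^l + d < 2^l
  · left
    intro y'' hy
    have := grid_aux (v := 0) a0 (by simpa using h.1) (by simpa using h.2) hy
    simpa using this
  · right
    intro y'' hy
    have hr := sig_mod hl
    have m0 := Int.emod_nonneg y a0.ne'
    have m1 := Int.emod_lt_of_pos y a0
    set r := sig S % 2^l with hrd
    have e0 : (y + sig S) % 2^l = (y % 2^l + r) % 2^l := by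
      rw [hrd]; push_cast; rw [Int.emod_add_emod, Int.add_emod_emod]
    set b := y % 2^l
    have hd' : 8 * (d:ℤ) ≤ 2^l := by exact_mod_cast hd
    have hr' : 3 * (r:ℤ) + 1 = 2^l ∨ 3 * (r:ℤ) + 1 = 2 * 2^l := by exact_mod_cast hr
    set a := (2:ℤ)^l
    refine grid_aux a0 ?_ ?_ hy
    all_goals
      rw [e0]
      rcases lt_or_ge (b + r) a with h1 | h1
      · rw [Int.emod_eq_of_lt (by omega) h1]; omega
      · rw [← Int.sub_emod_right, Int.emod_eq_of_lt (by omega) (by omega)]; omega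

def gl (v l : ℕ) (y : Fn T) : ℕ := (y.val + v) / 2^l

lemma gl_nest (v l : ℕ) (z w : Fn T) (h : gl v l z = gl v l w) : gl v (l+1) z = gl v (l+1) w := by
  simp only [gl, pow_succ, ← Nat.div_div_eq_div_mul] at *; rw [h]

lemma av_mul_ge {α β : Type*} [Fintype α] [DecidableEq β] (π : α → β) {N : ℝ} {a : α → ℝ} (h0 : ∀ w, 0 ≤ a w) (z : α)
    (hN : (∑ w, if π w = π z then (1:ℝ) else 0) ≤ N) : (∑ w, if π w = π z then a w else 0) ≤ N * av π a z := by
  have hp := av_cnt_pos π z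
  refine le_trans (le_of_eq ?_) (mul_le_mul_of_nonneg_right hN (av_nonneg _ h0 z))
  rw [av, mul_div_assoc', eq_div_iff hp.ne', mul_comm]
  congr!

lemma gl_cnt (v l : ℕ) (z : Fn T) :
    (∑ w : Fn T, if gl v l w = gl v l z then (1:ℝ) else 0) ≤ 2^l := by
  rw [Finset.sum_boole]
  have : (Finset.univ.filter fun w : Fn T => gl v l w = gl v l z).card ≤
      (Finset.Ico (gl v l z * 2^l) ((gl v l z + 1) * 2^l)).card := by
    refine Finset.card_le_card_of_injOn (fun w => w.val + v) ?_ ?_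
    · intro w hw
      simp only [Finset.coe_filter, Finset.mem_univ, true_and, Set.mem_ofPred_eq] at hw
      rw [← hw, Finset.coe_Ico, Set.mem_Ico, gl]
      exact ⟨Nat.div_mul_le_self _ _, by rw [mul_comm]; exact Nat.lt_mul_div_succ _ (by positivity)⟩
    · intro a _ b _ h
      exact Fin.ext (by simpa using h)
  rw [Nat.card_Ico, Nat.add_mul, one_mul, Nat.add_sub_cancel_left] at this
  exact_mod_cast this

lemma win {S l : ℕ} (hl : l ≤ 2*S) {d : ℕ} (hd0 : 0 < d) (hd : 8 * d ≤ 2^l) (a : Fn T → ℝ)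
    (h0 : ∀ y, 0 ≤ a y) (y : Fn T) :
    (∑ y'' : Fn T, if |(y''.val:ℤ) - y.val| ≤ d then a y'' else 0) ≤
      2^l * (av (gl 0 l) a y + av (gl (sig S) l) a y) := by
  have key : ∀ v : ℕ, (∀ y'' : ℤ, |y'' - y.val| ≤ d → (y'' + v) / 2^l = (y.val + v) / 2^l) →
      (∑ y'' : Fn T, if |(y''.val:ℤ) - y.val| ≤ d then a y'' else 0) ≤ 2^l * av (gl v l) a y := by
    intro v hv
    refine le_trans ?_ (av_mul_ge (gl v l) h0 y (gl_cnt v l y))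
    refine sum_le_sum fun w _ => ?_
    split_ifs with h1 h2 h2
    · exact le_rfl
    · exfalso; apply h2
      have := hv w.val h1
      rw [gl, gl]; zify; exact this
    · exact h0 _
    · exact le_rfl
  have n0 := av_nonneg (gl 0 l) h0 y
  have n1 := av_nonneg (gl (sig S) l) h0 y
  rcases twogrid hl hd0 hd y.val with h | h
  · refine (key 0 (by simpa using h)).trans ?_
    gcongr; linarith
  · refine (key _ h).trans ?_
    gcongr; linarith

lemma E1_eq {j : ℕ} (h : j ≤ T) (f : Kn T) (x y) :
    E1 j f x y = (∑ w, if lb j w = lb j x then f w y else 0) / 2^j := Ea_eq h _ _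

lemma hull_pt {P j k S : ℕ} (hP : 2^k ≤ P ∧ P < 2^(k+1)) (hj : j ≤ T) (hS : j + k + 4 ≤ 2*S)
    {e : Kn T} (h0 : ∀ x y, 0 ≤ e x y)
    (ha : ∀ x y, e x y ≠ 0 → adm T P j (rho P j (x, y))) (x y) :
    E1 j (La P j e) x y ≤ 16 * (E1 j (A2 (gl 0 (j+k+4)) e) x y + E1 j (A2 (gl (sig S) (j+k+4)) e) x y) := by
  have hP0 : 0 < P := lt_of_lt_of_le (by positivity) hP.1
  have hPr : (0:ℝ) < P := by exact_mod_cast hP0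
  have hPk : (2:ℝ)^k ≤ P := by exact_mod_cast hP.1
  rw [← E1_add, E1_eq hj, E1_eq hj, mul_div_assoc']
  refine div_le_div_of_nonneg_right ?_ (by positivity)
  set d := 2^(j+k+1) with hd
  have s1 : ∀ x' : Fn T, (if lb j x' = lb j x then La P j e x' y else 0) ≤
      ∑ x'', ∑ y'', (if lb j x' = lb j x ∧ rho P j (x'', y'') = rho P j (x', y) then e x'' y'' else 0) / (2^j * P) := by
    intro x'
    split_ifs with h
    · refine (La_eq hP0 hj h0 ha x' y).trans (le_of_eq ?_)
      simp only [h, true_and, Finset.sum_div]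
    · simp [h]
  have s2 : ∀ x'' y'' : Fn T, ∑ x' : Fn T, (if lb j x' = lb j x ∧ rho P j (x'', y'') = rho P j (x', y) then e x'' y'' else 0) ≤
      if lb j x'' = lb j x then (if |(y''.val:ℤ) - y.val| ≤ d then e x'' y'' else 0) else 0 := by
    intro x'' y''
    have hu : ∀ x1 x2 : Fn T, rho P j (x'', y'') = rho P j (x1, y) → rho P j (x'', y'') = rho P j (x2, y) → x1 = x2 := by
      intro x1 x2 h1 h2
      have h3 := congrArg Prod.snd (h1.symm.trans h2)
      simp only [rho] at h3
      exact Fin.ext (by omega)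
    by_cases hex : ∃ x', lb j x' = lb j x ∧ rho P j (x'', y'') = rho P j (x', y)
    · obtain ⟨x', h1, h2⟩ := hex
      rw [Finset.sum_eq_single x' (fun b _ hb => if_neg fun h => hb (hu _ _ h.2 h2)) (by simp), if_pos ⟨h1, h2⟩]
      have h3 : lb j x'' = lb j x' := congrArg Prod.fst h2
      have h4 : ((y''.val / P : ℕ) : ℤ) - x''.val = ((y.val / P : ℕ) : ℤ) - x'.val := congrArg Prod.snd h2
      rw [if_pos (h3.trans h1), if_pos]
      have b1 := (lb_iff (l := j) x'' _).1 h3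
      have b2 := (lb_iff (l := j) x' _).1 rfl
      have c1 := Nat.div_add_mod y''.val P
      have c2 := Nat.div_add_mod y.val P
      have c3 := Nat.mod_lt y''.val hP0
      have c4 := Nat.mod_lt y.val hP0
      have c5 : d = 2^j * 2^(k+1) := by rw [hd, ← pow_add]; ring_nf
      have c6 : |((y''.val / P : ℕ) : ℤ) - ((y.val / P : ℕ) : ℤ)| ≤ 2^j - 1 := by
        rw [show ((y''.val / P : ℕ) : ℤ) - ((y.val / P : ℕ) : ℤ) = x''.val - x'.val by omega]
        rw [Nat.add_mul, one_mul] at b1 b2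
        have : ((2^j : ℕ):ℤ) = 2^j := by norm_cast
        rw [abs_le]; omega
      have c7 : (2:ℤ)^j * P ≤ d := by
        rw [c5]; push_cast; gcongr
        have := hP.2.le; exact_mod_cast this
      rw [abs_le] at c6 ⊢
      zify at c1 c2 c3 c4
      push_cast at c6
      have t0 : (0:ℤ) ≤ P := by positivity
      have t1 := mul_le_mul_of_nonneg_left c6.1 t0
      have t2 := mul_le_mul_of_nonneg_left c6.2 t0
      have n1 := Nat.zero_le (y''.val % P)
      have n2 := Nat.zero_le (y.val % P)
      zify at n1 n2
      constructor <;> nlinarith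
    · rw [sum_eq_zero fun x' _ => if_neg fun h => hex ⟨x', h⟩]
      split_ifs
      exacts [h0 _ _, le_rfl, le_rfl]
  calc _ ≤ ∑ x' : Fn T, ∑ x'' : Fn T, ∑ y'', (if lb j x' = lb j x ∧ rho P j (x'', y'') = rho P j (x', y) then e x'' y'' else 0) / (2^j * P) :=
        sum_le_sum fun x' _ => s1 x'
    _ = (∑ x'' : Fn T, ∑ y'', ∑ x' : Fn T, (if lb j x' = lb j x ∧ rho P j (x'', y'') = rho P j (x', y) then e x'' y'' else 0)) / (2^j * P) := by
        simp only [← Finset.sum_div]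
        rw [sum_comm, sum_congr rfl fun x'' _ => sum_comm]
    _ ≤ (∑ x'' : Fn T, ∑ y'' : Fn T, if lb j x'' = lb j x then (if |(y''.val:ℤ) - y.val| ≤ d then e x'' y'' else 0) else 0) / (2^j * P) := by
        gcongr; exact s2 _ _
    _ ≤ (∑ x'' : Fn T, if lb j x'' = lb j x then 2^(j+k+4) * (A2 (gl 0 (j+k+4)) e x'' y + A2 (gl (sig S) (j+k+4)) e x'' y) else 0) / (2^j * P) := by
        gcongr with x'' _
        split_ifs with h
        · exact win hS (by positivity) (by rw [hd, pow_add 2 (j+k) 1, pow_add 2 (j+k) 4]; omega) (e x'') (h0 x'') y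
        · simp
    _ = (2^(j+k+4) / (2^j * P)) * (∑ x'' : Fn T, if lb j x'' = lb j x then (A2 (gl 0 (j+k+4)) e x'' y + A2 (gl (sig S) (j+k+4)) e x'' y) else 0) := by
        rw [mul_sum, Finset.sum_div]
        refine sum_congr rfl fun x'' _ => ?_
        split_ifs <;> ring
    _ ≤ _ := by
        refine mul_le_mul_of_nonneg_right ?_ (sum_nonneg fun x'' _ => ?_)
        · rw [div_le_iff₀ (by positivity), pow_add, pow_add]
          have : (0:ℝ) < 2^j := by positivity
          nlinarith
        · split_ifs
          · exact add_nonneg (av_nonneg _ (h0 x'') _) (av_nonneg _ (h0 x'') _)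
          · exact le_rfl

lemma DDi3 {ι : Type*} (π : ℕ → Fn T → ℕ) (hπ : ∀ l z w, π l z = π l w → π (l+1) z = π (l+1) w)
    (m : ℕ) (s : Finset ι) (l1 l2 : ι → ℕ) (g : ι → Kn T)
    (hg : ∀ i x y, 0 ≤ g i x y) :
    ∑ x, ∑ y, (∑ i ∈ s, E1 (l1 i) (A2 (π (l2 i)) (g i)) x y) ^ (m+1) ≤
      ((m+1) ^ (m+1) * (m+1) ^ (m+1)) * ∑ x, ∑ y, (∑ i ∈ s, g i x y) ^ (m+1) := by
  calc _ = ∑ y, ∑ x, (∑ i ∈ s, E1 (l1 i) (A2 (π (l2 i)) (g i)) x y) ^ (m+1) := sum_comm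
    _ ≤ ∑ y, (m+1) ^ (m+1) * ∑ x, (∑ i ∈ s, A2 (π (l2 i)) (g i) x y) ^ (m+1) := sum_le_sum fun y _ =>
        DDi lb lb_nest m s l1 (fun i x => A2 (π (l2 i)) (g i) x y) (fun i x => av_nonneg _ (hg i x) y)
    _ = (m+1) ^ (m+1) * ∑ x, ∑ y, (∑ i ∈ s, A2 (π (l2 i)) (g i) x y) ^ (m+1) := by
        rw [← mul_sum, sum_comm]
    _ ≤ (m+1) ^ (m+1) * ∑ x, (m+1) ^ (m+1) * ∑ y, (∑ i ∈ s, g i x y) ^ (m+1) :=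
        mul_le_mul_of_nonneg_left (sum_le_sum fun x _ =>
          DDi π hπ m s l2 (fun i y => g i x y) (fun i y => hg i x y)) (by positivity)
    _ = _ := by rw [← mul_sum, mul_assoc]

lemma La_total (P j : ℕ) (e : Kn T) : ∑ x, ∑ y, La P j e x y = ∑ x, ∑ y, e x y := by
  have := av_total (rho P j) (fun z : Fn T × Fn T => e z.1 z.2)
  simp only [Fintype.sum_prod_type] at this
  exact this

lemma sum_pair {α β : Type*} (s : Finset α) (t : Finset β) (f : α → β → ℝ) :
    ∑ a ∈ s, ∑ b ∈ t, f a b = ∑ i ∈ s ×ˢ t, f i.1 i.2 := (Finset.sum_product' s t f).symm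

lemma mass_La (P : ℕ → ℕ) (e : ℕ → ℕ → Kn T) (q : ℕ) :
    mass (fun k j => La (P k) j (e k j)) q =
      ∑ x, ∑ y, ∑ i ∈ rg q ×ˢ rg T, e i.1 i.2 x y := by
  simp only [mass, FF, GG]
  rw [sum4]
  simp only [La_total]
  rw [← sum4]
  simp only [sum_pair _ _ (fun k j => e k j _ _)]

lemma hull (m : ℕ) {q : ℕ} (hq : q ≤ T) {P : ℕ → ℕ} (hP : ∀ k < q, 2^k ≤ P k ∧ P k < 2^(k+1))
    (e : ℕ → ℕ → Kn T) (h0 : ∀ k j x y, 0 ≤ e k j x y)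
    (ha : ∀ k < q, ∀ j < T, ∀ x y, e k j x y ≠ 0 → adm T (P k) j (rho (P k) j (x, y)))
    (h1 : ∀ x y, ∑ k ∈ rg q, ∑ j ∈ rg T, e k j x y ≤ 1) :
    ∑ x, ∑ y, Ft (fun k j => La (P k) j (e k j)) q x y ^ (m+1) ≤
      (16^(m+1) * (2^(m+1) * (2 * ((m+1) ^ (m+1) * (m+1) ^ (m+1))))) * mass (fun k j => La (P k) j (e k j)) q := by
  set I := rg q ×ˢ rg T with hI
  set S := T + 3
  set B : ℕ → Kn T := fun v x y => ∑ i ∈ I, E1 i.2 (A2 (gl v (i.2+i.1+4)) (e i.1 i.2)) x y with hB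
  have B0 : ∀ v x y, 0 ≤ B v x y := fun v x y => sum_nonneg fun i _ =>
    E1_nonneg _ (fun x y => av_nonneg _ (h0 _ _ x) y) x y
  have e0 : ∀ x y, 0 ≤ ∑ i ∈ I, e i.1 i.2 x y := fun x y => sum_nonneg fun i _ => h0 _ _ _ _
  have e1 : ∀ x y, ∑ i ∈ I, e i.1 i.2 x y ≤ 1 := fun x y => by rw [← sum_pair _ _ (fun k j => e k j x y)]; exact h1 x y
  have F0 : ∀ x y, 0 ≤ Ft (fun k j => La (P k) j (e k j)) q x y :=
    fun x y => Ft_nonneg (g := fun k j => La (P k) j (e k j)) (h0 := fun k j x y => La_nonneg (h0 k j) x y) q x y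
  have hF : ∀ x y, Ft (fun k j => La (P k) j (e k j)) q x y ≤ 16 * (B 0 x y + B (sig S) x y) := by
    intro x y
    simp only [Ft, Gt, hB]
    rw [← sum_add_distrib, mul_sum, sum_pair _ _ (fun k j => E1 j (La (P k) j (e k j)) x y)]
    refine sum_le_sum fun i hi => ?_
    simp only [Finset.mem_product, Finset.mem_range] at hi
    exact hull_pt (hP _ hi.1) hi.2.le (by omega) (h0 _ _) (ha _ hi.1 _ hi.2) x y
  have hm := mass_La P e q
  have hBm : ∀ v, ∑ x, ∑ y, B v x y ^ (m+1) ≤ ((m+1) ^ (m+1) * (m+1) ^ (m+1)) * ∑ x, ∑ y, ∑ i ∈ I, e i.1 i.2 x y := by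
    intro v
    refine (DDi3 (gl v) (gl_nest v) m I (fun i => i.2) (fun i => i.2+i.1+4) (fun i => e i.1 i.2) (fun i => h0 _ _)).trans ?_
    refine mul_le_mul_of_nonneg_left (sum2_le fun x y => ?_) (by positivity)
    exact pow_le_of_le_one (e0 x y) (e1 x y) (by omega)
  calc _ ≤ ∑ x, ∑ y, 16^(m+1) * (2^(m+1) * (B 0 x y ^ (m+1) + B (sig S) x y ^ (m+1))) := by
        refine sum2_le fun x y => ?_
        refine (pow_le_pow_left₀ (F0 x y) (hF x y) _).trans ?_
        rw [mul_pow]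
        exact mul_le_mul_of_nonneg_left (add_pow2 (B0 _ x y) (B0 _ x y) _) (by positivity)
    _ = 16^(m+1) * (2^(m+1) * (∑ x, ∑ y, B 0 x y ^ (m+1) + ∑ x, ∑ y, B (sig S) x y ^ (m+1))) := by
        simp only [← mul_sum, sum_add_distrib]
    _ ≤ _ := by
        rw [hm]
        have h1 := hBm 0
        have h2 := hBm (sig S)
        rw [mul_assoc, mul_assoc, mul_assoc]
        gcongr
        linarith

end p9

section p9b
variable {T : ℕ}

lemma rho_nest {P j j' : ℕ} (h : j ≤ j') {z w : Fn T × Fn T} (e : rho P j z = rho P j w) :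
    rho P j' z = rho P j' w := by
  simp only [rho, Prod.mk.injEq] at *
  exact ⟨lb_nest' h _ _ e.1, e.2⟩

lemma La_adj (P j : ℕ) (e f : Kn T) :
    ∑ x, ∑ y, La P j e x y * f x y = ∑ x, ∑ y, e x y * La P j f x y := by
  have := av_adj (rho P j) (fun z : Fn T × Fn T => e z.1 z.2) (fun z => f z.1 z.2)
  simp only [Fintype.sum_prod_type] at this
  exact this

lemma A2_adj {β : Type*} (π : Fn T → β) (e f : Kn T) :
    ∑ x, ∑ y, A2 π e x y * f x y = ∑ x, ∑ y, e x y * A2 π f x y :=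
  sum_congr rfl fun x _ => av_adj π (e x) (f x)

lemma La_sum {ι : Type*} (s : Finset ι) (P j : ℕ) (e : ι → Kn T) (x y) :
    La P j (fun x y => ∑ i ∈ s, e i x y) x y = ∑ i ∈ s, La P j (e i) x y :=
  av_sum (rho P j) s (fun i z => e i z.1 z.2) _

lemma one_box {ι : Type*} [DecidableEq ι] (I : Finset ι) (i0 : ι) (b : Prop) [Decidable b] :
    ∑ i ∈ I, (if b ∧ i0 = i then (1:ℝ) else 0) ≤ if b then 1 else 0 := by
  by_cases h : b
  · simp only [h, true_and, if_true, Finset.sum_ite_eq]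
    split_ifs <;> norm_num
  · simp [h]

lemma young_eps (n : ℕ) {ε a b : ℝ} (hε : 0 < ε) (ha : 0 ≤ a) (hb : 0 ≤ b) :
    a * b ≤ (1/ε) ^ (((n:ℝ)+2)/(n+1)) * a ^ (((n:ℝ)+2)/(n+1)) + ε^(n+2) * b^(n+2) := by
  have hpq : (((n:ℝ)+2)/(n+1)).HolderConjugate ((n:ℝ)+2) := by
    rw [Real.holderConjugate_iff]
    refine ⟨by rw [lt_div_iff₀ (by positivity)]; linarith, ?_⟩
    field_simp
    ring
  have h := Real.young_inequality_of_nonneg (a := 1/ε * a) (b := ε * b) (by positivity) (by positivity) hpq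
  have e1 : 1/ε * a * (ε * b) = a * b := by field_simp
  rw [e1, Real.mul_rpow (by positivity) ha] at h
  have e2 : (ε * b) ^ ((n:ℝ)+2) = ε^(n+2) * b^(n+2) := by
    rw [← mul_pow, ← Real.rpow_natCast]; push_cast; rfl
  rw [e2] at h
  refine h.trans (add_le_add (div_le_self (by positivity) hpq.lt.le) (div_le_self (by positivity) ?_))
  have : (0:ℝ) ≤ n := by positivity
  linarith

open Classical in
lemma WT (n : ℕ) (hQ : QQ (n+2)) : ∃ C : ℝ, 0 ≤ C ∧ ∀ (T q : ℕ) (hq : q ≤ T) (P : ℕ → ℕ)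
    (hP : ∀ k < q, 2^k ≤ P k ∧ P k < 2^(k+1)) (π : ℕ → Fn T → ℕ)
    (hπ : ∀ l z w, π l z = π l w → π (l+1) z = π (l+1) w) (hπq : ∀ l z w, lb q z = lb q w → π l z = π l w)
    (L : ℕ) (f : Kn T) (hf : ∀ x y, 0 ≤ f x y) (bad : Fn T → Fn T → Prop)
    (hbad : ∀ x y, bad x y → ∃ k < q, ∃ j < T, adm T (P k) j (rho (P k) j (x, y)) ∧
      ∃ l < L, 1 < La (P k) j (A2 (π l) f) x y),
    (∑ x, ∑ y, if bad x y then (1:ℝ) else 0) ≤ C * ∑ x, ∑ y, f x y ^ (((n:ℝ)+2)/(n+1)) := by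
  obtain ⟨C, C0, hC⟩ := hQ (fun m => 16^(m+1) * (2^(m+1) * (2 * ((m+1) ^ (m+1) * (m+1) ^ (m+1)))))
  set ε : ℝ := 1/(2*(n+2)*(C+1)) with hε
  have ε0 : 0 < ε := by positivity
  refine ⟨2 * (1/ε) ^ (((n:ℝ)+2)/(n+1)), by positivity, ?_⟩
  intro T q hq P hP π hπ hπq L f hf bad hbad
  set good : ℕ → ℕ → Fn T → Fn T → Prop := fun k j x y => j < T ∧ adm T (P k) j (rho (P k) j (x, y)) ∧
      ∃ l < L, 1 < La (P k) j (A2 (π l) f) x y with hgood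
  have gcongr' : ∀ k j x y x' y', rho (P k) j (x, y) = rho (P k) j (x', y') → good k j x y → good k j x' y' := by
    rintro k j x y x' y' h ⟨h1, h2, l, h3, h4⟩
    refine ⟨h1, h ▸ h2, l, h3, ?_⟩
    rwa [La, ← av_ms (rho (P k) j) _ _ _ h]
  have sel : ∀ x y, ∃ k j l, bad x y → (k < q ∧ l < L ∧ good k j x y ∧ 1 < La (P k) j (A2 (π l) f) x y ∧
      ∀ j', j < j' → ¬ good k j' x y) := by
    intro x y
    by_cases h : bad x y
    · obtain ⟨k, hk, j, hj, h⟩ := hbad x y h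
      have hg : good k (Nat.findGreatest (fun j => good k j x y) T) x y :=
        Nat.findGreatest_spec (P := fun j => good k j x y) hj.le ⟨hj, h⟩
      obtain ⟨_, _, l, hl, hl'⟩ := id hg
      refine ⟨k, _, l, fun _ => ⟨hk, hl, hg, hl', fun j' hj' hc => ?_⟩⟩
      exact Nat.findGreatest_is_greatest hj' hc.1.le hc
    · exact ⟨0, 0, 0, fun h' => absurd h' h⟩
  choose kk jj ll hs using sel
  set el : ℕ → ℕ → ℕ → Kn T := fun l k j x y =>
    if bad x y ∧ (ll x y, kk x y, jj x y) = (l, k, j) then 1 else 0 with hel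
  set e : ℕ → ℕ → Kn T := fun k j x y => ∑ l ∈ rg L, el l k j x y with he
  have el0 : ∀ l k j x y, 0 ≤ el l k j x y := fun l k j x y => by simp only [hel]; split_ifs <;> norm_num
  have e0 : ∀ k j x y, 0 ≤ e k j x y := fun k j x y => sum_nonneg fun l _ => el0 _ _ _ _ _
  have ene : ∀ k j x y, e k j x y ≠ 0 → bad x y ∧ kk x y = k ∧ jj x y = j := by
    intro k j x y h
    obtain ⟨l, _, hl⟩ := Finset.exists_ne_zero_of_sum_ne_zero h
    simp only [hel, ne_eq, ite_eq_right_iff, not_forall] at hl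
    obtain ⟨⟨h1, h2⟩, _⟩ := hl
    simp only [Prod.mk.injEq] at h2
    exact ⟨h1, h2.2⟩
  set K3 := rg L ×ˢ (rg q ×ˢ rg T) with hK3
  set E : ℝ := ∑ x, ∑ y, if bad x y then (1:ℝ) else 0 with hE
  have eI : ∀ x y, ∑ i ∈ rg q ×ˢ rg T, e i.1 i.2 x y = ∑ i ∈ K3, el i.1 i.2.1 i.2.2 x y := by
    intro x y
    simp only [he]
    rw [sum_comm, hK3, Finset.sum_product (s := rg L)]
  have elb : ∀ x y, ∑ i ∈ K3, el i.1 i.2.1 i.2.2 x y ≤ if bad x y then 1 else 0 :=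
    fun x y => one_box K3 (ll x y, kk x y, jj x y) (bad x y)
  have eb : ∀ x y, ∑ i ∈ rg q ×ˢ rg T, e i.1 i.2 x y ≤ if bad x y then 1 else 0 :=
    fun x y => (eI x y).trans_le (elb x y)
  have ea : ∀ k < q, ∀ j < T, ∀ x y, e k j x y ≠ 0 → adm T (P k) j (rho (P k) j (x, y)) := by
    intro k _ j _ x y h
    obtain ⟨h1, h2, h3⟩ := ene _ _ _ _ h
    have := (hs x y h1).2.2.1.2.1
    rwa [h2, h3] at this
  have eone : ∀ x y, ∑ i ∈ rg q ×ˢ rg T, e i.1 i.2 x y ≤ 1 :=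
    fun x y => (eb x y).trans (by split_ifs <;> norm_num)
  set g : ℕ → ℕ → Kn T := fun k j => La (P k) j (e k j) with hg
  have hLD : LD T q P g := by
    refine ⟨hq, hP, fun k j => La_nonneg (e0 k j), fun k _ j _ => La_LInv _ _ _, fun k hk j hj x y => ?_, fun k hk x y => ?_⟩
    · exact La_col (lt_of_lt_of_le (by positivity) (hP k hk).1) (ea k hk j hj) x y
    · have uniq : ∀ j1 j2, j1 < j2 → g k j1 x y ≠ 0 → g k j2 x y ≠ 0 → False := by
        intro j1 j2 h12 n1 n2
        obtain ⟨x1, y1, a1, b1⟩ := La_ex n1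
        obtain ⟨x2, y2, a2, b2⟩ := La_ex n2
        obtain ⟨c1, c2, c3⟩ := ene _ _ _ _ a1
        obtain ⟨d1, d2, d3⟩ := ene _ _ _ _ a2
        have f2 := (hs x2 y2 d1).2.2.1
        rw [d2, d3] at f2
        have f1 := (hs x1 y1 c1).2.2.2.2 j2 (by rw [c3]; exact h12)
        rw [c2] at f1
        exact f1 (gcongr' _ _ _ _ _ _ (b2.trans (rho_nest h12.le b1).symm) f2)
      by_cases hz : ∃ j ∈ rg T, g k j x y ≠ 0
      · obtain ⟨j, hj, hne⟩ := hz
        rw [Finset.sum_eq_single_of_mem j hj]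
        · refine av_le_one (rho (P k) j) (a := fun z => e k j z.1 z.2) (fun w => ?_) _
          refine le_trans ?_ (eone w.1 w.2)
          exact Finset.single_le_sum (f := fun i : ℕ × ℕ => e i.1 i.2 w.1 w.2) (a := (k, j)) (fun i _ => e0 _ _ _ _)
            (Finset.mem_product.2 ⟨Finset.mem_range.2 hk, hj⟩)
        · intro b _ hb
          by_contra hbn
          rcases lt_or_gt_of_ne hb with h | h
          · exact uniq _ _ h hbn hne
          · exact uniq _ _ h hne hbn
      · push Not at hz
        rw [sum_eq_zero hz]; norm_num
  have hmass : mass g q ≤ E := by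
    rw [hg, mass_La]
    exact sum2_le eb
  have hQ' := hC T q P g hLD (fun m => hull m hq hP e e0 ea
    (fun x y => by rw [sum_pair _ _ (fun k j => e k j x y)]; exact eone x y))
  set H : Kn T := fun x y => ∑ i ∈ K3, A2 (π i.1) (E2 q (La (P i.2.1) i.2.2 (el i.1 i.2.1 i.2.2))) x y with hH
  have El0 : ∀ (i : ℕ × ℕ × ℕ) x y, 0 ≤ E2 q (La (P i.2.1) i.2.2 (el i.1 i.2.1 i.2.2)) x y :=
    fun i => E2_nonneg q (La_nonneg (el0 _ _ _))
  have H0 : ∀ x y, 0 ≤ H x y := fun x y => sum_nonneg fun i _ => av_nonneg _ (El0 i x) y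
  have hHM : ∑ x, ∑ y, H x y ^ (n+2) ≤ (n+2)^(n+2) * (C * E) := by
    have h1 : ∀ x y, ∑ i ∈ K3, E2 q (La (P i.2.1) i.2.2 (el i.1 i.2.1 i.2.2)) x y = E2 q (FF g q) x y := by
      intro x y
      rw [← E2_sum]
      congr 1
      funext x y
      simp only [FF, GG, hg, he, La_sum]
      rw [hK3, Finset.sum_product, sum_pair _ _ (fun k j => ∑ l ∈ rg L, La (P k) j (el l k j) x y), sum_comm]
    calc _ ≤ ∑ x, ((n+1:ℕ)+1:ℝ)^(n+1+1) * ∑ y, (∑ i ∈ K3, E2 q (La (P i.2.1) i.2.2 (el i.1 i.2.1 i.2.2)) x y) ^ (n+1+1) :=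
          sum_le_sum fun x _ => DDi π hπ (n+1) K3 (fun i => i.1)
            (fun i y => E2 q (La (P i.2.1) i.2.2 (el i.1 i.2.1 i.2.2)) x y) (fun i y => El0 i x y)
      _ = (n+2)^(n+2) * ∑ x, ∑ y, E2 q (FF g q) x y ^ (n+2) := by
          simp only [h1]
          rw [← mul_sum]; push_cast; ring_nf
      _ ≤ _ := mul_le_mul_of_nonneg_left (hQ'.trans (mul_le_mul_of_nonneg_left hmass C0)) (by positivity)
  have hEf : E ≤ ∑ x, ∑ y, f x y * H x y := by
    calc E ≤ ∑ x, ∑ y, ∑ i ∈ K3, el i.1 i.2.1 i.2.2 x y * La (P i.2.1) i.2.2 (A2 (π i.1) f) x y := by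
          refine sum2_le fun x y => ?_
          have nn : ∀ i ∈ K3, 0 ≤ el i.1 i.2.1 i.2.2 x y * La (P i.2.1) i.2.2 (A2 (π i.1) f) x y := fun i _ =>
            mul_nonneg (el0 _ _ _ _ _) (La_nonneg (fun x y => av_nonneg _ (hf x) y) x y)
          split_ifs with h
          · obtain ⟨h1, h2, h3, h4, h5⟩ := hs x y h
            refine le_trans ?_ (Finset.single_le_sum nn (a := (ll x y, kk x y, jj x y)) ?_)
            · simp only [hel, h, true_and, if_true, one_mul]
              exact h4.le
            · simp only [hK3, Finset.mem_product, Finset.mem_range]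
              exact ⟨h2, h1, h3.1⟩
          · exact sum_nonneg nn
      _ = ∑ i ∈ K3, ∑ x, ∑ y, el i.1 i.2.1 i.2.2 x y * La (P i.2.1) i.2.2 (A2 (π i.1) f) x y := by
          rw [sum_congr rfl fun x _ => sum_comm, sum_comm]
      _ = ∑ i ∈ K3, ∑ x, ∑ y, f x y * A2 (π i.1) (E2 q (La (P i.2.1) i.2.2 (el i.1 i.2.1 i.2.2))) x y := by
          refine sum_congr rfl fun i _ => ?_
          rw [← La_adj, ← A2_adj]
          refine sum_congr rfl fun x _ => ?_
          refine sum_congr rfl fun y _ => ?_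
          rw [mul_comm]
          congr 1
          exact (av_tower (lb q) (hπq i.1) _ y).symm
      _ = _ := by
          simp only [hH, mul_sum]
          rw [sum_comm, sum_congr rfl fun x _ => sum_comm]
  have E0 : 0 ≤ E := sum2_nonneg fun x y => by split_ifs <;> norm_num
  have hY : E ≤ (1/ε) ^ (((n:ℝ)+2)/(n+1)) * ∑ x, ∑ y, f x y ^ (((n:ℝ)+2)/(n+1)) + ε^(n+2) * ∑ x, ∑ y, H x y ^ (n+2) := by
    refine hEf.trans ((sum2_le fun x y => young_eps n ε0 (hf x y) (H0 x y)).trans (le_of_eq ?_))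
    simp only [sum_add_distrib, ← mul_sum]
  have hsm : ε^(n+2) * ((n+2)^(n+2) * (C * E)) ≤ E / 2 := by
    have h1 : ε * (n+2) = 1/(2*(C+1)) := by rw [hε]; field_simp
    have h2 : 1/(2*(C+1)) ≤ 1 := by rw [div_le_one (by positivity)]; linarith
    calc _ = (ε * (n+2))^(n+2) * (C * E) := by rw [mul_pow]; ring
      _ ≤ (ε * (n+2)) * (C * E) := by
          rw [h1]
          exact mul_le_mul_of_nonneg_right (pow_le_of_le_one (by positivity) h2 (by omega)) (by positivity)
      _ = (C/(C+1)) * (E/2) := by rw [h1]; field_simp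
      _ ≤ 1 * (E/2) := mul_le_mul_of_nonneg_right (by rw [div_le_one (by positivity)]; linarith) (by positivity)
      _ = _ := one_mul _
  have hsm' : ε^(n+2) * ∑ x, ∑ y, H x y ^ (n+2) ≤ E/2 :=
    (mul_le_mul_of_nonneg_left hHM (by positivity)).trans hsm
  linarith

end p9b

section p10
variable {T : ℕ}

def pl (v q l : ℕ) (y : Fn T) : ℕ := (lb q y + v) / 2^l

lemma pl_gl (v q l : ℕ) (y : Fn T) : pl v q l y = gl (v * 2^q) (q + l) y := by
  unfold pl gl lb
  rw [pow_add, ← Nat.div_div_eq_div_mul, Nat.add_mul_div_right _ _ (by positivity)]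

lemma winc {S q l : ℕ} (hl : l ≤ 2*S) {d : ℕ} (hd0 : 0 < d) (hd : 8 * d ≤ 2^l) (a : Fn T → ℝ)
    (h0 : ∀ y, 0 ≤ a y) (y : Fn T) :
    (∑ y'' : Fn T, if |(lb q y'':ℤ) - lb q y| ≤ d then a y'' else 0) ≤
      2^(q+l) * (av (pl 0 q l) a y + av (pl (sig S) q l) a y) := by
  have key : ∀ v, (∀ y'' : ℤ, |y'' - lb q y| ≤ d → (y'' + (v:ℕ)) / 2^l = ((lb q y : ℤ) + v) / 2^l) →
      (∑ y'' : Fn T, if |(lb q y'':ℤ) - lb q y| ≤ d then a y'' else 0) ≤ 2^(q+l) * av (pl v q l) a y := by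
    intro v h
    refine le_trans (sum_le_sum fun y'' _ => ?_) (av_mul_ge (pl v q l) h0 y ?_)
    · by_cases h1 : |(lb q y'':ℤ) - lb q y| ≤ d
      · rw [if_pos h1, if_pos]
        have := h _ h1
        unfold pl
        exact_mod_cast this
      · rw [if_neg h1]; split_ifs <;> simp [h0]
    · simp only [pl_gl]
      exact gl_cnt _ _ _
  have n1 := av_nonneg (pl 0 q l) h0 y
  have n2 := av_nonneg (pl (sig S) q l) h0 y
  have hp : (0:ℝ) < 2^(q+l) := by positivity
  rcases twogrid hl hd0 hd (lb q y : ℤ) with h | h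
  · refine (key 0 (by simpa using h)).trans (mul_le_mul_of_nonneg_left (by linarith) hp.le)
  · refine (key (sig S) h).trans (mul_le_mul_of_nonneg_left (by linarith) hp.le)

lemma par_pt {S q P j l a b : ℕ} {u : ℝ} (hP : 0 < P) (hPq : P ≤ 2^q) (hj : j ≤ T) (hl : l ≤ 2*S)
    (hb : 8 * (b+3) ≤ 2^l) (ha : a ≤ 2^q) (hu : (P:ℝ) ≤ u * 2^q) (hu' : u * 2^q < P + 1)
    {f : Kn T} (hf : ∀ x y, 0 ≤ f x y) (x y : Fn T)
    (hadm : adm T P j (rho P j (x, y)))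
    (hx : ∀ x'' : ℤ, |x'' - x.val| ≤ a → x'' / 2^j = (x.val:ℤ) / 2^j) :
    (∑ x' : Fn T, ∑ y' : Fn T, if |(x'.val:ℤ) - x.val| ≤ a ∧
      |((lb q y' : ℝ) - lb q y) - u * ((x'.val:ℝ) - x.val)| ≤ b then f x' y' else 0) ≤
      2^(q+l) * 2^j * (La P j (A2 (pl 0 q l) f) x y + La P j (A2 (pl (sig S) q l) f) x y) := by
  set G : Kn T := fun x y => A2 (pl 0 q l) f x y + A2 (pl (sig S) q l) f x y with hG
  have G0 : ∀ x y, 0 ≤ G x y := fun x y => add_nonneg (av_nonneg _ (hf x) y) (av_nonneg _ (hf x) y)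
  have hPr : (0:ℝ) < P := by exact_mod_cast hP
  have hrow : ∀ x' : Fn T, (P:ℝ) * (∑ y' : Fn T, if |(x'.val:ℤ) - x.val| ≤ a ∧
      |((lb q y' : ℝ) - lb q y) - u * ((x'.val:ℝ) - x.val)| ≤ b then f x' y' else 0) ≤
      ∑ y', if rho P j (x', y') = rho P j (x, y) then 2^(q+l) * G x' y' else 0 := by
    intro x'
    by_cases hxa : |(x'.val:ℤ) - x.val| ≤ a
    swap
    · simp only [hxa, false_and, if_false, Finset.sum_const_zero, mul_zero]
      exact sum_nonneg fun y' _ => by split_ifs; exacts [mul_nonneg (by positivity) (G0 _ _), le_rfl]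
    have hlb : lb j x' = lb j x := by
      have := hx _ hxa
      unfold lb
      exact_mod_cast this
    obtain ⟨r1, r2⟩ := adm_row hadm (x := x') hlb
    rw [← cntP hP _ r1 r2, sum_mul]
    refine sum_le_sum fun y' _ => ?_
    have hiff : rho P j (x', y') = rho P j (x, y) ↔ ((y'.val / P : ℕ) : ℤ) = (rho P j (x, y)).2 + x'.val := by
      rw [rho_iff]; exact ⟨fun h => h.2, fun h => ⟨hlb, h⟩⟩
    by_cases hr : ((y'.val / P : ℕ) : ℤ) = (rho P j (x, y)).2 + x'.val
    swap
    · rw [if_neg hr, if_neg (fun h => hr (hiff.1 h)), zero_mul]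
    rw [if_pos hr, if_pos (hiff.2 hr), one_mul]
    refine le_trans (sum_le_sum fun y'' _ => ?_) (winc (q := q) hl (d := b+3) (by omega) hb (f x') (hf x') y')
    by_cases hc : |((lb q y'' : ℝ) - lb q y) - u * ((x'.val:ℝ) - x.val)| ≤ b
    swap
    · simp only [hc, and_false, if_false]; split_ifs <;> simp [hf]
    rw [if_pos ⟨hxa, hc⟩, if_pos]
    have hq0 : (0:ℝ) < 2^q := by positivity
    have e1 : ((y'.val / P : ℕ) : ℝ) = ((y.val / P : ℕ):ℝ) - x.val + x'.val := by
      have h' : ∀ A B c d : ℕ, (A:ℤ) = (B:ℤ) - c + d → (A:ℝ) = B - c + d := by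
        intro A B c d h; have := congrArg (Int.cast (R := ℝ)) h; push_cast at this; exact this
      exact h' _ _ _ _ hr
    have y1 : (y.val:ℝ) = P * ((y.val / P : ℕ):ℝ) + ((y.val % P : ℕ):ℝ) := by exact_mod_cast (Nat.div_add_mod _ _).symm
    have y2 : (y'.val:ℝ) = P * ((y'.val / P : ℕ):ℝ) + ((y'.val % P : ℕ):ℝ) := by exact_mod_cast (Nat.div_add_mod _ _).symm
    have y3 : (y.val:ℝ) = 2^q * (lb q y:ℝ) + ((y.val % 2^q : ℕ):ℝ) := by unfold lb; exact_mod_cast (Nat.div_add_mod _ _).symm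
    have y4 : (y'.val:ℝ) = 2^q * (lb q y':ℝ) + ((y'.val % 2^q : ℕ):ℝ) := by unfold lb; exact_mod_cast (Nat.div_add_mod _ _).symm
    have m1 : ((y.val % P : ℕ):ℝ) ≤ 2^q := by exact_mod_cast (Nat.mod_lt _ hP).le.trans hPq
    have m2 : ((y'.val % P : ℕ):ℝ) ≤ 2^q := by exact_mod_cast (Nat.mod_lt _ hP).le.trans hPq
    have m3 : ((y.val % 2^q : ℕ):ℝ) ≤ 2^q := by exact_mod_cast (Nat.mod_lt _ (by positivity)).le
    have m4 : ((y'.val % 2^q : ℕ):ℝ) ≤ 2^q := by exact_mod_cast (Nat.mod_lt _ (by positivity)).le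
    have p1 : (0:ℝ) ≤ ((y.val % P : ℕ):ℝ) := by positivity
    have p2 : (0:ℝ) ≤ ((y'.val % P : ℕ):ℝ) := by positivity
    have p3 : (0:ℝ) ≤ ((y.val % 2^q : ℕ):ℝ) := by positivity
    have p4 : (0:ℝ) ≤ ((y'.val % 2^q : ℕ):ℝ) := by positivity
    have hi : |(x'.val:ℝ) - x.val| ≤ 2^q := by
      have : |(x'.val:ℝ) - x.val| ≤ a := by exact_mod_cast hxa
      exact this.trans (by exact_mod_cast ha)
    set i : ℝ := (x'.val:ℝ) - x.val with hidef
    have e2 : 2^q * ((lb q y':ℝ) - lb q y) = P * i + (((y'.val % P : ℕ):ℝ) - ((y.val % P : ℕ):ℝ)) -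
        (((y'.val % 2^q : ℕ):ℝ) - ((y.val % 2^q : ℕ):ℝ)) := by
      rw [e1] at y2
      have : (P:ℝ) * (((y.val / P : ℕ):ℝ) - x.val + x'.val) = P * ((y.val / P : ℕ):ℝ) + P * i := by rw [hidef]; ring
      linarith
    have e3 : |(u * 2^q - P) * i| ≤ 2^q := by
      rw [abs_mul]
      have : |u * 2^q - P| ≤ 1 := by rw [abs_le]; constructor <;> linarith
      calc _ ≤ 1 * (2:ℝ)^q := mul_le_mul this hi (abs_nonneg _) zero_le_one
        _ = _ := one_mul _
    have e4 : 2^q * |((lb q y':ℝ) - lb q y) - u * i| ≤ 2^q * 3 := by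
      rw [← abs_of_pos hq0, ← abs_mul, abs_of_pos hq0, mul_sub, e2, abs_le]
      have : 2^q * (u * i) = P * i + (u * 2^q - P) * i := by ring
      rw [abs_le] at e3
      rw [this]
      constructor <;> linarith
    have e5 := le_of_mul_le_mul_left e4 hq0
    have : |(lb q y'':ℝ) - lb q y'| ≤ b + 3 := by
      rw [abs_le] at *
      constructor <;> linarith
    exact_mod_cast this
  have hsum : (P:ℝ) * (∑ x' : Fn T, ∑ y' : Fn T, if |(x'.val:ℤ) - x.val| ≤ a ∧
      |((lb q y' : ℝ) - lb q y) - u * ((x'.val:ℝ) - x.val)| ≤ b then f x' y' else 0) ≤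
      2^(q+l) * ∑ x', ∑ y', if rho P j (x', y') = rho P j (x, y) then G x' y' else 0 := by
    rw [mul_sum, mul_sum]
    refine sum_le_sum fun x' _ => (hrow x').trans (le_of_eq ?_)
    rw [mul_sum]
    simp only [mul_ite, mul_zero]
  have hav : (∑ x', ∑ y', if rho P j (x', y') = rho P j (x, y) then G x' y' else 0) ≤ 2^j * P * La P j G x y := by
    have := av_mul_ge (rho P j) (a := fun z : Fn T × Fn T => G z.1 z.2) (fun w => G0 _ _) (x, y)
      (rho_cnt hP hj x y hadm).le
    rw [Fintype.sum_prod_type] at this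
    exact this
  have hLa : La P j G x y = La P j (A2 (pl 0 q l) f) x y + La P j (A2 (pl (sig S) q l) f) x y :=
    av_add (rho P j) (fun z => A2 (pl 0 q l) f z.1 z.2) (fun z => A2 (pl (sig S) q l) f z.1 z.2) _
  rw [← hLa]
  refine le_of_mul_le_mul_left (hsum.trans ((mul_le_mul_of_nonneg_left hav (by positivity)).trans (le_of_eq ?_))) hPr
  ring

lemma fib {q : ℕ} (hq : q ≤ T) (o s : ℤ) (W : Finset (ℤ × ℤ))
    (hW : ∀ w ∈ W, 0 ≤ w.1 + o + s ∧ w.1 + o + s < 2^T ∧ 0 ≤ w.2 + o ∧ (w.2 + o + 1) * 2^q ≤ 2^T) (h : ℤ × ℤ → ℝ) :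
    (∑ x : Fn T, ∑ y : Fn T, if ((x.val:ℤ) - o - s, (lb q y:ℤ) - o) ∈ W then
      h ((x.val:ℤ) - o - s, (lb q y:ℤ) - o) else 0) = 2^q * ∑ w ∈ W, h w := by
  have e : ∀ x y : Fn T, (if ((x.val:ℤ) - o - s, (lb q y:ℤ) - o) ∈ W then
      h ((x.val:ℤ) - o - s, (lb q y:ℤ) - o) else 0) =
      ∑ w ∈ W, (if (x.val:ℤ) = w.1 + o + s then 1 else 0) * ((if (lb q y:ℤ) = w.2 + o then (1:ℝ) else 0) * h w) := by
    intro x y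
    rw [← Finset.sum_ite_eq W ((x.val:ℤ) - o - s, (lb q y:ℤ) - o) h]
    refine sum_congr rfl fun w _ => ?_
    by_cases h1 : (x.val:ℤ) = w.1 + o + s
    · by_cases h2 : (lb q y:ℤ) = w.2 + o
      · rw [if_pos h1, if_pos h2, if_pos]
        · ring
        · ext <;> simp only <;> omega
      · rw [if_neg h2, if_neg]
        · ring
        · intro hc; rw [Prod.ext_iff] at hc; simp only at hc; omega
    · rw [if_neg h1, if_neg]
      · ring
      · intro hc; rw [Prod.ext_iff] at hc; simp only at hc; omega
  simp only [e]
  rw [sum_congr rfl fun x _ => sum_comm, sum_comm, mul_sum]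
  refine sum_congr rfl fun w hw => ?_
  obtain ⟨a1, a2, a3, a4⟩ := hW w hw
  simp only [← mul_sum, ← sum_mul]
  obtain ⟨X, hX⟩ := Int.eq_ofNat_of_zero_le a1
  obtain ⟨Y, hY⟩ := Int.eq_ofNat_of_zero_le a3
  simp only [hX, hY] at *
  have a2' : X < 2^T := by exact_mod_cast a2
  have a4' : (Y+1) * 2^q ≤ 2^T := by exact_mod_cast a4
  have c1 : (∑ x : Fn T, if (x.val:ℤ) = (X:ℤ) then (1:ℝ) else 0) = 1 := by
    rw [Finset.sum_eq_single (⟨X, a2'⟩ : Fn T)]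
    · simp
    · intro b _ hb; rw [if_neg]; intro hc; apply hb; ext; exact_mod_cast hc
    · simp
  have hY' : Y * 2^q < 2^T := by have : 0 < 2^q := by positivity
                                 nlinarith
  have c2 : (∑ y : Fn T, if (lb q y:ℤ) = (Y:ℤ) then (1:ℝ) else 0) = 2^q := by
    rw [← lb_cnt hq (⟨Y * 2^q, hY'⟩ : Fn T)]
    refine sum_congr rfl fun y _ => ?_
    have : lb q (⟨Y * 2^q, hY'⟩ : Fn T) = Y := Nat.mul_div_cancel _ (by positivity)
    rw [this]; simp only [Nat.cast_inj]
  rw [c1, c2, one_mul]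
end p10

section p10b

lemma clog_bd {a : ℕ} (ha : 0 < a) : 8 * a ≤ 2 ^ Nat.clog 2 (8*a) ∧ 2 ^ Nat.clog 2 (8*a) ≤ 16 * a := by
  refine ⟨Nat.le_pow_clog (by norm_num) _, ?_⟩
  have h := Nat.pow_pred_clog_lt_self (b := 2) (by norm_num) (x := 8*a) (by omega)
  have hp : 0 < Nat.clog 2 (8*a) := Nat.clog_pos (by norm_num) (by omega)
  obtain ⟨k, hk⟩ := Nat.exists_eq_succ_of_ne_zero hp.ne'
  rw [hk] at h ⊢
  simp only [Nat.pred_succ, Nat.succ_eq_add_one, pow_succ] at h ⊢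
  omega

lemma adm_of {T P j M S : ℕ} (pk0 : 0 < P) (pkM : P ≤ 2^M) (jS : (2:ℤ)^j ≤ 4^S) (hTM : (2:ℤ)^T = 2^M * (8 * 4^S))
    (x y : Fn T) (z1 : (4:ℤ)^S ≤ lb M y) (z2 : (lb M y:ℤ) + 1 ≤ 3 * 4^S) : adm T P j (rho P j (x, y)) := by
  have xj : (2:ℤ)^j * ((x.val / 2^j : ℕ):ℤ) ≤ x.val ∧ (x.val:ℤ) < 2^j * ((x.val / 2^j : ℕ):ℤ) + 2^j := by
    have e := Nat.div_add_mod x.val (2^j)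
    have e' := Nat.mod_lt x.val (show 0 < 2^j by positivity)
    constructor
    · have : 2^j * (x.val / 2^j) ≤ x.val := by omega
      exact_mod_cast this
    · have : x.val < 2^j * (x.val / 2^j) + 2^j := by omega
      exact_mod_cast this
  have yP := Nat.div_add_mod y.val (P)
  have yP' := Nat.mod_lt y.val pk0
  have yq := Nat.div_add_mod y.val (2^M)
  have yq' := Nat.mod_lt y.val (show 0 < 2^M by positivity)
  have yl : lb M y = y.val / 2^M := rfl
  have PM : (P:ℤ) ≤ 2^M := by exact_mod_cast pkM
  have P0 : (0:ℤ) < P := by exact_mod_cast pk0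
  have hy1 : (2:ℤ)^M * lb M y ≤ y.val := by rw [yl]; exact_mod_cast (by omega : 2^M * (y.val / 2^M) ≤ y.val)
  have hy2 : (y.val:ℤ) < 2^M * (lb M y + 1) := by
    rw [yl]; exact_mod_cast (by rw [mul_add]; omega : y.val < 2^M * (y.val / 2^M + 1))
  have hy3 : (P:ℤ) * ((y.val / P : ℕ):ℤ) ≤ y.val := by exact_mod_cast (by omega : P * (y.val / P) ≤ y.val)
  have hy4 : (y.val:ℤ) < P * (((y.val / P : ℕ):ℤ) + 1) := by
    exact_mod_cast (by rw [mul_add]; omega : y.val < P * (y.val / P + 1))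
  constructor
  · simp only [rho, lb]
    have : (2:ℤ)^j ≤ ((y.val / P : ℕ):ℤ) := by
      by_contra hc
      push Not at hc
      have : (P:ℤ) * (((y.val / P : ℕ):ℤ) + 1) ≤ 2^M * 4^S :=
        mul_le_mul PM (by linarith) (by positivity) (by positivity)
      have h5 : (2:ℤ)^M * 4^S ≤ 2^M * lb M y := mul_le_mul_of_nonneg_left z1 (by positivity)
      linarith
    linarith [xj.2]
  · simp only [rho, lb]
    have e1 : (2:ℤ)^j * ((x.val / 2^j : ℕ):ℤ) + 2^j + (((y.val / P : ℕ):ℤ) - x.val) ≤ 2^j + ((y.val / P : ℕ):ℤ) := by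
      linarith [xj.1]
    refine (mul_le_mul_of_nonneg_right e1 P0.le).trans ?_
    have e2 : (2:ℤ)^j * P ≤ 4^S * 2^M := mul_le_mul jS PM P0.le (by positivity)
    have e3 : (2:ℤ)^M * (lb M y + 1) ≤ 2^M * (3 * 4^S) := mul_le_mul_of_nonneg_left z2 (by positivity)
    have e4 : (0:ℤ) ≤ 2^M * 4^S := by positivity
    rw [hTM]
    linarith

set_option maxHeartbeats 1000000 in
open Classical in
lemma half_grid {n : ℕ} {C : ℝ} {M S T : ℕ} (hS : S = M + 6) (hT : T = M + 2*S + 3)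
    (hC : ∀ (P : ℕ → ℕ) (hP : ∀ k < M, 2^k ≤ P k ∧ P k < 2^(k+1)) (π : ℕ → Fn T → ℕ)
      (hπ : ∀ l z w, π l z = π l w → π (l+1) z = π (l+1) w) (hπq : ∀ l z w, lb M z = lb M w → π l z = π l w)
      (L : ℕ) (f : Kn T) (hf : ∀ x y, 0 ≤ f x y) (bad : Fn T → Fn T → Prop)
      (hbad : ∀ x y, bad x y → ∃ k < M, ∃ j < T, adm T (P k) j (rho (P k) j (x, y)) ∧
        ∃ l < L, 1 < La (P k) j (A2 (π l) f) x y),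
      (∑ x, ∑ y, if bad x y then (1:ℝ) else 0) ≤ C * ∑ x, ∑ y, f x y ^ (((n:ℝ)+2)/(n+1)))
    (v : ℕ → ℝ) (hv : ∀ m, (1/2:ℝ)^(m+1) ≤ v m ∧ v m < (1/2:ℝ)^m)
    (φ : ℤ × ℤ → ℝ) (hφ : ∀ z, 0 ≤ φ z) (W Z : Finset (ℤ × ℤ))
    (hW : ∀ z ∈ W, |z.1| < 2^M ∧ |z.2| < 2^M) (hZ : ∀ z ∈ Z, |z.1| < 2^M ∧ |z.2| < 2^M)
    (hW0 : ∀ z ∉ W, φ z = 0) (s : ℕ) (hs : s ≤ 4^S)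
    (hbad : ∀ z ∈ Z, ∃ m a b : ℕ, m < M ∧ 0 < a ∧ 0 < b ∧ a ≤ 2^M ∧ b ≤ 2^M ∧
      (∀ x : ℤ, |x - (z.1 + 2 * 4^S)| ≤ a → (x + s) / 2 ^ Nat.clog 2 (8*a) = (z.1 + 2 * 4^S + s) / 2 ^ Nat.clog 2 (8*a)) ∧
      2048 * (a:ℝ) * b < ∑ w ∈ W, if |w.1 - z.1| ≤ a ∧ |((w.2:ℝ) - z.2) - v m * ((w.1:ℝ) - z.1)| ≤ b then φ w else 0) :
    (Z.card : ℝ) ≤ 2 * C * ∑ w ∈ W, φ w ^ (((n:ℝ)+2)/(n+1)) := by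
  have h2 : (2:ℤ)^M ≤ 4^S := by
    calc (2:ℤ)^M ≤ 2^S := pow_le_pow_right₀ (by norm_num) (by omega)
      _ ≤ 4^S := pow_le_pow_left₀ (by norm_num) (by norm_num) _
  have h4 : (4:ℤ)^S = 2^(2*S) := by rw [pow_mul]; norm_num
  have hs' : (s:ℤ) ≤ 4^S := by exact_mod_cast hs
  have hTM : (2:ℤ)^T = 2^M * (8 * 4^S) := by rw [hT, h4, pow_add, pow_add]; ring
  have M1 : (1:ℤ) ≤ 2^M := one_le_pow₀ (by norm_num)
  have hqT : M ≤ T := by omega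
  set o : ℤ := 2 * 4^S with ho
  have T8 : 8 * (4:ℤ)^S ≤ 2^T := by rw [hTM]; nlinarith
  have rng : ∀ w : ℤ × ℤ, |w.1| < 2^M ∧ |w.2| < 2^M →
      0 ≤ w.1 + o + s ∧ w.1 + o + s < 2^T ∧ 0 ≤ w.2 + o ∧ (w.2 + o + 1) * 2^M ≤ 2^T := by
    rintro w ⟨w1, w2⟩
    rw [abs_lt] at w1 w2
    refine ⟨by omega, by omega, by omega, ?_⟩
    rw [hTM]; nlinarith
  have hpne : ((n:ℝ)+2)/(n+1) ≠ 0 := by positivity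
  set f : Kn T := fun x y => φ ((x.val:ℤ) - o - s, (lb M y:ℤ) - o) with hf
  have f0 : ∀ x y, 0 ≤ f x y := fun x y => hφ _
  have fs : ∑ x, ∑ y, f x y ^ (((n:ℝ)+2)/(n+1)) = 2^M * ∑ w ∈ W, φ w ^ (((n:ℝ)+2)/(n+1)) := by
    rw [← fib hqT o s W (fun w hw => rng w (hW w hw)) (fun w => φ w ^ (((n:ℝ)+2)/(n+1)))]
    refine sum_congr rfl fun x _ => sum_congr rfl fun y _ => ?_
    split_ifs with h
    · rfl
    · rw [hf]; simp only; rw [hW0 _ h, Real.zero_rpow hpne]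
  set P : ℕ → ℕ := fun k => ⌊v (M - 1 - k) * 2^M⌋₊ with hPd
  have hv0 : ∀ m, 0 < v m := fun m => lt_of_lt_of_le (by positivity) (hv m).1
  have hPv : ∀ m, (⌊v m * 2^M⌋₊ : ℝ) ≤ v m * 2^M ∧ v m * 2^M < ⌊v m * 2^M⌋₊ + 1 := fun m =>
    ⟨Nat.floor_le (mul_nonneg (hv0 m).le (by positivity)), Nat.lt_floor_add_one _⟩
  have hP : ∀ k < M, 2^k ≤ P k ∧ P k < 2^(k+1) := by
    intro k hk
    obtain ⟨g1, g2⟩ := hv (M - 1 - k)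
    have p0 : (0:ℝ) < 2^M := by positivity
    have q1 : (1/2:ℝ)^(M-1-k+1) * 2^M = 2^k := by
      obtain ⟨r, hr⟩ : ∃ r, M = r + 1 + k := ⟨M - 1 - k, by omega⟩
      rw [show M - 1 - k + 1 = r + 1 by omega, hr, pow_add _ (r+1) k, ← mul_assoc, ← mul_pow]; norm_num
    have q2 : (1/2:ℝ)^(M-1-k) * 2^M = 2^(k+1) := by
      rw [pow_succ] at q1 ⊢; rw [← q1]; ring
    constructor
    · refine Nat.le_floor ?_
      push_cast
      rw [← q1]; exact mul_le_mul_of_nonneg_right g1 p0.le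
    · rw [hPd, Nat.floor_lt (mul_nonneg (hv0 _).le p0.le)]
      push_cast
      rw [← q2]; exact mul_lt_mul_of_pos_right g2 p0
  obtain ⟨bd, hbd⟩ : ∃ bd : ℕ → Fn T → Fn T → Prop, bd = fun t x y => ∃ k < M, ∃ j < T, adm T (P k) j (rho (P k) j (x, y)) ∧
        ∃ l < 2*S+1, 1 < La (P k) j (A2 (pl t M l) f) x y := ⟨_, rfl⟩
  have hcount : ∀ t, (∑ x, ∑ y, if bd t x y then (1:ℝ) else 0) ≤ C * (2^M * ∑ w ∈ W, φ w ^ (((n:ℝ)+2)/(n+1))) := by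
    intro t
    rw [← fs]
    refine hC P hP (pl t M) ?_ ?_ (2*S+1) f f0 (bd t) (fun x y h => by rw [hbd] at h; exact h)
    · intro l z w h
      simp only [pl, pow_succ, ← Nat.div_div_eq_div_mul] at h ⊢
      rw [h]
    · intro l z w h; simp only [pl, h]
  have hcov : ∀ x y : Fn T, (if ((x.val:ℤ) - o - s, (lb M y:ℤ) - o) ∈ Z then (1:ℝ) else 0) ≤
      (if bd 0 x y then (1:ℝ) else 0) + (if bd (sig S) x y then (1:ℝ) else 0) := by
    intro x y
    by_cases hz : ((x.val:ℤ) - o - s, (lb M y:ℤ) - o) ∈ Z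
    swap
    · rw [if_neg hz]; split_ifs <;> norm_num
    suffices h : bd 0 x y ∨ bd (sig S) x y by
      rw [if_pos hz]
      rcases h with h | h <;> rw [if_pos h] <;> split_ifs <;> norm_num
    obtain ⟨m, a, b, hm, a0, b0, aM, bM, hx, hbig⟩ := hbad _ hz
    obtain ⟨zr1, zr2⟩ := hZ _ hz
    obtain ⟨r1, r2, r3, r4⟩ := rng _ (hZ _ hz)
    simp only [sub_add_cancel] at *
    obtain ⟨j1, j2⟩ := clog_bd a0
    obtain ⟨l1, l2⟩ := clog_bd (a := 4*b) (by omega)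
    set j := Nat.clog 2 (8*a) with hj
    set l := Nat.clog 2 (8*(4*b)) with hl
    have jb : j ≤ M + 4 := by
      rw [← Nat.pow_le_pow_iff_right (a := 2) (by norm_num), pow_add]; omega
    have lb' : l ≤ M + 6 := by
      rw [← Nat.pow_le_pow_iff_right (a := 2) (by norm_num), pow_add]; omega
    set k := M - 1 - m with hk
    have hkM : k < M := by omega
    have hmk : M - 1 - k = m := by omega
    have hPk : P k = ⌊v m * 2^M⌋₊ := by rw [hPd]; simp only [hmk]
    obtain ⟨pk1, pk2⟩ := hP k hkM
    have pkM : P k ≤ 2^M := pk2.le.trans (Nat.pow_le_pow_right (by norm_num) (by omega))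
    have pk0 : 0 < P k := lt_of_lt_of_le (by positivity) pk1
    have hadm : adm T (P k) j (rho (P k) j (x, y)) := by
      refine adm_of pk0 pkM (j := j) (S := S) ?_ hTM x y ?_ ?_
      · rw [h4]; exact pow_le_pow_right₀ (by norm_num) (by omega)
      · rw [abs_lt] at zr2; omega
      · rw [abs_lt] at zr2; omega
    have hxv : ∀ x'' : ℤ, |x'' - x.val| ≤ a → x'' / 2^j = (x.val:ℤ) / 2^j := by
      intro x'' hx''
      have := hx (x'' - s) (by rw [show x'' - s - ((x.val:ℤ) - o - s + o) = x'' - x.val by ring]; exact hx'')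
      rw [show x'' - s + (s:ℤ) = x'' by ring, show (x.val:ℤ) - o - s + o + s = x.val by ring] at this
      exact this
    have main := par_pt (S := S) (q := M) (P := P k) (j := j) (l := l) (a := a) (b := b) (u := v m) pk0 pkM
      (by omega) (by omega) (by omega) aM (by rw [hPk]; exact (hPv m).1) (by rw [hPk]; exact (hPv m).2) f0 x y hadm hxv
    have hfb := fib hqT o s W (fun w hw => rng w (hW w hw)) (fun w => if |w.1 - ((x.val:ℤ) - o - s)| ≤ a ∧
      |((w.2:ℝ) - ((lb M y:ℤ) - o : ℤ)) - v m * ((w.1:ℝ) - ((x.val:ℤ) - o - s : ℤ))| ≤ b then φ w else 0)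
    have hle : (2:ℝ)^M * (∑ w ∈ W, if |w.1 - ((x.val:ℤ) - o - s)| ≤ a ∧
      |((w.2:ℝ) - ((lb M y:ℤ) - o : ℤ)) - v m * ((w.1:ℝ) - ((x.val:ℤ) - o - s : ℤ))| ≤ b then φ w else 0) ≤
      2^(M+l) * 2^j * (La (P k) j (A2 (pl 0 M l) f) x y + La (P k) j (A2 (pl (sig S) M l) f) x y) := by
      rw [← hfb]
      refine le_trans (sum_le_sum fun x' _ => sum_le_sum fun y' _ => ?_) main
      by_cases hw : ((x'.val:ℤ) - o - s, (lb M y':ℤ) - o) ∈ W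
      · rw [if_pos hw]
        refine le_of_eq (if_congr ?_ rfl rfl)
        refine and_congr ?_ ?_
        · rw [show (x'.val:ℤ) - o - s - ((x.val:ℤ) - o - s) = x'.val - x.val by ring]
        · push_cast
          rw [show (lb M y':ℝ) - o - (lb M y - o) = lb M y' - lb M y by ring,
            show (x'.val:ℝ) - o - s - ((x.val:ℝ) - o - s) = x'.val - x.val by ring]
      · rw [if_neg hw]; split_ifs <;> simp [f0]
    by_contra hcon
    push Not at hcon
    have hno : ∀ t, ¬ bd t x y → La (P k) j (A2 (pl t M l) f) x y ≤ 1 := by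
      intro t ht
      by_contra h
      push Not at h
      rw [hbd] at ht
      exact ht ⟨k, hkM, j, by omega, hadm, l, by omega, h⟩
    have n1 := hno _ hcon.1
    have n2 := hno _ hcon.2
    have hpM : (0:ℝ) < 2^M := by positivity
    have j2' : (2:ℝ)^j ≤ 16 * a := by exact_mod_cast j2
    have l2' : (2:ℝ)^l ≤ 16 * (4 * b) := by exact_mod_cast l2
    have hjl : (2:ℝ)^l * 2^j ≤ 16 * (4 * b) * (16 * a) := mul_le_mul l2' j2' (by positivity) (by positivity)
    have hle2 : (2:ℝ)^(M+l) * 2^j * (La (P k) j (A2 (pl 0 M l) f) x y + La (P k) j (A2 (pl (sig S) M l) f) x y) ≤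
        2^M * (2048 * a * b) := by
      calc _ ≤ (2:ℝ)^(M+l) * 2^j * 2 := mul_le_mul_of_nonneg_left (by linarith) (by positivity)
        _ = 2^M * (2^l * 2^j * 2) := by rw [pow_add]; ring
        _ ≤ _ := mul_le_mul_of_nonneg_left (by linarith) hpM.le
    have := le_of_mul_le_mul_left (hle.trans hle2) hpM
    exact absurd hbig (not_lt.2 this)
  have hZc : (2:ℝ)^M * Z.card ≤ 2^M * (2 * C * ∑ w ∈ W, φ w ^ (((n:ℝ)+2)/(n+1))) := by
    have := fib hqT o s Z (fun w hw => rng w (hZ w hw)) (fun _ => (1:ℝ))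
    rw [Finset.sum_const, nsmul_eq_mul, mul_one] at this
    rw [← this]
    calc _ ≤ ∑ x, ∑ y, ((if bd 0 x y then (1:ℝ) else 0) + (if bd (sig S) x y then (1:ℝ) else 0)) :=
          sum_le_sum fun x _ => sum_le_sum fun y _ => by convert hcov x y
      _ = (∑ x, ∑ y, if bd 0 x y then (1:ℝ) else 0) + ∑ x, ∑ y, (if bd (sig S) x y then (1:ℝ) else 0) := by
          simp only [sum_add_distrib]
      _ ≤ _ := (add_le_add (hcount _) (hcount _)).trans (le_of_eq (by ring))
  exact le_of_mul_le_mul_left hZc (by positivity)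

open Classical in
lemma DM (n : ℕ) (hQ : QQ (n+2)) : ∃ C : ℝ, 0 ≤ C ∧ ∀ (v : ℕ → ℝ) (hv : ∀ m, (1/2:ℝ)^(m+1) ≤ v m ∧ v m < (1/2:ℝ)^m)
    (φ : ℤ × ℤ → ℝ) (hφ : ∀ z, 0 ≤ φ z) (W Z : Finset (ℤ × ℤ)) (hW0 : ∀ z ∉ W, φ z = 0) (I : Finset (ℕ × ℕ × ℕ))
    (hI : ∀ i ∈ I, 0 < i.2.1 ∧ 0 < i.2.2)
    (hbad : ∀ z ∈ Z, ∃ i ∈ I, 2048 * (i.2.1:ℝ) * i.2.2 <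
      ∑ w ∈ W, if |w.1 - z.1| ≤ i.2.1 ∧ |((w.2:ℝ) - z.2) - v i.1 * ((w.1:ℝ) - z.1)| ≤ i.2.2 then φ w else 0),
    (Z.card : ℝ) ≤ C * ∑ w ∈ W, φ w ^ (((n:ℝ)+2)/(n+1)) := by
  obtain ⟨C, C0, hC⟩ := WT n hQ
  refine ⟨4 * C, by positivity, ?_⟩
  intro v hv φ hφ W Z hW0 I hI hbad
  obtain ⟨M1, hM1⟩ := (W.image (fun z => z.1.natAbs + z.2.natAbs)).exists_le
  obtain ⟨M2, hM2⟩ := (Z.image (fun z => z.1.natAbs + z.2.natAbs)).exists_le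
  obtain ⟨M3, hM3⟩ := (I.image (fun i => i.1 + i.2.1 + i.2.2)).exists_le
  set M := M1 + M2 + M3 + 1 with hM
  have hM2' : M < 2^M := Nat.lt_two_pow_self
  have bdd : ∀ z : ℤ × ℤ, z.1.natAbs + z.2.natAbs ≤ M → |z.1| < 2^M ∧ |z.2| < 2^M := by
    intro z hz
    have : (M:ℤ) < 2^M := by exact_mod_cast hM2'
    constructor <;> rw [Int.abs_eq_natAbs] <;> omega
  have hW : ∀ z ∈ W, |z.1| < 2^M ∧ |z.2| < 2^M := fun z hz =>
    bdd z ((hM1 _ (Finset.mem_image_of_mem _ hz)).trans (by omega))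
  have hZ : ∀ z ∈ Z, |z.1| < 2^M ∧ |z.2| < 2^M := fun z hz =>
    bdd z ((hM2 _ (Finset.mem_image_of_mem _ hz)).trans (by omega))
  choose! it hit hbig using hbad
  have hitb : ∀ z ∈ Z, (it z).1 + (it z).2.1 + (it z).2.2 ≤ M3 := fun z hz => hM3 _ (Finset.mem_image_of_mem _ (hit z hz))
  set S := M + 6 with hS
  set T := M + 2*S + 3 with hT
  set c : ℕ → ℤ × ℤ → Prop := fun s z => ∀ x : ℤ, |x - (z.1 + 2 * 4^S)| ≤ (it z).2.1 →
    (x + s) / 2 ^ Nat.clog 2 (8*(it z).2.1) = (z.1 + 2 * 4^S + s) / 2 ^ Nat.clog 2 (8*(it z).2.1) with hc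
  have hcs : ∀ z ∈ Z, c 0 z ∨ c (sig S) z := by
    intro z hz
    have b := hitb z hz
    obtain ⟨j1, j2⟩ := clog_bd (hI _ (hit z hz)).1
    have jb : Nat.clog 2 (8*(it z).2.1) ≤ M + 4 := by
      rw [← Nat.pow_le_pow_iff_right (a := 2) (by norm_num), pow_add]; omega
    have := twogrid (S := S) (l := Nat.clog 2 (8*(it z).2.1)) (by omega) (hI _ (hit z hz)).1 j1 (z.1 + 2 * 4^S)
    rcases this with h | h
    · left; simpa [hc] using h
    · right; exact h
  have hh : ∀ s ≤ 4^S, ((Z.filter (c s)).card : ℝ) ≤ 2 * C * ∑ w ∈ W, φ w ^ (((n:ℝ)+2)/(n+1)) := by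
    intro s hs
    refine half_grid (T := T) hS hT (fun P hP π hπ hπq L f hf bad hb => ?_) v hv φ hφ W (Z.filter (c s)) hW
      (fun z hz => hZ z (Finset.mem_filter.1 hz).1) hW0 s hs (fun z hz => ?_)
    · exact hC T M (by omega) P hP π hπ hπq L f hf bad hb
    · obtain ⟨h1, h2⟩ := Finset.mem_filter.1 hz
      have b := hitb z h1
      have b' := hI _ (hit z h1)
      exact ⟨(it z).1, (it z).2.1, (it z).2.2, by omega, b'.1, b'.2, by omega, by omega, h2, hbig z h1⟩
  have hU : Z.card ≤ (Z.filter (c 0)).card + (Z.filter (c (sig S))).card := by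
    refine le_trans (Finset.card_le_card fun z hz => ?_) (Finset.card_union_le _ _)
    rw [Finset.mem_union, mem_filter, mem_filter]
    rcases hcs z hz with h | h
    · exact Or.inl ⟨hz, h⟩
    · exact Or.inr ⟨hz, h⟩
  have s1 := hh 0 (Nat.zero_le _)
  have s2 := hh (sig S) (by have := sig_eq S; omega)
  have : (Z.card:ℝ) ≤ (Z.filter (c 0)).card + (Z.filter (c (sig S))).card := by exact_mod_cast hU
  linarith
end p10b

section p11

lemma nf_aux {c s L1 L2 k1 k2 u : ℝ} (hc : 0 < c) (hsc : s = u * c) (h1 : c^2 + s^2 = 1) (p : ℝ × ℝ) :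
    (∃ x y : ℝ, x ∈ Icc (0:ℝ) L1 ∧ y ∈ Icc (0:ℝ) L2 ∧ p.1 = k1 + x * c - y * s ∧ p.2 = k2 + x * s + y * c) ↔
    ((k1 + u * k2 ≤ p.1 + u * p.2 ∧ p.1 + u * p.2 ≤ k1 + u * k2 + L1 / c) ∧
      (k2 - u * k1 ≤ p.2 - u * p.1 ∧ p.2 - u * p.1 ≤ k2 - u * k1 + L2 / c)) := by
  subst hsc
  have hcu : c * (1 + u^2) = 1 / c := by field_simp; nlinarith
  constructor
  · rintro ⟨x, y, ⟨hx0, hx1⟩, ⟨hy0, hy1⟩, e1, e2⟩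
    have f1 : p.1 + u * p.2 = k1 + u * k2 + x / c := by
      rw [e1, e2]; linear_combination x * hcu
    have f2 : p.2 - u * p.1 = k2 - u * k1 + y / c := by
      rw [e1, e2]; linear_combination y * hcu
    rw [f1, f2]
    have g1 := div_le_div_of_nonneg_right hx1 hc.le
    have g2 := div_le_div_of_nonneg_right hy1 hc.le
    have g3 : 0 ≤ x / c := by positivity
    have g4 : 0 ≤ y / c := by positivity
    refine ⟨⟨?_, ?_⟩, ?_, ?_⟩ <;> linarith
  · rintro ⟨⟨a1, a2⟩, b1, b2⟩
    refine ⟨c * (p.1 + u * p.2 - (k1 + u * k2)), c * (p.2 - u * p.1 - (k2 - u * k1)),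
      ⟨mul_nonneg hc.le (by linarith), ?_⟩, ⟨mul_nonneg hc.le (by linarith), ?_⟩, ?_, ?_⟩
    · rw [← le_div_iff₀' hc]; linarith
    · rw [← le_div_iff₀' hc]; linarith
    · linear_combination (-(p.1 - k1)) * h1
    · linear_combination (-(p.2 - k2)) * h1

lemma nf (R : Rect) {u : ℝ} (hu : u ∈ Ioo (0:ℝ) 1) (hs : R.slope = u) :
    ∃ A B L1 L2 : ℝ, R.shortSide ≤ L2 ∧ L2 ≤ L1 ∧ ∀ p : ℝ × ℝ, p ∈ R.carrier ↔
      ((A ≤ p.1 + u * p.2 ∧ p.1 + u * p.2 ≤ A + L1) ∧ (B ≤ p.2 - u * p.1 ∧ p.2 - u * p.1 ≤ B + L2)) := by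
  obtain ⟨⟨k1, k2⟩, θ, l1, l2, h1, h2⟩ := R
  simp only [Rect.slope, Rect.shortSide, Rect.carrier] at *
  have key : ∀ (c s m1 m2 K1 K2 : ℝ), 0 < c → s = u * c → c^2 + s^2 = 1 → 0 < m2 → m2 ≤ m1 →
      (∀ p : ℝ × ℝ, p ∈ {p : ℝ × ℝ | ∃ s t : ℝ, s ∈ Icc (0 : ℝ) l1 ∧ t ∈ Icc (0 : ℝ) l2 ∧
        p = (k1, k2) + s • (Real.cos θ, Real.sin θ) + t • (-Real.sin θ, Real.cos θ)} ↔
        ∃ x y : ℝ, x ∈ Icc (0:ℝ) m1 ∧ y ∈ Icc (0:ℝ) m2 ∧ p.1 = K1 + x * c - y * s ∧ p.2 = K2 + x * s + y * c) →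
      min l1 l2 ≤ m2 →
      ∃ A B L1 L2 : ℝ, min l1 l2 ≤ L2 ∧ L2 ≤ L1 ∧ ∀ p : ℝ × ℝ,
        p ∈ {p : ℝ × ℝ | ∃ s t : ℝ, s ∈ Icc (0 : ℝ) l1 ∧ t ∈ Icc (0 : ℝ) l2 ∧
        p = (k1, k2) + s • (Real.cos θ, Real.sin θ) + t • (-Real.sin θ, Real.cos θ)} ↔
      ((A ≤ p.1 + u * p.2 ∧ p.1 + u * p.2 ≤ A + L1) ∧ (B ≤ p.2 - u * p.1 ∧ p.2 - u * p.1 ≤ B + L2)) := by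
    intro c s m1 m2 K1 K2 hc hsc hcs hm0 hm hiff hmin
    refine ⟨K1 + u * K2, K2 - u * K1, m1 / c, m2 / c, hmin.trans ?_, div_le_div_of_nonneg_right hm hc.le, fun p => ?_⟩
    · rw [le_div_iff₀ hc]
      nlinarith [sq_nonneg s]
    · rw [hiff, nf_aux hc hsc hcs]
  have ext2 : ∀ p : ℝ × ℝ, ∀ s t : ℝ, p = (k1, k2) + s • (Real.cos θ, Real.sin θ) + t • (-Real.sin θ, Real.cos θ) ↔
      p.1 = k1 + s * Real.cos θ - t * Real.sin θ ∧ p.2 = k2 + s * Real.sin θ + t * Real.cos θ := by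
    intro p s t
    rw [Prod.ext_iff]
    simp only [Prod.fst_add, Prod.snd_add, Prod.smul_fst, Prod.smul_snd, smul_eq_mul]
    constructor <;> rintro ⟨a, b⟩ <;> constructor <;> linarith
  have sc := Real.sin_sq_add_cos_sq θ
  split_ifs at hs with h
  · have hc0 : Real.cos θ ≠ 0 := by
      intro h0; rw [Real.tan_eq_sin_div_cos, h0, div_zero] at hs; linarith [hu.1]
    have hsc : Real.sin θ = u * Real.cos θ := by rw [← hs, Real.tan_eq_sin_div_cos]; field_simp
    rcases lt_or_gt_of_ne hc0 with hn | hp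
    · refine key (-Real.cos θ) (-Real.sin θ) l1 l2 (k1 + l1 * Real.cos θ - l2 * Real.sin θ)
        (k2 + l1 * Real.sin θ + l2 * Real.cos θ) (by linarith) (by linarith) (by nlinarith) h2 h (fun p => ?_) (min_le_right _ _)
      constructor
      · rintro ⟨x, y, ⟨x0, x1⟩, ⟨y0, y1⟩, e⟩
        obtain ⟨e1, e2⟩ := (ext2 _ _ _).1 e
        refine ⟨l1 - x, l2 - y, ⟨by linarith, by linarith⟩, ⟨by linarith, by linarith⟩, ?_, ?_⟩
        · rw [e1]; ring
        · rw [e2]; ring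
      · rintro ⟨x, y, ⟨x0, x1⟩, ⟨y0, y1⟩, e1, e2⟩
        refine ⟨l1 - x, l2 - y, ⟨by linarith, by linarith⟩, ⟨by linarith, by linarith⟩, (ext2 _ _ _).2 ⟨?_, ?_⟩⟩
        · rw [e1]; ring
        · rw [e2]; ring
    · refine key (Real.cos θ) (Real.sin θ) l1 l2 k1 k2 hp hsc (by linarith) h2 h (fun p => ?_) (min_le_right _ _)
      simp only [Set.mem_ofPred_eq, ext2]
  · push Not at h
    rw [Real.tan_eq_sin_div_cos, Real.sin_add_pi_div_two, Real.cos_add_pi_div_two] at hs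
    have hc0 : Real.sin θ ≠ 0 := by
      intro h0; rw [h0, neg_zero, div_zero] at hs; linarith [hu.1]
    have hsc : Real.cos θ = u * (-Real.sin θ) := by rw [← hs]; field_simp
    rcases lt_or_gt_of_ne hc0 with hn | hp
    · refine key (-Real.sin θ) (Real.cos θ) l2 l1 (k1 + l1 * Real.cos θ)
        (k2 + l1 * Real.sin θ) (by linarith) hsc (by nlinarith) h1 h.le (fun p => ?_) (min_le_left _ _)
      constructor
      · rintro ⟨x, y, ⟨x0, x1⟩, ⟨y0, y1⟩, e⟩
        obtain ⟨e1, e2⟩ := (ext2 _ _ _).1 e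
        refine ⟨y, l1 - x, ⟨by linarith, by linarith⟩, ⟨by linarith, by linarith⟩, ?_, ?_⟩
        · rw [e1]; ring
        · rw [e2]; ring
      · rintro ⟨x, y, ⟨x0, x1⟩, ⟨y0, y1⟩, e1, e2⟩
        refine ⟨l1 - y, x, ⟨by linarith, by linarith⟩, ⟨by linarith, by linarith⟩, (ext2 _ _ _).2 ⟨?_, ?_⟩⟩
        · rw [e1]; ring
        · rw [e2]; ring
    · refine key (Real.sin θ) (-Real.cos θ) l2 l1 (k1 - l2 * Real.sin θ)
        (k2 + l2 * Real.cos θ) hp (by linarith) (by nlinarith) h1 h.le (fun p => ?_) (min_le_left _ _)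
      constructor
      · rintro ⟨x, y, ⟨x0, x1⟩, ⟨y0, y1⟩, e⟩
        obtain ⟨e1, e2⟩ := (ext2 _ _ _).1 e
        refine ⟨l2 - y, x, ⟨by linarith, by linarith⟩, ⟨by linarith, by linarith⟩, ?_, ?_⟩
        · rw [e1]; ring
        · rw [e2]; ring
      · rintro ⟨x, y, ⟨x0, x1⟩, ⟨y0, y1⟩, e1, e2⟩
        refine ⟨y, l2 - x, ⟨by linarith, by linarith⟩, ⟨by linarith, by linarith⟩, (ext2 _ _ _).2 ⟨?_, ?_⟩⟩
        · rw [e1]; ring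
        · rw [e2]; ring

lemma mem_aux {u α β L1 L2 : ℝ} (u0 : 0 < u) (u1 : u < 1) (ha : |α| ≤ L1/8) (hb : |β| ≤ L2/4) (hL : L2 ≤ L1) :
    |(1 + u^2) * α + u * β| ≤ L1/2 := by
  refine (abs_add_le _ _).trans ?_
  rw [abs_mul, abs_mul, abs_of_pos u0, abs_of_pos (by positivity)]
  have h1 : (1 + u^2) * |α| ≤ 2 * |α| := mul_le_mul_of_nonneg_right (by nlinarith) (abs_nonneg _)
  have h2 : u * |β| ≤ 1 * |β| := mul_le_mul_of_nonneg_right u1.le (abs_nonneg _)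
  linarith

set_option maxHeartbeats 1000000 in
lemma geom (R : Rect) (h0 : ((0:ℝ), (0:ℝ)) ∈ R.carrier) {u : ℝ} (hu : u ∈ Ioo (0:ℝ) 1) (hs : R.slope = u)
    (hl : 10 ≤ R.shortSide) :
    ∃ (G : Finset (ℤ × ℤ)) (a b : ℕ), latticePts R.carrier = ↑G ∧ 0 < a ∧ 0 < b ∧ R.shortSide ≤ b ∧
      (∀ z ∈ G, |z.1| ≤ a ∧ |(z.2:ℝ) - u * z.1| ≤ b) ∧ (a:ℝ) * b ≤ 100 * G.card ∧
      ∀ i j1 j2 j : ℤ, (i, j1) ∈ G → (i, j2) ∈ G → j1 ≤ j → j ≤ j2 → (i, j) ∈ G := by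
  obtain ⟨A, B, L1, L2, hL2, hL, hiff⟩ := nf R hu hs
  obtain ⟨u0, u1⟩ := hu
  have hz := (hiff _).1 h0
  simp only [mul_zero, add_zero, sub_zero] at hz
  obtain ⟨⟨z1, z2⟩, z3, z4⟩ := hz
  set a := ⌈2 * L1⌉₊ with ha
  set b := ⌈L2⌉₊ with hb
  have a1 : 2 * L1 ≤ a := Nat.le_ceil _
  have a2 : (a:ℝ) < 2 * L1 + 1 := Nat.ceil_lt_add_one (by linarith)
  have b1 : L2 ≤ b := Nat.le_ceil _
  have b2 : (b:ℝ) < L2 + 1 := Nat.ceil_lt_add_one (by linarith)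
  have hsub : ∀ z ∈ latticePts R.carrier, |z.1| ≤ a ∧ |(z.2:ℝ) - u * z.1| ≤ b := by
    intro z hz
    have := (hiff _).1 hz
    simp only at this
    obtain ⟨⟨y1, y2⟩, y3, y4⟩ := this
    have f2 : |(z.2:ℝ) - u * z.1| ≤ L2 := by rw [abs_le]; constructor <;> linarith
    refine ⟨?_, f2.trans b1⟩
    have f1 : |(z.1:ℝ) + u * z.2| ≤ L1 := by rw [abs_le]; constructor <;> linarith
    have f3 : |(z.1:ℝ)| ≤ a := by
      have e : (1 + u^2) * (z.1:ℝ) = (z.1 + u * z.2) - u * (z.2 - u * z.1) := by ring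
      have e' : |(1 + u^2) * (z.1:ℝ)| ≤ 2 * L1 := by
        rw [e]
        refine (abs_sub _ _).trans ?_
        rw [abs_mul, abs_of_pos u0]
        nlinarith [abs_nonneg ((z.2:ℝ) - u * z.1)]
      rw [abs_mul, abs_of_pos (by positivity)] at e'
      nlinarith [abs_nonneg (z.1:ℝ), mul_nonneg (sq_nonneg u) (abs_nonneg (z.1:ℝ))]
    exact_mod_cast f3
  have hfin : (latticePts R.carrier).Finite := by
    refine (Set.finite_Icc ((-(a:ℤ), -(a+b:ℤ)) : ℤ × ℤ) ((a:ℤ), (a+b:ℤ))).subset fun z hz => ?_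
    obtain ⟨y1, y2⟩ := hsub z hz
    have y3 : |(z.2:ℝ)| ≤ a + b := by
      have e : (z.2:ℝ) = (z.2 - u * z.1) + u * z.1 := by ring
      have y1' : |(z.1:ℝ)| ≤ a := by exact_mod_cast y1
      rw [e]
      refine (abs_add_le _ _).trans ?_
      rw [abs_mul, abs_of_pos u0]
      nlinarith [abs_nonneg (z.1:ℝ)]
    have y4 : |z.2| ≤ (a + b : ℤ) := by exact_mod_cast y3
    rw [abs_le] at y1 y4
    exact ⟨⟨y1.1, y4.1⟩, ⟨y1.2, y4.2⟩⟩
  have hco : latticePts R.carrier = ↑hfin.toFinset := (hfin.coe_toFinset).symm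
  have hmem : ∀ z, z ∈ hfin.toFinset ↔ ((z.1:ℝ), (z.2:ℝ)) ∈ R.carrier := fun z => hfin.mem_toFinset
  refine ⟨hfin.toFinset, a, b, hco, Nat.ceil_pos.2 (by linarith), Nat.ceil_pos.2 (by linarith), hL2.trans b1,
    fun z hz => hsub z (hfin.mem_toFinset.1 hz), ?_, ?_⟩
  · set y0 : ℝ := (B + L2/2 + u * (A + L1/2)) / (1 + u^2) with hy0
    set x0 : ℝ := (A + L1/2 - u * (B + L2/2)) / (1 + u^2) with hx0
    have c1 : x0 + u * y0 = A + L1/2 := by rw [hx0, hy0]; field_simp; ring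
    have c2 : y0 - u * x0 = B + L2/2 := by rw [hx0, hy0]; field_simp; ring
    set K1 := ⌊L1/4⌋₊ with hK1
    set K2 := ⌊L2/2⌋₊ with hK2
    have k1 : L1/4 < K1 + 1 := Nat.lt_floor_add_one _
    have k2 : L2/2 < K2 + 1 := Nat.lt_floor_add_one _
    have k1' : (K1:ℝ) ≤ L1/4 := Nat.floor_le (by linarith)
    have k2' : (K2:ℝ) ≤ L2/2 := Nat.floor_le (by linarith)
    set i : ℕ → ℤ := fun s => ⌈x0 - L1/8⌉ + s with hi
    have hcard : K1 * K2 ≤ hfin.toFinset.card := by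
      rw [← Finset.card_range K1, ← Finset.card_range K2, ← Finset.card_product]
      refine Finset.card_le_card_of_injOn (fun s => (i s.1, ⌈y0 + u * (i s.1 - x0) - L2/4⌉ + (s.2:ℤ))) ?_ ?_
      · rintro ⟨s, t⟩ hst
        rw [Finset.mem_coe, Finset.mem_product, Finset.mem_range, Finset.mem_range] at hst
        rw [Finset.mem_coe, hmem, hiff]
        simp only at hst ⊢
        have s1 : (s:ℝ) + 1 ≤ K1 := by exact_mod_cast hst.1
        have t1 : (t:ℝ) + 1 ≤ K2 := by exact_mod_cast hst.2
        have s0 : (0:ℝ) ≤ s := by positivity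
        have t0 : (0:ℝ) ≤ t := by positivity
        have al1 : -(L1/8) ≤ (i s:ℝ) - x0 := by
          have := Int.le_ceil (x0 - L1/8); simp only [hi]; push_cast; linarith
        have al2 : (i s:ℝ) - x0 ≤ L1/8 := by
          have := Int.ceil_lt_add_one (x0 - L1/8); simp only [hi]; push_cast; linarith
        set α : ℝ := (i s:ℝ) - x0 with hα
        have be1 := Int.le_ceil (y0 + u * α - L2/4)
        have be2 := Int.ceil_lt_add_one (y0 + u * α - L2/4)
        push_cast
        set w : ℝ := (⌈y0 + u * α - L2/4⌉:ℝ) + t with hw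
        have w1 : -(L2/4) ≤ w - y0 - u * α := by linarith
        have w2 : w - y0 - u * α ≤ L2/4 := by linarith
        set β := w - y0 - u * α with hβ
        have d1 : w - u * i s = B + L2/2 + β := by rw [hβ, hα]; linear_combination c2
        have d2 : i s + u * w = A + L1/2 + (1 + u^2) * α + u * β := by rw [hβ, hα]; linear_combination c1
        rw [d1, d2]
        have q := abs_le.1 (mem_aux (L1 := L1) (L2 := L2) u0 u1 (abs_le.2 ⟨al1, al2⟩) (abs_le.2 ⟨w1, w2⟩) hL)
        refine ⟨⟨?_, ?_⟩, ?_, ?_⟩ <;> linarith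
      · rintro ⟨s, t⟩ _ ⟨s', t'⟩ _ h
        simp only [Prod.mk.injEq, hi] at h
        obtain ⟨e1, e2⟩ := h
        have e1' : s = s' := by omega
        subst e1'
        have e2' : t = t' := by omega
        rw [e2']
    have hcard' : (K1:ℝ) * K2 ≤ hfin.toFinset.card := by exact_mod_cast hcard
    have g1 : 3/20 * L1 ≤ K1 := by linarith
    have g2 : 2/5 * L2 ≤ K2 := by linarith
    have g3 : 3/20 * L1 * (2/5 * L2) ≤ K1 * K2 := mul_le_mul g1 g2 (by linarith) (by positivity)
    have g4 : (a:ℝ) * b ≤ (2.1 * L1) * (1.1 * L2) := mul_le_mul (by linarith) (by linarith) (by positivity) (by linarith)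
    have g5 : 0 ≤ L1 * L2 := mul_nonneg (by linarith) (by linarith)
    linarith
  · intro i j1 j2 j m1 m2 l1 l2
    rw [hmem, hiff] at *
    simp only at *
    have l1' : (j1:ℝ) ≤ j := by exact_mod_cast l1
    have l2' : (j:ℝ) ≤ j2 := by exact_mod_cast l2
    have := mul_le_mul_of_nonneg_left l1' u0.le
    have := mul_le_mul_of_nonneg_left l2' u0.le
    obtain ⟨⟨_, _⟩, _, _⟩ := m1
    obtain ⟨⟨_, _⟩, _, _⟩ := m2
    refine ⟨⟨?_, ?_⟩, ?_, ?_⟩ <;> linarith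

lemma slopes {u : ℕ → ℝ} (hu01 : ∀ k, u k ∈ Ioo (0:ℝ) 1) (hlac : ∃ l ∈ Ioo (0:ℝ) 1, ∀ k, u (k+1) ≤ l * u k) :
    ∃ (r : ℕ) (v : ℕ → ℕ → ℝ), (∀ c m, (1/2:ℝ)^(m+1) ≤ v c m ∧ v c m < (1/2:ℝ)^m) ∧
      ∀ k, ∃ c < r, ∃ m, u k = v c m := by
  classical
  obtain ⟨l, ⟨l0, l1⟩, hl⟩ := hlac
  obtain ⟨r, hr⟩ := exists_pow_lt_of_lt_one (show (0:ℝ) < 1/2 by norm_num) l1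
  have hr0 : 0 < r := by
    rcases Nat.eq_zero_or_pos r with h | h
    · rw [h] at hr; norm_num at hr
    · exact h
  have hstep : ∀ d k, u (k+d) ≤ l^d * u k := by
    intro d; induction d with
    | zero => intro k; simp
    | succ d ih =>
      intro k
      calc u (k+(d+1)) ≤ l * u (k+d) := hl (k+d)
        _ ≤ l * (l^d * u k) := mul_le_mul_of_nonneg_left (ih k) l0.le
        _ = _ := by ring
  have hm : ∀ k, ∃ m, (1/2:ℝ)^(m+1) ≤ u k ∧ u k < (1/2:ℝ)^m := by
    intro k
    have hex : ∃ m, (1/2:ℝ)^(m+1) ≤ u k := by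
      obtain ⟨m, hm⟩ := exists_pow_lt_of_lt_one (hu01 k).1 (show (1/2:ℝ) < 1 by norm_num)
      exact ⟨m, le_trans (pow_le_pow_of_le_one (by norm_num) (by norm_num) (by omega)) hm.le⟩
    refine ⟨Nat.find hex, Nat.find_spec hex, ?_⟩
    rcases h : Nat.find hex with _ | m
    · simpa using (hu01 k).2
    · have := Nat.find_min hex (m := m) (by omega)
      push Not at this
      exact this
  refine ⟨r, fun c m => if h : ∃ k, k % r = c ∧ (1/2:ℝ)^(m+1) ≤ u k ∧ u k < (1/2:ℝ)^m then u h.choose else (1/2)^(m+1),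
    fun c m => ?_, fun k => ?_⟩ <;> beta_reduce
  · split_ifs with h
    · exact h.choose_spec.2
    · exact ⟨le_rfl, pow_lt_pow_right_of_lt_one₀ (by norm_num) (by norm_num) (by omega)⟩
  · obtain ⟨m, m1, m2⟩ := hm k
    have h : ∃ k', k' % r = k % r ∧ (1/2:ℝ)^(m+1) ≤ u k' ∧ u k' < (1/2:ℝ)^m := ⟨k, rfl, m1, m2⟩
    refine ⟨k % r, Nat.mod_lt _ hr0, m, ?_⟩
    rw [dif_pos h]
    obtain ⟨s1, s2, s3⟩ := h.choose_spec
    have aux : ∀ x y : ℕ, x < y → x % r = y % r → (1/2:ℝ)^(m+1) ≤ u y → u x < (1/2:ℝ)^m → False := by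
      intro x y hxy hmod h1 h2
      have hge : x + r ≤ y := by
        have := (Nat.modEq_iff_dvd' hxy.le).1 (show x ≡ y [MOD r] from hmod)
        have := Nat.le_of_dvd (by omega) this
        omega
      obtain ⟨d, rfl⟩ := Nat.exists_eq_add_of_le hge
      have e1 := hstep d (x + r)
      have e2 := hstep r x
      have p1 : l^d ≤ 1 := pow_le_one₀ l0.le l1.le
      have p2 : u (x + r + d) ≤ u (x + r) := e1.trans (mul_le_of_le_one_left (hu01 _).1.le p1)
      have p3 : l^r * u x ≤ 1/2 * u x := mul_le_mul_of_nonneg_right hr.le (hu01 x).1.le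
      rw [pow_succ] at h1
      linarith
    rcases lt_trichotomy k h.choose with hlt | heq | hgt
    · exact (aux _ _ hlt s1.symm s2 m2).elim
    · rw [← heq]
    · exact (aux _ _ hgt s1 m1 s3).elim
end p11

section p12

def RD (v : ℕ → ℕ → ℝ) (r : ℕ) (G : Finset (ℤ × ℤ)) : Prop :=
  ∃ a b c m : ℕ, c < r ∧ 0 < a ∧ 0 < b ∧ (∀ z ∈ G, |z.1| ≤ a ∧ |(z.2:ℝ) - v c m * z.1| ≤ b) ∧
    (a:ℝ) * b ≤ 100 * G.card

open Classical in
lemma discC (n : ℕ) (hQ : QQ (n+2)) : ∃ C : ℝ, 0 ≤ C ∧ ∀ (r : ℕ) (v : ℕ → ℕ → ℝ)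
    (hv : ∀ c m, (1/2:ℝ)^(m+1) ≤ v c m ∧ v c m < (1/2:ℝ)^m)
    (φ : ℤ × ℤ → ℝ) (hφ : ∀ z, 0 ≤ φ z) (W Z : Finset (ℤ × ℤ)) (hW0 : ∀ z ∉ W, φ z = 0)
    (F : Finset ℕ) (G : ℕ → Finset (ℤ × ℤ)) (hG : ∀ i ∈ F, RD v r (G i))
    (hbad : ∀ z ∈ Z, ∃ i ∈ F, 204800 * ((G i).card : ℝ) < ∑ q ∈ G i, φ (q + z)),
    (Z.card : ℝ) ≤ r * C * ∑ w ∈ W, φ w ^ (((n:ℝ)+2)/(n+1)) := by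
  obtain ⟨C, hC0, hC⟩ := DM n hQ
  refine ⟨C, hC0, ?_⟩
  intro r v hv φ hφ W Z hW0 F G hG hbad
  have hG' : ∀ i, ∃ a b c m : ℕ, i ∈ F → (c < r ∧ 0 < a ∧ 0 < b ∧
    (∀ z ∈ G i, |z.1| ≤ a ∧ |(z.2:ℝ) - v c m * z.1| ≤ b) ∧ (a:ℝ) * b ≤ 100 * (G i).card) := by
    intro i
    by_cases hi : i ∈ F
    · obtain ⟨a, b, c, m, h⟩ := hG i hi
      exact ⟨a, b, c, m, fun _ => h⟩
    · exact ⟨0, 0, 0, 0, fun h => absurd h hi⟩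
  choose a b c m H using hG'
  let Zc : ℕ → Finset (ℤ × ℤ) := fun k => Z.filter (fun z => ∃ i ∈ F, c i = k ∧
    204800 * ((G i).card : ℝ) < ∑ q ∈ G i, φ (q + z))
  have hZ : Z ⊆ (rg r).biUnion Zc := by
    intro z hz
    obtain ⟨i, hi, h⟩ := hbad z hz
    exact Finset.mem_biUnion.2 ⟨c i, Finset.mem_range.2 (H i hi).1, Finset.mem_filter.2 ⟨hz, i, hi, rfl, h⟩⟩
  have hk : ∀ k ∈ rg r, ((Zc k).card : ℝ) ≤ C * ∑ w ∈ W, φ w ^ (((n:ℝ)+2)/(n+1)) := by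
    intro k hk
    refine hC (v k) (hv k) φ hφ W (Zc k) hW0 ((F.filter (fun i => c i = k)).image (fun i => (m i, a i, b i))) ?_ ?_
    · intro i hi
      obtain ⟨j, hj, rfl⟩ := Finset.mem_image.1 hi
      have := H j (Finset.mem_filter.1 hj).1
      exact ⟨this.2.1, this.2.2.1⟩
    · intro z hz
      obtain ⟨i, hi, hik, h⟩ := (Finset.mem_filter.1 hz).2
      refine ⟨(m i, a i, b i), Finset.mem_image.2 ⟨i, Finset.mem_filter.2 ⟨hi, hik⟩, rfl⟩, ?_⟩
      obtain ⟨-, ha, hb, hp, hab⟩ := H i hi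
      have h1 : 2048 * (a i:ℝ) * b i ≤ 204800 * ((G i).card : ℝ) := by nlinarith
      refine lt_of_le_of_lt h1 (lt_of_lt_of_le h ?_)
      have h2 : ∑ q ∈ G i, φ (q + z) = ∑ w ∈ (G i).image (fun q => q + z), φ w := by
        rw [Finset.sum_image]
        intro x _ y _ hxy
        exact add_right_cancel hxy
      have h3 : ∑ w ∈ (G i).image (fun q => q + z), φ w
          = ∑ w ∈ W, if w ∈ (G i).image (fun q => q + z) then φ w else 0 := by
        rw [← Finset.sum_filter, Finset.filter_mem_eq_inter, Finset.inter_comm]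
        refine (Finset.sum_subset Finset.inter_subset_left ?_).symm
        intro w hw hw'
        exact hW0 w (fun hw2 => hw' (Finset.mem_inter.2 ⟨hw, hw2⟩))
      rw [h2, h3]
      refine sum_le_sum fun w _ => ?_
      by_cases hw : w ∈ (G i).image (fun q => q + z)
      · rw [if_pos hw]
        obtain ⟨q, hq, rfl⟩ := Finset.mem_image.1 hw
        have hpq := hp q hq
        rw [if_pos]
        refine ⟨by simpa using hpq.1, ?_⟩
        have := hpq.2
        rw [hik] at this
        simpa using this
      · rw [if_neg hw]
        split_ifs
        · exact hφ w
        · exact le_rfl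
  calc (Z.card : ℝ) ≤ (((rg r).biUnion Zc).card : ℝ) := by exact_mod_cast Finset.card_le_card hZ
    _ ≤ ∑ k ∈ rg r, ((Zc k).card : ℝ) := by exact_mod_cast Finset.card_biUnion_le
    _ ≤ ∑ k ∈ rg r, C * ∑ w ∈ W, φ w ^ (((n:ℝ)+2)/(n+1)) := sum_le_sum hk
    _ = _ := by rw [Finset.sum_const, Finset.card_range, nsmul_eq_mul]; ring

variable {Y : Type*} [MeasurableSpace Y]

def Gam (S T : Y ≃ᵐ Y) (q : ℤ × ℤ) (x : Y) : Y := (S.toEquiv ^ q.1) ((T.toEquiv ^ q.2) x)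

lemma Gam_add (S T : Y ≃ᵐ Y) (hc : ∀ x, S (T x) = T (S x)) (q z : ℤ × ℤ) (x : Y) :
    Gam S T (q + z) x = Gam S T q (Gam S T z x) := by
  have h : Commute (S.toEquiv : Equiv.Perm Y) T.toEquiv := by
    ext x; exact hc x
  have h2 := (h.zpow_zpow z.1 q.2).eq
  have := congrArg (fun e : Equiv.Perm Y => e ((T.toEquiv ^ z.2) x)) h2
  simp only [Equiv.Perm.mul_apply] at this
  simp only [Gam, Prod.fst_add, Prod.snd_add, zpow_add, Equiv.Perm.mul_apply]
  rw [this]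

lemma zmp {μ : Measure Y} (S : Y ≃ᵐ Y) (h : MeasurePreserving S μ μ) (k : ℤ) :
    MeasurePreserving (⇑((S.toEquiv : Equiv.Perm Y) ^ k)) μ μ := by
  induction k using Int.induction_on with
  | zero => exact MeasurePreserving.id μ
  | succ i ih =>
    rw [zpow_add_one]
    exact ih.comp h
  | pred i ih =>
    rw [zpow_sub_one]
    exact ih.comp (h.symm S)

lemma Gam_mp {μ : Measure Y} {S T : Y ≃ᵐ Y} (hS : MeasurePreserving S μ μ)
    (hT : MeasurePreserving T μ μ) (q : ℤ × ℤ) : MeasurePreserving (Gam S T q) μ μ :=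
  (zmp S hS q.1).comp (zmp T hT q.2)

lemma Gam_zero (S T : Y ≃ᵐ Y) (x : Y) : Gam S T 0 x = x := by simp [Gam]

end p12

section p13

open Classical in
lemma transf (n : ℕ) (hQ : QQ (n+2)) : ∃ C : ℝ, 0 ≤ C ∧ ∀ (r : ℕ) (v : ℕ → ℕ → ℝ)
    (hv : ∀ c m, (1/2:ℝ)^(m+1) ≤ v c m ∧ v c m < (1/2:ℝ)^m)
    (Y : Type) [MeasurableSpace Y] (μ : Measure Y) (S T : Y ≃ᵐ Y)
    (hS : MeasurePreserving S μ μ) (hT : MeasurePreserving T μ μ) (hc : ∀ x, S (T x) = T (S x))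
    (f : Y → ℝ) (hf : Measurable f) (hf0 : ∀ x, 0 ≤ f x)
    (F : Finset ℕ) (G : ℕ → Finset (ℤ × ℤ)) (hG : ∀ i ∈ F, RD v r (G i)),
    μ {x | ∃ i ∈ F, 204800 * ((G i).card : ℝ) < ∑ q ∈ G i, f (Gam S T q x)} ≤
      ENNReal.ofReal (r * C * 4) * ∫⁻ x, ENNReal.ofReal (f x ^ (((n:ℝ)+2)/(n+1))) ∂μ := by
  obtain ⟨C, hC0, hC⟩ := discC n hQ
  refine ⟨C, hC0, ?_⟩
  intro r v hv Y _ μ S T hS hT hc f hf hf0 F G hG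
  set p := ((n:ℝ)+2)/(n+1)
  set E := {x | ∃ i ∈ F, 204800 * ((G i).card : ℝ) < ∑ q ∈ G i, f (Gam S T q x)} with hE
  have hEm : MeasurableSet E := by
    have : E = ⋃ i ∈ F, {x | 204800 * ((G i).card : ℝ) < ∑ q ∈ G i, f (Gam S T q x)} := by
      ext x; simp [hE]
    rw [this]
    refine Finset.measurableSet_biUnion _ fun i _ => ?_
    refine measurableSet_lt measurable_const ?_
    exact Finset.measurable_sum _ fun q _ => hf.comp (Gam_mp hS hT q).measurable
  obtain ⟨D, hD⟩ : ∃ D : ℕ, ∀ i ∈ F, ∀ q ∈ G i, |q.1| ≤ D ∧ |q.2| ≤ D := by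
    refine ⟨(F.biUnion G).sup (fun q => q.1.natAbs + q.2.natAbs), fun i hi q hq => ?_⟩
    have := Finset.le_sup (f := fun q : ℤ × ℤ => q.1.natAbs + q.2.natAbs)
      (Finset.mem_biUnion.2 ⟨i, hi, hq⟩)
    rw [Int.abs_eq_natAbs, Int.abs_eq_natAbs]
    omega
  let B : ℤ := 2 * D + 1
  let Q : Finset (ℤ × ℤ) := Finset.Ico 0 B ×ˢ Finset.Ico 0 B
  let W : Finset (ℤ × ℤ) := Finset.Ico (-(D:ℤ)) (B + D) ×ˢ Finset.Ico (-(D:ℤ)) (B + D)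
  have hQc : Q.card = (2 * D + 1) ^ 2 := by
    simp only [Q, Finset.card_product, Int.card_Ico, B]
    rw [sq]; congr 1
  have hWc : W.card ≤ 4 * (2 * D + 1) ^ 2 := by
    have : W.card = (4 * D + 1) ^ 2 := by
      simp only [W, Finset.card_product, Int.card_Ico, B]
      rw [sq]; congr 1 <;> omega
    rw [this]
    exact (Nat.pow_le_pow_left (show 4 * D + 1 ≤ 2 * (2 * D + 1) by omega) 2).trans (by rw [mul_pow]; norm_num)
  have key : ∀ x, ∑ z ∈ Q, (Gam S T z ⁻¹' E).indicator (fun _ => (1:ℝ≥0∞)) x ≤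
      ENNReal.ofReal (r * C) * ∑ w ∈ W, ENNReal.ofReal (f (Gam S T w x) ^ p) := by
    intro x
    have h := hC r v hv (fun z => if z ∈ W then f (Gam S T z x) else 0)
      (fun z => by split_ifs <;> simp [hf0]) W (Q.filter (fun z => Gam S T z x ∈ E))
      (fun z hz => if_neg hz) F G hG ?_
    · rw [← ENNReal.ofReal_sum_of_nonneg (fun w _ => Real.rpow_nonneg (hf0 _) _),
        ← ENNReal.ofReal_mul (by positivity)]
      have e1 : ∑ z ∈ Q, (Gam S T z ⁻¹' E).indicator (fun _ => (1:ℝ≥0∞)) x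
          = ENNReal.ofReal ((Q.filter (fun z => Gam S T z x ∈ E)).card : ℝ) := by
        rw [ENNReal.ofReal_natCast, Finset.card_filter]
        push_cast
        refine sum_congr rfl fun z _ => ?_
        simp [Set.indicator_apply]
      rw [e1]
      refine ENNReal.ofReal_le_ofReal (h.trans (le_of_eq ?_))
      congr 1
      refine sum_congr rfl fun w hw => ?_
      rw [if_pos hw]
    · intro z hz
      obtain ⟨hzQ, i, hi, hlt⟩ := Finset.mem_filter.1 hz
      refine ⟨i, hi, lt_of_lt_of_eq hlt (sum_congr rfl fun q hq => ?_)⟩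
      rw [if_pos, Gam_add S T hc]
      have h1 := hD i hi q hq
      simp only [Q, Finset.mem_product, Finset.mem_Ico] at hzQ
      simp only [W, Finset.mem_product, Finset.mem_Ico, Prod.fst_add, Prod.snd_add]
      have h3 := abs_le.1 h1.1
      have h4 := abs_le.1 h1.2
      omega
  have hint := lintegral_mono (μ := μ) key
  have hfm : Measurable fun x => ENNReal.ofReal (f x ^ p) := (hf.pow_const p).ennreal_ofReal
  rw [lintegral_finsetSum, lintegral_const_mul, lintegral_finsetSum] at hint
  rotate_left
  · exact fun w _ => hfm.comp (Gam_mp hS hT w).measurable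
  · exact Finset.measurable_sum _ fun w _ => hfm.comp (Gam_mp hS hT w).measurable
  · exact fun z _ => measurable_const.indicator ((Gam_mp hS hT z).measurable hEm)
  have e2 : ∀ z ∈ Q, ∫⁻ x, (Gam S T z ⁻¹' E).indicator (fun _ => (1:ℝ≥0∞)) x ∂μ = μ E := by
    intro z _
    rw [lintegral_indicator_const ((Gam_mp hS hT z).measurable hEm), one_mul,
      (Gam_mp hS hT z).measure_preimage hEm.nullMeasurableSet]
  have e3 : ∀ w ∈ W, ∫⁻ x, ENNReal.ofReal (f (Gam S T w x) ^ p) ∂μ = ∫⁻ x, ENNReal.ofReal (f x ^ p) ∂μ :=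
    fun w _ => (Gam_mp hS hT w).lintegral_comp hfm
  rw [sum_congr rfl e2, sum_congr rfl e3, Finset.sum_const, Finset.sum_const,
    nsmul_eq_mul, nsmul_eq_mul, hQc] at hint
  set I := ∫⁻ x, ENNReal.ofReal (f x ^ p) ∂μ
  set N : ℝ≥0∞ := (((2 * D + 1) ^ 2 : ℕ) : ℝ≥0∞) with hN
  have hN0 : N ≠ 0 := by rw [hN]; exact_mod_cast (by positivity : ((2 * D + 1)^2 : ℕ) ≠ 0)
  have hNt : N ≠ ⊤ := ENNReal.natCast_ne_top _
  have hW' : (W.card : ℝ≥0∞) ≤ 4 * N := by rw [hN]; exact_mod_cast hWc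
  have hfin : N * μ E ≤ N * (ENNReal.ofReal (r * C * 4) * I) := by
    refine hint.trans ?_
    rw [ENNReal.ofReal_mul (by positivity : 0 ≤ (r:ℝ) * C)]
    have : ENNReal.ofReal 4 = 4 := by simp
    rw [this]
    calc ENNReal.ofReal (r * C) * (W.card * I) ≤ ENNReal.ofReal (r * C) * (4 * N * I) := by gcongr
      _ = _ := by ring
  exact (ENNReal.mul_le_mul_iff_right hN0 hNt).1 hfin

end p13

section p14

lemma maxE (n : ℕ) (hQ : QQ (n+2)) : ∃ C : ℝ, 0 ≤ C ∧ ∀ (r : ℕ) (v : ℕ → ℕ → ℝ)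
    (hv : ∀ c m, (1/2:ℝ)^(m+1) ≤ v c m ∧ v c m < (1/2:ℝ)^m)
    (Y : Type) [MeasurableSpace Y] (μ : Measure Y) (S T : Y ≃ᵐ Y)
    (hS : MeasurePreserving S μ μ) (hT : MeasurePreserving T μ μ) (hc : ∀ x, S (T x) = T (S x))
    (h : Y → ℝ) (hh : Measurable h) (α : ℝ) (hα : 0 < α)
    (G : ℕ → Finset (ℤ × ℤ)) (N0 : ℕ) (hG : ∀ i, N0 ≤ i → RD v r (G i)),
    μ {x | ∃ i, N0 ≤ i ∧ α * ((G i).card : ℝ) < ∑ q ∈ G i, |h (Gam S T q x)|} ≤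
      ENNReal.ofReal (r * C * 4 * (204800 / α) ^ (((n:ℝ)+2)/(n+1))) *
        (eLpNorm h (ENNReal.ofReal (((n:ℝ)+2)/(n+1))) μ) ^ (((n:ℝ)+2)/(n+1)) := by
  obtain ⟨C, hC0, hC⟩ := transf n hQ
  refine ⟨C, hC0, ?_⟩
  intro r v hv Y _ μ S T hS hT hc h hh α hα G N0 hG
  have hp0 : 0 < ((n:ℝ)+2)/(n+1) := by positivity
  set p := ((n:ℝ)+2)/(n+1)
  let E : ℕ → Set Y := fun N => {x | ∃ i ∈ Finset.Ico N0 N,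
    204800 * ((G i).card : ℝ) < ∑ q ∈ G i, (204800 / α * |h (Gam S T q x)|)}
  have hEq : {x | ∃ i, N0 ≤ i ∧ α * ((G i).card : ℝ) < ∑ q ∈ G i, |h (Gam S T q x)|} = ⋃ N, E N := by
    ext x
    simp only [E, mem_ofPred_eq, mem_iUnion, Finset.mem_Ico]
    have : ∀ i, (204800 * ((G i).card : ℝ) < ∑ q ∈ G i, (204800 / α * |h (Gam S T q x)|)) ↔
        α * ((G i).card : ℝ) < ∑ q ∈ G i, |h (Gam S T q x)| := by
      intro i
      rw [← mul_sum, div_mul_eq_mul_div, lt_div_iff₀ hα]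
      constructor <;> intro hh <;> linarith
    simp only [this]
    constructor
    · rintro ⟨i, hi, hlt⟩
      exact ⟨i + 1, i, ⟨hi, by omega⟩, hlt⟩
    · rintro ⟨N, i, hi, hlt⟩
      exact ⟨i, hi.1, hlt⟩
  have hmono : Monotone E := by
    intro N M hNM x hx
    obtain ⟨i, hi, hlt⟩ := hx
    rw [Finset.mem_Ico] at hi
    exact ⟨i, Finset.mem_Ico.2 ⟨hi.1, by omega⟩, hlt⟩
  rw [hEq, hmono.measure_iUnion]
  refine iSup_le fun N => ?_
  have h1 := hC r v hv Y μ S T hS hT hc (fun x => 204800 / α * |h x|) (hh.abs.const_mul _)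
    (fun x => by positivity) (Finset.Ico N0 N) G (fun i hi => hG i (Finset.mem_Ico.1 hi).1)
  refine h1.trans (le_of_eq ?_)
  rw [eLpNorm_eq_lintegral_rpow_enorm_toReal (by simpa using hp0) ENNReal.ofReal_ne_top,
    ENNReal.toReal_ofReal hp0.le, ← ENNReal.rpow_mul, one_div, inv_mul_cancel₀ hp0.ne',
    ENNReal.rpow_one, ENNReal.ofReal_mul (q := (204800 / α) ^ p) (by positivity), mul_assoc (ENNReal.ofReal _),
    ← lintegral_const_mul (ENNReal.ofReal ((204800 / α) ^ p))]
  · congr 1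
    refine lintegral_congr fun x => ?_
    rw [Real.mul_rpow (by positivity) (abs_nonneg _), ENNReal.ofReal_mul (by positivity),
      ← ENNReal.ofReal_rpow_of_nonneg (abs_nonneg _) hp0.le, ← Real.norm_eq_abs, ofReal_norm]
  · exact hh.enorm.pow_const _

lemma tele (G : Finset (ℤ × ℤ)) (a : ℕ) (ha : ∀ z ∈ G, |z.1| ≤ a)
    (hG : ∀ i j1 j2 j : ℤ, (i,j1) ∈ G → (i,j2) ∈ G → j1 ≤ j → j ≤ j2 → (i,j) ∈ G)
    (g : ℤ × ℤ → ℝ) (K : ℝ) (hg : ∀ z, |g z| ≤ K) :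
    |∑ q ∈ G, (g q - g (q + (0,1)))| ≤ 2 * K * (2 * a + 1) := by
  classical
  set H := G.image (fun q => q + ((0:ℤ),(1:ℤ))) with hH
  have hmem : ∀ i j : ℤ, (i, j) ∈ H ↔ (i, j - 1) ∈ G := by
    intro i j
    simp only [hH, Finset.mem_image, Prod.exists, Prod.mk_add_mk, Prod.mk.injEq]
    constructor
    · rintro ⟨a, b, h, h1, h2⟩
      have : j - 1 = b := by omega
      rw [this, ← h1]; simpa using h
    · intro h
      exact ⟨i, j - 1, h, by omega, by omega⟩
  have hK : 0 ≤ K := (abs_nonneg _).trans (hg 0)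
  have e1 : ∑ q ∈ G, (g q - g (q + (0,1))) = ∑ q ∈ G \ H, g q - ∑ q ∈ H \ G, g q := by
    rw [Finset.sum_sdiff_sub_sum_sdiff, sum_sub_distrib]
    congr 1
    rw [hH, Finset.sum_image]
    intro x _ y _ hxy
    exact add_right_cancel hxy
  have card : ∀ A : Finset (ℤ × ℤ), (∀ z ∈ A, |z.1| ≤ a) → (∀ i j k : ℤ, (i,j) ∈ A → (i,k) ∈ A → ¬ j < k) →
      |∑ q ∈ A, g q| ≤ K * (2 * a + 1) := by
    intro A h1 h2
    have h3 : A.card ≤ (Finset.Icc (-(a:ℤ)) a).card := by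
      refine Finset.card_le_card_of_injOn Prod.fst (fun z hz => ?_) ?_
      · exact Finset.mem_coe.2 (Finset.mem_Icc.2 (abs_le.1 (h1 z hz)))
      · rintro ⟨i, j⟩ hz ⟨i', j'⟩ hw hzw
        simp only at hzw
        subst hzw
        have := h2 i j j' hz hw
        have := h2 i j' j hw hz
        congr 1; omega
    have h4 : A.card ≤ 2 * a + 1 := h3.trans (by rw [Int.card_Icc]; omega)
    calc |∑ q ∈ A, g q| ≤ ∑ q ∈ A, |g q| := Finset.abs_sum_le_sum_abs _ _
      _ ≤ ∑ q ∈ A, K := sum_le_sum fun q _ => hg q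
      _ = A.card * K := by rw [Finset.sum_const, nsmul_eq_mul]
      _ ≤ ((2 * a + 1 : ℕ) : ℝ) * K := by gcongr
      _ = _ := by push_cast; ring
  have c1 := card (G \ H) (fun z hz => ha z (Finset.mem_sdiff.1 hz).1) (by
    intro i j k hj hk hjk
    rw [Finset.mem_sdiff, hmem] at hj hk
    exact hk.2 (hG i j k (k - 1) hj.1 hk.1 (by omega) (by omega)))
  have c2 := card (H \ G) (fun z hz => by
    obtain ⟨i, j⟩ := z
    rw [Finset.mem_sdiff, hmem] at hz
    exact ha (i, j - 1) hz.1) (by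
    intro i j k hj hk hjk
    rw [Finset.mem_sdiff, hmem] at hj hk
    exact hj.2 (hG i (j-1) (k-1) j hj.1 hk.1 (by omega) (by omega)))
  rw [e1]
  refine (abs_sub _ _).trans ?_
  linarith

lemma meanE {Y : Type} [MeasurableSpace Y] (μ : Measure Y) [IsProbabilityMeasure μ] (T : Y ≃ᵐ Y)
    (hT : Ergodic T μ) (φ : SimpleFunc Y ℝ) (ε : ℝ) (hε : 0 < ε) :
    ∃ (c : ℝ) (g : Y → ℝ) (K : ℝ), Measurable g ∧ (∀ x, |g x| ≤ K) ∧
      eLpNorm (fun x => φ x - c - (g x - g (T x))) 2 μ ≤ ENNReal.ofReal ε := by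
  have hmp := hT.toMeasurePreserving
  obtain ⟨M, hM⟩ := φ.exists_forall_norm_le
  have hφ : MemLp φ 2 μ := MemLp.of_bound φ.aestronglyMeasurable M (Eventually.of_forall hM)
  let U := (Lp.compMeasurePreservingₗᵢ (E := ℝ) (p := 2) ℝ T hmp).toContinuousLinearMap
  let F0 : Lp ℝ 2 μ := hφ.toLp φ
  have hit : ∀ k, ((U^[k] F0 : Lp ℝ 2 μ) : Y → ℝ) =ᵐ[μ] fun x => φ (T^[k] x) := by
    intro k
    induction k with
    | zero => exact hφ.coeFn_toLp
    | succ k ih =>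
      rw [Function.iterate_succ_apply']
      refine (Lp.coeFn_compMeasurePreserving _ hmp).trans ?_
      have := hmp.quasiMeasurePreserving.ae_eq_comp ih
      refine this.trans (Eventually.of_forall fun x => ?_)
      simp only [Function.comp_apply, ← Function.iterate_succ_apply]
  have hsum : ∀ N, ((∑ k ∈ rg N, U^[k] F0 : Lp ℝ 2 μ) : Y → ℝ) =ᵐ[μ]
      fun x => ∑ k ∈ rg N, φ (T^[k] x) := by
    intro N
    induction N with
    | zero => simp only [Finset.range_zero, Finset.sum_empty]; exact Lp.coeFn_zero ℝ 2 μ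
    | succ N ih =>
      simp only [Finset.sum_range_succ]
      filter_upwards [Lp.coeFn_add (∑ k ∈ rg N, U^[k] F0) (U^[N] F0), ih, hit N] with x h1 h2 h3
      rw [h1, Pi.add_apply, h2, h3]
  have hlim := U.tendsto_birkhoffAverage_orthogonalProjection
    (LinearIsometry.norm_toContinuousLinearMap_le _) F0
  set P := (U.eqLocus (1 : Lp ℝ 2 μ →L[ℝ] Lp ℝ 2 μ)).orthogonalProjectionOnto F0
  have hP : U (P : Lp ℝ 2 μ) = P := P.2
  obtain ⟨c, hcP⟩ : ∃ c : ℝ, ((P : Lp ℝ 2 μ) : Y → ℝ) =ᵐ[μ] fun _ => c := by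
    refine hT.ae_eq_const_of_ae_eq_comp_ae (Lp.aestronglyMeasurable _) ?_
    have h1 := Lp.coeFn_compMeasurePreserving (P : Lp ℝ 2 μ) hmp
    have h2 : Lp.compMeasurePreserving T hmp (P : Lp ℝ 2 μ) = P := hP
    rw [h2] at h1
    exact h1.symm
  obtain ⟨N, hN1, hN⟩ : ∃ N : ℕ, 1 ≤ N ∧ ‖birkhoffAverage ℝ U _root_.id N F0 - (P : Lp ℝ 2 μ)‖ < ε := by
    have := (Metric.tendsto_atTop.1 hlim ε hε)
    obtain ⟨N, hN⟩ := this
    exact ⟨N + 1, by omega, by simpa [dist_eq_norm] using hN (N + 1) (by omega)⟩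
  let s : ℕ → Y → ℝ := fun k x => ∑ i ∈ rg k, φ (T^[i] x)
  have hTm : ∀ i, Measurable (T^[i]) := fun i => T.measurable.iterate i
  have hsd : ∀ k x, s k x - s k (T x) = φ x - φ (T^[k] x) := by
    intro k x
    have := birkhoffSum_apply_sub_birkhoffSum T φ k x
    simp only [birkhoffSum] at this
    simp only [s]; linarith
  refine ⟨c, fun x => (N:ℝ)⁻¹ * ∑ k ∈ rg N, s k x,
    (N:ℝ)⁻¹ * ∑ k ∈ rg N, ∑ i ∈ rg k, M, ?_, ?_, ?_⟩
  · exact (Finset.measurable_sum _ fun k _ => Finset.measurable_sum _ fun i _ =>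
      φ.measurable.comp (hTm i)).const_mul _
  · intro x
    rw [abs_mul, abs_of_nonneg (by positivity : (0:ℝ) ≤ (N:ℝ)⁻¹)]
    gcongr
    refine (Finset.abs_sum_le_sum_abs _ _).trans (sum_le_sum fun k _ => ?_)
    exact (Finset.abs_sum_le_sum_abs _ _).trans (sum_le_sum fun i _ => hM _)
  · have hae : (fun x => φ x - c - ((N:ℝ)⁻¹ * ∑ k ∈ rg N, s k x
        - (N:ℝ)⁻¹ * ∑ k ∈ rg N, s k (T x))) =ᵐ[μ]
        ((birkhoffAverage ℝ U _root_.id N F0 - (P : Lp ℝ 2 μ) : Lp ℝ 2 μ) : Y → ℝ) := by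
      simp only [birkhoffAverage, birkhoffSum, id]
      filter_upwards [Lp.coeFn_sub ((N:ℝ)⁻¹ • ∑ k ∈ rg N, U^[k] F0) (P : Lp ℝ 2 μ),
        Lp.coeFn_smul ((N:ℝ)⁻¹) (∑ k ∈ rg N, U^[k] F0), hsum N, hcP] with x h1 h2 h3 h4
      rw [h1, Pi.sub_apply, h2, Pi.smul_apply, h3, h4, ← mul_sub, ← sum_sub_distrib]
      simp only [hsd]
      rw [sum_sub_distrib, Finset.sum_const, Finset.card_range, nsmul_eq_mul, smul_eq_mul]
      have : (N:ℝ) ≠ 0 := by positivity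
      field_simp
      ring
    rw [eLpNorm_congr_ae hae, ← ENNReal.ofReal_toReal (Lp.eLpNorm_ne_top _), ← Lp.norm_def]
    exact ENNReal.ofReal_le_ofReal hN.le

end p14

section p15

lemma cauchyE (n : ℕ) (hQ : QQ (n+2)) (r : ℕ) (v : ℕ → ℕ → ℝ)
    (hv : ∀ c m, (1/2:ℝ)^(m+1) ≤ v c m ∧ v c m < (1/2:ℝ)^m)
    (Y : Type) [MeasurableSpace Y] (μ : Measure Y) [IsProbabilityMeasure μ] (S T : Y ≃ᵐ Y)
    (hS : MeasurePreserving S μ μ) (hT : Ergodic T μ) (hc : ∀ x, S (T x) = T (S x))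
    (f : Y → ℝ) (hfm : Measurable f) (hf : MemLp f (ENNReal.ofReal (((n:ℝ)+2)/(n+1))) μ)
    (G : ℕ → Finset (ℤ × ℤ)) (N0 : ℕ) (hG : ∀ i, N0 ≤ i → RD v r (G i))
    (hG0 : ∀ i, N0 ≤ i → 0 < (G i).card) (β : ℕ → ℝ) (hβ : Tendsto β atTop (𝓝 0))
    (htel : ∀ i, N0 ≤ i → ∀ (g : ℤ × ℤ → ℝ) (K : ℝ), (∀ z, |g z| ≤ K) →
      |∑ q ∈ G i, (g q - g (q + (0,1)))| ≤ K * β i * (G i).card) :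
    ∀ᵐ x ∂μ, ∃ L : ℝ, Tendsto (fun i => ((G i).card : ℝ)⁻¹ * ∑ q ∈ G i, f (Gam S T q x)) atTop (𝓝 L) := by
  obtain ⟨C, hC0, hC⟩ := maxE n hQ
  have hp1 : 1 ≤ ((n:ℝ)+2)/(n+1) := by rw [one_le_div (by positivity)]; linarith
  have hp2 : ((n:ℝ)+2)/(n+1) ≤ 2 := by
    rw [div_le_iff₀ (by positivity)]; nlinarith [(Nat.cast_nonneg n : (0:ℝ) ≤ n)]
  set p := ((n:ℝ)+2)/(n+1)
  have hTm := hT.toMeasurePreserving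
  set A : ℕ → Y → ℝ := fun i x => ((G i).card : ℝ)⁻¹ * ∑ q ∈ G i, f (Gam S T q x) with hA
  have main : ∀ δ : ℝ, 0 < δ → ∀ᵐ x ∂μ, ∃ N, ∀ i, N ≤ i → ∀ j, N ≤ j → |A i x - A j x| ≤ δ := by
    intro δ hδ
    rw [ae_iff]
    set D := ENNReal.ofReal (r * C * 4 * (204800 / (δ/3)) ^ p)
    have hlim : Tendsto (fun k : ℕ => D * (ENNReal.ofReal (1 / ((k:ℝ) + 1))) ^ p) atTop (𝓝 0) := by
      have h1 : Tendsto (fun k : ℕ => ENNReal.ofReal (1 / ((k:ℝ) + 1))) atTop (𝓝 0) := by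
        rw [← ENNReal.ofReal_zero]
        exact ENNReal.tendsto_ofReal tendsto_one_div_add_atTop_nhds_zero_nat
      have h2 := (ENNReal.continuous_rpow_const (y := p)).tendsto 0 |>.comp h1
      rw [ENNReal.zero_rpow_of_pos (by linarith)] at h2
      simpa using ENNReal.Tendsto.const_mul h2 (Or.inr (ENNReal.ofReal_ne_top : D ≠ ⊤))
    refine le_antisymm (ge_of_tendsto' hlim fun k => ?_) zero_le
    set ε := 1 / ((k:ℝ) + 1)
    have hε : 0 < ε := by positivity
    obtain ⟨φ, hφ, hφ2⟩ := hf.exists_simpleFunc_eLpNorm_sub_lt ENNReal.ofReal_ne_top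
      (ε := ENNReal.ofReal (ε/2)) (by simpa using hε)
    obtain ⟨c, g, K, hgm, hgK, hg⟩ := meanE μ T hT φ (ε/2) (by positivity)
    let h : Y → ℝ := fun x => f x - c - (g x - g (T x))
    have hhm : Measurable h := (hfm.sub_const c).sub (hgm.sub (hgm.comp T.measurable))
    have hwm : Measurable (fun x => φ x - c - (g x - g (T x))) :=
      (φ.measurable.sub_const c).sub (hgm.sub (hgm.comp T.measurable))
    have hh : eLpNorm h (ENNReal.ofReal p) μ ≤ ENNReal.ofReal ε := by
      have e : h = (f - ⇑φ) + (fun x => φ x - c - (g x - g (T x))) := by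
        ext x; simp only [h, Pi.add_apply, Pi.sub_apply]; ring
      rw [e]
      refine (eLpNorm_add_le (hfm.sub φ.measurable).aestronglyMeasurable hwm.aestronglyMeasurable
        (by rw [← ENNReal.ofReal_one]; exact ENNReal.ofReal_le_ofReal hp1)).trans ?_
      have h2 : ENNReal.ofReal p ≤ 2 := by
        rw [show (2:ℝ≥0∞) = ENNReal.ofReal 2 by simp]; exact ENNReal.ofReal_le_ofReal hp2
      have := (eLpNorm_le_eLpNorm_of_exponent_le h2 hwm.aestronglyMeasurable (μ := μ)).trans hg
      refine (add_le_add hφ.le this).trans (le_of_eq ?_)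
      rw [← ENNReal.ofReal_add (by positivity) (by positivity)]
      congr 1; ring
    have hm := hC r v hv Y μ S T hS hTm hc h hhm (δ/3) (by positivity) G N0 hG
    refine le_trans (measure_mono ?_) (hm.trans ?_)
    · intro x hx
      by_contra hcon
      apply hx
      simp only [mem_ofPred_eq, not_exists, not_and, not_lt] at hcon
      have hKβ : Tendsto (fun i => K * β i) atTop (𝓝 0) := by simpa using hβ.const_mul K
      obtain ⟨N1, hN1⟩ := (hKβ.eventually_lt_const (show (0:ℝ) < δ/6 by positivity)).exists_forall_of_atTop
      have hb : ∀ i, max N0 N1 ≤ i → |A i x - c| ≤ δ/2 := by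
        intro i hi
        have hi0 : N0 ≤ i := le_trans (le_max_left _ _) hi
        have hcp : (0:ℝ) < (G i).card := by exact_mod_cast hG0 i hi0
        have t1 := htel i hi0 (fun z => g (Gam S T z x)) K (fun z => hgK _)
        have t2 := hcon i hi0
        have t3 := hN1 i (le_trans (le_max_right _ _) hi)
        have hTG : ∀ q, Gam S T (q + (0,1)) x = T (Gam S T q x) := by
          intro q
          rw [add_comm, Gam_add S T hc]
          simp [Gam]
        have e1 : ∑ q ∈ G i, f (Gam S T q x) = ∑ q ∈ G i, h (Gam S T q x) + (G i).card * c
            + ∑ q ∈ G i, (g (Gam S T q x) - g (Gam S T (q + (0,1)) x)) := by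
          rw [← nsmul_eq_mul, ← Finset.sum_const, ← sum_add_distrib, ← sum_add_distrib]
          refine sum_congr rfl fun q _ => ?_
          rw [hTG]; simp only [h]; ring
        have t4 := (Finset.abs_sum_le_sum_abs (fun q => h (Gam S T q x)) (G i)).trans t2
        have e2 : A i x - c = (∑ q ∈ G i, h (Gam S T q x)
            + ∑ q ∈ G i, (g (Gam S T q x) - g (Gam S T (q + (0,1)) x))) / (G i).card := by
          simp only [hA]; rw [e1]; field_simp; ring
        rw [e2, abs_div, abs_of_pos hcp, div_le_iff₀ hcp]
        refine (abs_add_le _ _).trans ((add_le_add t4 t1).trans ?_)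
        nlinarith
      refine ⟨max N0 N1, fun i hi j hj => ?_⟩
      have h1 := abs_le.1 (hb i hi)
      have h2 := abs_le.1 (hb j hj)
      exact abs_le.2 ⟨by linarith, by linarith⟩
    · gcongr
  have hall : ∀ᵐ x ∂μ, ∀ k : ℕ, ∃ N, ∀ i, N ≤ i → ∀ j, N ≤ j → |A i x - A j x| ≤ 1 / ((k:ℝ) + 1) :=
    ae_all_iff.2 fun k => main _ (by positivity)
  filter_upwards [hall] with x hx
  refine cauchySeq_tendsto_of_complete (Metric.cauchySeq_iff.2 fun ε hε => ?_)
  obtain ⟨k, hk⟩ := exists_nat_one_div_lt hε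
  obtain ⟨N, hN⟩ := hx k
  exact ⟨N, fun i hi j hj => (hN i hi j hj).trans_lt hk⟩

lemma stmt5_aux (R : ℕ → Rect) (hR : IsProcess R)
    (u : ℕ → ℝ) (hu01 : ∀ k, u k ∈ Set.Ioo (0 : ℝ) 1)
    (hlac : ∃ l ∈ Set.Ioo (0 : ℝ) 1, ∀ k, u (k + 1) ≤ l * u k)
    (hslope : ∀ n, ∃ k, (R n).slope = u k)
    (p : ℝ≥0∞) (hp : 1 < p) :
    IsGoodProcess R p := by
  intro Y _ μ S T hE f hf
  haveI := hE.prob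
  obtain ⟨r, v, hv, hvu⟩ := slopes hu01 hlac
  obtain ⟨n, hQ, hnp⟩ : ∃ n, QQ (n+2) ∧ ENNReal.ofReal (((n:ℝ)+2)/(n+1)) ≤ p := by
    have hl : Tendsto (fun n : ℕ => ENNReal.ofReal (1 + 1 / ((n:ℝ)+1))) atTop (𝓝 1) := by
      rw [← ENNReal.ofReal_one]
      refine ENNReal.tendsto_ofReal ?_
      simpa using tendsto_one_div_add_atTop_nhds_zero_nat.const_add (1:ℝ)
    obtain ⟨N, hN⟩ := (hl.eventually_lt_const hp).exists_forall_of_atTop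
    obtain ⟨n, hn, hQ⟩ := Qall N
    refine ⟨n, hQ, le_trans (le_of_eq ?_) (hN n hn).le⟩
    congr 1
    field_simp
    ring
  obtain ⟨N0, hN0⟩ := (hR.2.eventually_ge_atTop 10).exists_forall_of_atTop
  have hgeo : ∀ i, ∃ (G : Finset (ℤ × ℤ)) (β : ℝ), N0 ≤ i → (latticePts (R i).carrier = ↑G ∧ RD v r G ∧
      0 < G.card ∧ 0 ≤ β ∧ β * (R i).shortSide ≤ 600 ∧ ∀ (g : ℤ × ℤ → ℝ) (K : ℝ), (∀ z, |g z| ≤ K) →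
      |∑ q ∈ G, (g q - g (q + (0,1)))| ≤ K * β * G.card) := by
    intro i
    by_cases hi : N0 ≤ i
    swap
    · exact ⟨∅, 0, fun h => absurd h hi⟩
    obtain ⟨k, hk⟩ := hslope i
    obtain ⟨G, a, b, h1, ha, hb, hlb, hz, hab, hcol⟩ := geom (R i) (hR.1 i) (hu01 k) hk (hN0 i hi)
    obtain ⟨c, hc, m, hm⟩ := hvu k
    have ha' : (1:ℝ) ≤ a := by exact_mod_cast ha
    have hb' : (1:ℝ) ≤ b := by exact_mod_cast hb
    refine ⟨G, 600 / b, fun _ => ⟨h1, ⟨a, b, c, m, hc, ha, hb, ?_, hab⟩, ?_, by positivity, ?_, ?_⟩⟩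
    · rw [← hm]; exact hz
    · by_contra h0
      have : G.card = 0 := by omega
      rw [this] at hab
      push_cast at hab
      nlinarith
    · rw [div_mul_eq_mul_div, div_le_iff₀ (by linarith)]
      linarith
    · intro g K hg
      have hK : 0 ≤ K := (abs_nonneg _).trans (hg 0)
      refine (tele G a (fun z hzG => (hz z hzG).1) hcol g K hg).trans ?_
      have h3 : 2 * (2 * (a:ℝ) + 1) ≤ 600 / b * G.card := by
        rw [div_mul_eq_mul_div, le_div_iff₀ (by linarith)]
        nlinarith
      nlinarith
  choose G β H using hgeo
  set f' := hf.1.mk f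
  have hff' : f =ᵐ[μ] f' := hf.1.ae_eq_mk
  have hf' : MemLp f' p μ := (memLp_congr_ae hff').1 hf
  have hfm : Measurable f' := hf.1.stronglyMeasurable_mk.measurable
  have hβ : Tendsto (fun i => if N0 ≤ i then β i else 0) atTop (𝓝 0) := by
    have h0 : Tendsto (fun i => 600 / (R i).shortSide) atTop (𝓝 0) := hR.2.const_div_atTop 600
    refine squeeze_zero' (Eventually.of_forall fun i => ?_) ?_ h0
    · split_ifs with hi
      · exact (H i hi).2.2.2.1
      · exact le_rfl
    · filter_upwards [eventually_ge_atTop N0] with i hi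
      rw [if_pos hi, le_div_iff₀ (by linarith [hN0 i hi])]
      exact (H i hi).2.2.2.2.1
  have hmain := cauchyE n hQ r v hv Y μ S T hE.measPres_S hE.erg_T hE.comm f' hfm
    (hf'.mono_exponent hnp) G N0 (fun i hi => (H i hi).2.1) (fun i hi => (H i hi).2.2.1) _ hβ
    (fun i hi g K hg => by rw [if_pos hi]; exact (H i hi).2.2.2.2.2 g K hg)
  have hae : ∀ᵐ x ∂μ, ∀ q : ℤ × ℤ, f (Gam S T q x) = f' (Gam S T q x) :=
    ae_all_iff.2 fun q => (Gam_mp hE.measPres_S hE.measPres_T q).quasiMeasurePreserving.ae hff'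
  filter_upwards [hmain, hae] with x hx hx2
  obtain ⟨L, hL⟩ := hx
  refine ⟨L, hL.congr' ?_⟩
  filter_upwards [eventually_ge_atTop N0] with i hi
  rw [ergAvg, latticeCount, (H i hi).1, Set.ncard_coe_finset, finsum_mem_coe_finset]
  congr 1
  exact sum_congr rfl fun q _ => (hx2 q).symm

end p15


end helpers

/-- a process with slopes in a lacunary subset of `(0,1)` converging to
`0` is a `p`-good process for every `1 < p ≤ ∞`. -/
theorem stmt5 (R : ℕ → Rect) (hR : IsProcess R)
    (u : ℕ → ℝ) (hu01 : ∀ k, u k ∈ Set.Ioo (0 : ℝ) 1)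
    (hlac : ∃ l ∈ Set.Ioo (0 : ℝ) 1, ∀ k, u (k + 1) ≤ l * u k)
    (hu0 : Tendsto u atTop (𝓝 0))
    (hslope : ∀ n, ∃ k, (R n).slope = u k)
    (p : ℝ≥0∞) (hp : 1 < p) :
    IsGoodProcess R p := by
  exact stmt5_aux R hR u hu01 hlac hslope p hp

end
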